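/- Dual inequality for exact controllability at any time T > T_opt in the time-analytic setting (consequence of Theorem 1.4 of the paper, restricted to classical adjoint solutions). Let m ≥ k ≥ 1 and n = k+m. Let λ₁,…,λ_{k+m} : [0,1] → (0,∞) be C² functions with λ₁(x) > ⋯ > λ_k(x) > 0 and 0 < λ_{k+1}(x) < ⋯ < λ_{k+m}(x) for every x; set Σ(x) = diag(−λ₁(x),…,−λ_k(x), λ_{k+1}(x),…,λ_{k+m}(x)), Σ₋(x), Σ₊(x) its negative and positive diagonal blocks, τ_i = ∫₀¹ dx/λ_i(x), T₁ = τ_k + τ_{k+1}, and T_opt = max{τ₁+τ_{m+1}, …, τ_k+τ_{m+k}, τ_{k+1}}. Let B ∈ ℝ^{k×m} be such that for every 1 ≤ i ≤ k the i×i matrix formed from the last i rows and the last i columns of B is invertible. Let C : ℝ × [0,1] → ℝ^{n×n} be continuous and such that the map t ↦ C(t,·) is real-analytic on some open interval I containing [T_opt − T₁, T_opt], as a map into the Banach space C([0,1]; ℝ^{n×n}) with the supremum norm. Then for every T > T_opt there exists a constant c_T > 0 such that every continuously differentiable v : [0,T] × [0,1] → ℝⁿ satisfying ∂_t v(t,x)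 = Σ(x) ∂_x v(t,x) + (Σ′(x) − C(t,x)ᵀ) v(t,x) on [0,T] × [0,1], v₋(t,1) = 0 for all t, and Σ₊(0) v₊(t,0) = −Bᵀ Σ₋(0) v₋(t,0) for all t, obeys ∫₀ᵀ |v₊(t,1)|² dt ≥ c_T ∫₀¹ |v(T,x)|² dx. -/

import Mathlib

open Set

namespace HypObs
open Set

theorem offdiag {κ f : ℝ → ℝ} {q K A ε δ : ℝ} (hδ : 0 < δ) (hK : 0 ≤ K) (n : ℕ) :
    ∀ p : ℝ, p ≤ q → ContinuousOn κ (Icc p q) → ContinuousOn f (Icc p q) →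
    (∀ y ∈ Icc p q, |κ y| ≤ K) →
    (∀ y ∈ Icc p q, ∀ y' ∈ Icc p q, |y - y'| ≤ δ → |κ y - κ y'| ≤ ε) →
    (∀ y ∈ Icc p q, ∀ y' ∈ Icc p q, |∫ x in y..y', f x| ≤ A) →
    q - p ≤ n * δ →
    |∫ x in p..q, κ x * f x| ≤ n * (K * A) + ε * ∫ x in p..q, |f x| := by
  have key : ∀ p q : ℝ, p ≤ q → ContinuousOn κ (Icc p q) → ContinuousOn f (Icc p q) →
    (∀ y ∈ Icc p q, |κ y| ≤ K) →
    (∀ y ∈ Icc p q, ∀ y' ∈ Icc p q, |y - y'| ≤ δ → |κ y - κ y'| ≤ ε) →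
    (∀ y ∈ Icc p q, ∀ y' ∈ Icc p q, |∫ x in y..y', f x| ≤ A) →
    q - p ≤ δ →
    |∫ x in p..q, κ x * f x| ≤ K * A + ε * ∫ x in p..q, |f x| := by
    intro p q hpq hκ hf hbK hosc hA hl
    have hp : p ∈ Icc p q := left_mem_Icc.2 hpq
    have hq : q ∈ Icc p q := right_mem_Icc.2 hpq
    have e1 : ∫ x in p..q, κ x * f x
        = κ p * (∫ x in p..q, f x) + ∫ x in p..q, (κ x - κ p) * f x := by
      rw [← intervalIntegral.integral_const_mul, ← intervalIntegral.integral_add]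
      · congr 1; ext x; ring
      · exact ((hf.const_smul (κ p)).intervalIntegrable_of_Icc hpq)
      · exact (((hκ.sub continuousOn_const).mul hf).intervalIntegrable_of_Icc hpq)
    rw [e1]
    refine (abs_add_le _ _).trans (add_le_add ?_ ?_)
    · rw [abs_mul]
      exact mul_le_mul (hbK p hp) (hA p hp q hq) (abs_nonneg _) hK
    · rw [← intervalIntegral.integral_const_mul]
      refine (intervalIntegral.abs_integral_le_integral_abs hpq).trans ?_
      refine intervalIntegral.integral_mono_on hpq ?_ ?_ ?_
      · exact (((hκ.sub continuousOn_const).mul hf).abs.intervalIntegrable_of_Icc hpq)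
      · exact ((hf.abs.const_smul ε).intervalIntegrable_of_Icc hpq)
      · intro x hx
        rw [abs_mul]
        refine mul_le_mul_of_nonneg_right (hosc x hx p hp ?_) (abs_nonneg _)
        rw [abs_of_nonneg (by linarith [hx.1])]; linarith [hx.2]
  induction n with
  | zero =>
    intro p hpq _ _ _ _ _ h
    have : q = p := by
      have : q - p ≤ 0 := by simpa using h
      linarith
    subst this; simp
  | succ n ih =>
    intro p hpq hκ hf hbK hosc hA hl
    have hA0 : 0 ≤ A := (abs_nonneg _).trans (hA p (left_mem_Icc.2 hpq) p (left_mem_Icc.2 hpq))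
    rcases le_total (q - p) δ with h | h
    · refine (key p q hpq hκ hf hbK hosc hA h).trans ?_
      have : 0 ≤ (n : ℝ) * (K * A) := by positivity
      push_cast; nlinarith
    · have h1 : p ≤ p + δ := by linarith
      have h2 : p + δ ≤ q := by linarith
      have s1 : Icc p (p + δ) ⊆ Icc p q := Icc_subset_Icc_right h2
      have s2 : Icc (p + δ) q ⊆ Icc p q := Icc_subset_Icc_left h1
      have a1 := key p (p + δ) h1 (hκ.mono s1) (hf.mono s1) (fun y hy => hbK y (s1 hy))
        (fun y hy y' hy' => hosc y (s1 hy) y' (s1 hy')) (fun y hy y' hy' => hA y (s1 hy) y' (s1 hy'))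
        (by linarith)
      have a2 := ih (p + δ) h2 (hκ.mono s2) (hf.mono s2) (fun y hy => hbK y (s2 hy))
        (fun y hy y' hy' => hosc y (s2 hy) y' (s2 hy')) (fun y hy y' hy' => hA y (s2 hy) y' (s2 hy'))
        (by push_cast at hl; linarith)
      have i1 : ∫ x in p..q, κ x * f x = (∫ x in p..(p+δ), κ x * f x) + ∫ x in (p+δ)..q, κ x * f x := by
        rw [intervalIntegral.integral_add_adjacent_intervals]
        · exact (((hκ.mul hf).mono s1).intervalIntegrable_of_Icc h1)
        · exact (((hκ.mul hf).mono s2).intervalIntegrable_of_Icc h2)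
      have i2 : ∫ x in p..q, |f x| = (∫ x in p..(p+δ), |f x|) + ∫ x in (p+δ)..q, |f x| := by
        rw [intervalIntegral.integral_add_adjacent_intervals]
        · exact ((hf.abs.mono s1).intervalIntegrable_of_Icc h1)
        · exact ((hf.abs.mono s2).intervalIntegrable_of_Icc h2)
      rw [i1, i2]
      refine (abs_add_le _ _).trans ?_
      push_cast
      linarith

theorem diag_step {u : ℝ → ℝ} {p q E μ δ : ℝ} (hμ : 0 ≤ μ) (hμδ : 2 * μ * δ ≤ 1)
    (hu : ContinuousOn u (Icc p q))
    (h : ∀ y ∈ Icc p q, ∀ y' ∈ Icc p q, |u y - u y'| ≤ E + μ * abs (∫ x in y'..y, |u x|))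
    {y y' : ℝ} (hy : y ∈ Icc p q) (hy' : y' ∈ Icc p q) (hd : |y - y'| ≤ δ) :
    |u y| ≤ 2 * (|u y'| + E) := by
  have hsub : uIcc y' y ⊆ Icc p q := uIcc_subset_Icc hy' hy
  obtain ⟨z, hz, hmax⟩ := isCompact_uIcc.exists_isMaxOn (nonempty_uIcc (a := y') (b := y))
    ((hu.mono hsub).abs)
  have hmax' : ∀ x ∈ uIcc y' y, |u x| ≤ |u z| := fun x hx => hmax hx
  have h1 := h z (hsub hz) y' hy'
  have h2 : abs (∫ x in y'..z, |u x|) ≤ |u z| * |z - y'| := by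
    have := intervalIntegral.norm_integral_le_of_norm_le_const (a := y') (b := z)
      (f := fun x => |u x|) (C := |u z|) (fun x hx => by
        rw [Real.norm_eq_abs, abs_abs]
        exact hmax' x (uIcc_subset_uIcc_left hz (uIoc_subset_uIcc hx)))
    simpa using this
  have h3 : |z - y'| ≤ δ := by
    refine le_trans ?_ hd
    exact Set.abs_sub_left_of_mem_uIcc hz
  have h4 : |u z| ≤ |u y'| + E + μ * (|u z| * δ) := by
    have : |u z| ≤ |u y'| + |u z - u y'| := by
      have := abs_add_le (u y') (u z - u y'); simpa using this
    have h5 : μ * abs (∫ x in y'..z, |u x|) ≤ μ * (|u z| * δ) := by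
      refine mul_le_mul_of_nonneg_left (h2.trans ?_) hμ
      exact mul_le_mul_of_nonneg_left h3 (abs_nonneg _)
    linarith
  have h6 : |u y| ≤ |u z| := hmax' y right_mem_uIcc
  nlinarith [abs_nonneg (u z)]

theorem diag {u : ℝ → ℝ} {p q E μ δ : ℝ} (hμ : 0 ≤ μ) (hδ : 0 < δ) (hμδ : 2 * μ * δ ≤ 1) (hE : 0 ≤ E)
    (hu : ContinuousOn u (Icc p q))
    (h : ∀ y ∈ Icc p q, ∀ y' ∈ Icc p q, |u y - u y'| ≤ E + μ * abs (∫ x in y'..y, |u x|)) (n : ℕ) :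
    ∀ y ∈ Icc p q, ∀ y' ∈ Icc p q, |y - y'| ≤ n * δ →
    |u y| ≤ 4 ^ n * (|u y'| + E) := by
  induction n with
  | zero =>
    intro y hy y' hy' hd
    have : y = y' := by
      have : |y - y'| ≤ 0 := by simpa using hd
      have := abs_nonpos_iff.1 this; linarith
    subst this; simp; exact hE
  | succ n ih =>
    intro y hy y' hy' hd
    push_cast at hd
    have hpos : (0:ℝ) ≤ 4 ^ n := by positivity
    have hone : (1:ℝ) ≤ 4 ^ n := one_le_pow₀ (by norm_num)
    obtain ⟨y'', hy'', hd1, hd2⟩ : ∃ y'' ∈ Icc p q, |y - y''| ≤ δ ∧ |y'' - y'| ≤ n * δ := by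
      have hn : 0 ≤ (n:ℝ) * δ := by positivity
      rcases le_total |y - y'| δ with hh | hh
      · exact ⟨y', hy', hh, by simpa using hn⟩
      · rcases le_total y y' with hc | hc
        · rw [abs_of_nonpos (by linarith)] at hd hh
          refine ⟨y + δ, ⟨by linarith [hy.1], by linarith [hy'.2]⟩, ?_, ?_⟩
          · rw [abs_le]; constructor <;> linarith
          · rw [abs_le]; constructor <;> linarith
        · rw [abs_of_nonneg (by linarith)] at hd hh
          refine ⟨y - δ, ⟨by linarith [hy'.1], by linarith [hy.2]⟩, ?_, ?_⟩
          · rw [abs_le]; constructor <;> linarith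
          · rw [abs_le]; constructor <;> linarith
    have a1 := diag_step hμ hμδ hu h hy hy'' hd1
    have a2 := ih y'' hy'' y' hy' hd2
    rw [pow_succ]
    nlinarith [abs_nonneg (u y')]

end HypObs
namespace HypObs
open Set

structure Sys (ι : Type) [Fintype ι] where
  S : ι → ℝ → ℝ
  hS : ∀ i, Continuous (S i)
  sgn : ∀ i, (∀ x, 0 < S i x) ∨ (∀ x, S i x < 0)
  dist : ∀ i j, i ≠ j → ∀ x, S i x ≠ S j x
  T : ℝ
  Topt : ℝ
  hT0 : 0 < Topt
  hT : Topt < T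
  M : ℕ → ι → ι → ℝ → ℝ → ℝ
  hM : ∀ l i j, ContinuousOn (fun p : ℝ × ℝ => M l i j p.1 p.2) (Icc 0 T ×ˢ Icc 0 1)
  hMd : ∀ l i j, ∀ t ∈ Icc 0 T, ∀ x ∈ Icc (0:ℝ) 1,
    HasDerivWithinAt (fun s => M l i j s x) ((l + 1 : ℝ) * M (l + 1) i j t x) (Icc 0 T) t
  A : ℝ
  R : ℝ
  hA : 0 ≤ A
  hR : 1 ≤ R
  hMb : ∀ l i j, ∀ t ∈ Icc 0 T, ∀ x ∈ Icc (0:ℝ) 1, |M l i j t x| ≤ A * R ^ l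
  Bd : Submodule ℝ (ι → ℝ)
  CB : ℝ
  hCB : 0 ≤ CB
  hΘ : ∀ i, |∫ y in (0:ℝ)..1, S i y| ≤ Topt
  BP : ∀ β t e : ℝ, Topt ≤ β → t ∈ Icc 0 β → 0 ≤ e → ∀ y ∈ Bd,
    (∀ i, t - (∫ x in (0:ℝ)..1, S i x) ∈ Icc 0 β → |y i| ≤ e) → ∀ i, |y i| ≤ CB * e

variable {ι : Type} [Fintype ι]

namespace Sys
variable (s : Sys ι)

noncomputable def Θ (i : ι) (x : ℝ) : ℝ := ∫ y in (0:ℝ)..x, s.S i y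

theorem Θ_zero (i : ι) : s.Θ i 0 = 0 := by simp [Θ]

theorem Θ_deriv (i : ι) (x : ℝ) : HasDerivAt (s.Θ i) (s.S i x) x :=
  intervalIntegral.integral_hasDerivAt_right ((s.hS i).intervalIntegrable _ _)
    ((s.hS i).stronglyMeasurableAtFilter _ _) (s.hS i).continuousAt

theorem Θ_cont (i : ι) : Continuous (s.Θ i) :=
  continuous_iff_continuousAt.2 fun x => (s.Θ_deriv i x).continuousAt

theorem Θ_mono (i : ι) : Monotone (s.Θ i) ∨ Antitone (s.Θ i) := by
  rcases s.sgn i with h | h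
  · left
    exact monotone_of_hasDerivAt_nonneg (s.Θ_deriv i) (fun x => (h x).le)
  · right
    exact antitone_of_hasDerivAt_nonpos (s.Θ_deriv i) (fun x => (h x).le)

theorem Θ_between (i : ι) {c β y0 y1 y : ℝ} (h0 : c - s.Θ i y0 ∈ Icc 0 β)
    (h1 : c - s.Θ i y1 ∈ Icc 0 β) (hy : y ∈ uIcc y0 y1) : c - s.Θ i y ∈ Icc 0 β := by
  have : s.Θ i y ∈ uIcc (s.Θ i y0) (s.Θ i y1) := by
    rcases s.Θ_mono i with h | h
    · exact h.mapsTo_uIcc hy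
    · exact h.mapsTo_uIcc hy
  rw [mem_uIcc] at this
  simp only [mem_Icc] at *
  rcases this with h | h <;> constructor <;> linarith

/-- a bound for the slopes -/
theorem exists_σ : ∃ σ : ℝ, 0 < σ ∧ (∀ i, ∀ x ∈ Icc (0:ℝ) 1, |s.S i x| ≤ σ) ∧
    ∀ i, ∀ x ∈ Icc (0:ℝ) 1, ∀ y ∈ Icc (0:ℝ) 1, |s.Θ i x - s.Θ i y| ≤ σ * |x - y| := by
  have hc : Continuous (fun x i => s.S i x) := continuous_pi fun i => s.hS i
  obtain ⟨C, hC⟩ := isCompact_Icc.exists_bound_of_continuousOn (s := Icc (0:ℝ) 1) hc.continuousOn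
  have hb : ∀ i, ∀ x ∈ Icc (0:ℝ) 1, |s.S i x| ≤ |C| + 1 := fun i x hx => by
    have := (norm_le_pi_norm (fun i => s.S i x) i).trans (hC x hx)
    rw [Real.norm_eq_abs] at this
    linarith [le_abs_self C]
  refine ⟨|C| + 1, by positivity, hb, ?_⟩
  intro i x hx y hy
  have := (convex_Icc (0:ℝ) 1).norm_image_sub_le_of_norm_hasDerivWithin_le
    (f := s.Θ i) (f' := s.S i) (C := |C| + 1)
    (fun z _ => (s.Θ_deriv i z).hasDerivWithinAt) (fun z hz => hb i z hz) hy hx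
  simpa using this

end Sys

/-- integrated transport equation along the curves `t = c - Θ y` within `[0,β] × [0,1]` -/
def Along (Θ : ℝ → ℝ) (β : ℝ) (f g : ℝ → ℝ → ℝ) : Prop :=
  ∀ c : ℝ, ∀ y0 ∈ Icc (0:ℝ) 1, ∀ y1 ∈ Icc (0:ℝ) 1,
    c - Θ y0 ∈ Icc 0 β → c - Θ y1 ∈ Icc 0 β →
    f (c - Θ y1) y1 - f (c - Θ y0) y0 = ∫ y in y0..y1, g (c - Θ y) y

abbrev CO (β : ℝ) (f : ℝ → ℝ → ℝ) : Prop :=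
  ContinuousOn (fun p : ℝ × ℝ => f p.1 p.2) (Icc 0 β ×ˢ Icc 0 1)

theorem CO.along {s : Sys ι} {i : ι} {β : ℝ} {f : ℝ → ℝ → ℝ} (hf : CO β f) {c y0 y1 : ℝ}
    (hy0 : y0 ∈ Icc (0:ℝ) 1) (hy1 : y1 ∈ Icc (0:ℝ) 1)
    (h0 : c - s.Θ i y0 ∈ Icc 0 β) (h1 : c - s.Θ i y1 ∈ Icc 0 β) :
    ContinuousOn (fun y => f (c - s.Θ i y) y) (uIcc y0 y1) := by
  have : ContinuousOn (fun y => (c - s.Θ i y, y)) (uIcc y0 y1) :=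
    ((continuous_const.sub (s.Θ_cont i)).prodMk continuous_id).continuousOn
  exact hf.comp this fun y hy => ⟨s.Θ_between i h0 h1 hy, uIcc_subset_Icc hy0 hy1 hy⟩

structure Pair (s : Sys ι) (β : ℝ) (z W F H : ι → ℝ → ℝ → ℝ) : Prop where
  cz : ∀ i, CO β (z i)
  cF : ∀ i, CO β (F i)
  cH : ∀ i, CO β (H i)
  mild : ∀ i, Along (s.Θ i) β (z i) (fun t x => ∑ j, s.M 0 i j t x * z j t x + H i t x)
  sol : ∀ i j, i ≠ j → Along (s.Θ i) β (W j) (fun t x => (s.S j x - s.S i x) * z j t x + F j t x)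

def Bdd (β a : ℝ) (f : ι → ℝ → ℝ → ℝ) : Prop :=
  ∀ i, ∀ t ∈ Icc 0 β, ∀ x ∈ Icc (0:ℝ) 1, |f i t x| ≤ a

theorem kappa (s : Sys ι) : ∃ K : ℝ, 0 ≤ K ∧
    (∀ i j, i ≠ j → ∀ t ∈ Icc 0 s.T, ∀ x ∈ Icc (0:ℝ) 1, |s.M 0 i j t x / (s.S j x - s.S i x)| ≤ K) ∧
    ∀ ε > 0, ∃ δ > 0, ∀ i j, i ≠ j → ∀ t ∈ Icc 0 s.T, ∀ x ∈ Icc (0:ℝ) 1,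
      ∀ t' ∈ Icc 0 s.T, ∀ x' ∈ Icc (0:ℝ) 1, |t - t'| ≤ δ → |x - x'| ≤ δ →
      |s.M 0 i j t x / (s.S j x - s.S i x) - s.M 0 i j t' x' / (s.S j x' - s.S i x')| ≤ ε := by
  set κ : ℝ × ℝ → ι → ι → ℝ := fun p i j => s.M 0 i j p.1 p.2 / (s.S j p.2 - s.S i p.2) with hκ
  have hc : ContinuousOn κ (Icc 0 s.T ×ˢ Icc 0 1) := by
    refine continuousOn_pi.2 fun i => continuousOn_pi.2 fun j => ?_
    by_cases hij : i = j
    · subst hij; simp [hκ]; exact continuousOn_const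
    · refine (s.hM 0 i j).div ?_ ?_
      · exact (((s.hS j).comp continuous_snd).sub ((s.hS i).comp continuous_snd)).continuousOn
      · intro p _
        exact sub_ne_zero.2 (s.dist j i (Ne.symm hij) p.2)
  have hcomp : IsCompact (Icc 0 s.T ×ˢ Icc (0:ℝ) 1) := isCompact_Icc.prod isCompact_Icc
  obtain ⟨C, hC⟩ := hcomp.exists_bound_of_continuousOn hc
  refine ⟨|C|, abs_nonneg _, ?_, ?_⟩
  · intro i j _ t ht x hx
    have h1 := (norm_le_pi_norm (κ (t, x)) i).trans (hC (t, x) ⟨ht, hx⟩)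
    have h2 := (norm_le_pi_norm (κ (t, x) i) j).trans h1
    exact h2.trans (le_abs_self C)
  · intro ε hε
    have huc := hcomp.uniformContinuousOn_of_continuous hc
    rw [Metric.uniformContinuousOn_iff] at huc
    obtain ⟨δ, hδ, h⟩ := huc ε hε
    refine ⟨δ / 2, by positivity, ?_⟩
    intro i j _ t ht x hx t' ht' x' hx' h1 h2
    have h3 := h (t, x) ⟨ht, hx⟩ (t', x') ⟨ht', hx'⟩ (by
      rw [Prod.dist_eq, Real.dist_eq, Real.dist_eq]
      exact max_lt (by simpa using by linarith) (by simpa using by linarith))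
    have h4 := (dist_le_pi_dist (κ (t, x)) (κ (t', x')) i).trans h3.le
    have h5 := (dist_le_pi_dist (κ (t, x) i) (κ (t', x') i) j).trans h4
    rwa [Real.dist_eq] at h5

end HypObs
namespace HypObs
open Set
variable {ι : Type} [Fintype ι]

theorem uIcc_dist_le {p q : ℝ} (hp : p ∈ Icc (0:ℝ) 1) (hq : q ∈ Icc (0:ℝ) 1) : |p - q| ≤ 1 := by
  rw [abs_le]; constructor <;> linarith [hp.1, hp.2, hq.1, hq.2]

theorem abs_int_le_of_bdd {f : ℝ → ℝ} {p q a : ℝ} (hp : p ∈ Icc (0:ℝ) 1) (hq : q ∈ Icc (0:ℝ) 1)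
    (ha : 0 ≤ a) (h : ∀ y ∈ uIcc p q, |f y| ≤ a) : |∫ y in p..q, f y| ≤ a := by
  have := intervalIntegral.norm_integral_le_of_norm_le_const (a := p) (b := q) (f := f) (C := a)
    (fun x hx => by rw [Real.norm_eq_abs]; exact h x (uIoc_subset_uIcc hx))
  rw [Real.norm_eq_abs] at this
  have h2 := uIcc_dist_le hq hp
  nlinarith

theorem SegBound (s : Sys ι) : ∃ C0 : ℝ, 1 ≤ C0 ∧ ∀ ε > 0, ∃ N : ℝ, 0 ≤ N ∧ ∀ β ≤ s.T,
    ∀ (z W F H : ι → ℝ → ℝ → ℝ) (a : ℝ), 0 ≤ a → Pair s β z W F H →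
    Bdd β a W → Bdd β a F → Bdd β a H → ∀ (i : ι) (c : ℝ), ∀ y0 ∈ Icc (0:ℝ) 1, ∀ y1 ∈ Icc (0:ℝ) 1,
    c - s.Θ i y0 ∈ Icc 0 β → c - s.Θ i y1 ∈ Icc 0 β → ∀ Q : ℝ,
    (∀ j, abs (∫ y in y0..y1, |z j (c - s.Θ i y) y|) ≤ Q) →
    |z i (c - s.Θ i y1) y1| ≤ C0 * (|z i (c - s.Θ i y0) y0| + N * a + ε * Q) := by
  classical
  obtain ⟨σ, hσ, hSσ, hΘσ⟩ := s.exists_σ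
  obtain ⟨K, hK, hκb, hκo⟩ := kappa s
  have hA := s.hA
  set n0 : ℕ := ⌈2 * s.A + 1⌉₊
  have hn0 : 2 * s.A + 1 ≤ n0 := Nat.le_ceil _
  have hd0 : 1 ≤ (n0:ℝ) * (1 / (2 * s.A + 1)) := by
    rw [mul_one_div, le_div_iff₀ (by positivity)]; linarith
  refine ⟨4 ^ n0, one_le_pow₀ (by norm_num), ?_⟩
  intro ε hε
  set m : ℝ := (Fintype.card ι : ℝ) with hmdef
  have hm : 0 ≤ m := Nat.cast_nonneg _
  set ε1 : ℝ := ε / ((m + 1) * (2 * σ)) with hε1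
  have hε1p : 0 < ε1 := by positivity
  obtain ⟨δ, hδ, hosc⟩ := hκo ε1 hε1p
  set δ' : ℝ := δ / (1 + σ)
  have hδ' : 0 < δ' := by positivity
  have hδ1 : δ' * (1 + σ) = δ := by simp only [δ']; field_simp
  set n1 : ℕ := ⌈1 / δ'⌉₊
  have hn1 : 1 ≤ (n1:ℝ) * δ' := by
    have : 1 / δ' ≤ n1 := Nat.le_ceil _
    rwa [div_le_iff₀ hδ'] at this
  refine ⟨m * (n1 * (K * 3)) + 1, by positivity, ?_⟩
  intro β hβ z W F H a ha P hW hF hH i c y0 hy0 y1 hy1 h0 h1 Q hQ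
  have hsub : uIcc y0 y1 ⊆ Icc 0 1 := uIcc_subset_Icc hy0 hy1
  have hwin : ∀ y ∈ uIcc y0 y1, c - s.Θ i y ∈ Icc 0 β := fun y hy => s.Θ_between i h0 h1 hy
  have hwinT : ∀ y ∈ uIcc y0 y1, c - s.Θ i y ∈ Icc 0 s.T := fun y hy =>
    Icc_subset_Icc_right hβ (hwin y hy)
  have cz : ∀ j, ContinuousOn (fun y => z j (c - s.Θ i y) y) (uIcc y0 y1) :=
    fun j => (P.cz j).along hy0 hy1 h0 h1
  have cF : ∀ j, ContinuousOn (fun y => F j (c - s.Θ i y) y) (uIcc y0 y1) :=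
    fun j => (P.cF j).along hy0 hy1 h0 h1
  have cH : ∀ j, ContinuousOn (fun y => H j (c - s.Θ i y) y) (uIcc y0 y1) :=
    fun j => (P.cH j).along hy0 hy1 h0 h1
  have cM : ∀ j, ContinuousOn (fun y => s.M 0 i j (c - s.Θ i y) y) (uIcc y0 y1) := fun j =>
    CO.along (β := β) ((s.hM 0 i j).mono (prod_mono (Icc_subset_Icc_right hβ) subset_rfl)) hy0 hy1 h0 h1
  have hQ0 : 0 ≤ Q := (abs_nonneg _).trans (hQ i)
  -- off-diagonal terms
  have hoff : ∀ j, j ≠ i → ∀ y ∈ uIcc y0 y1, ∀ y' ∈ uIcc y0 y1, y' ≤ y →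
      |∫ x in y'..y, s.M 0 i j (c - s.Θ i x) x * z j (c - s.Θ i x) x|
        ≤ n1 * (K * (3 * a)) + ε1 * (2 * σ * Q) := by
    intro j hj y hy y' hy' hle
    have hs' : Icc y' y ⊆ uIcc y0 y1 := by
      have := ordConnected_uIcc.out (α := ℝ) hy' hy
      exact this
    have cκ : ContinuousOn (fun x => s.M 0 i j (c - s.Θ i x) x / (s.S j x - s.S i x)) (Icc y' y) :=
      ((cM j).mono hs').div ((s.hS j).sub (s.hS i)).continuousOn
        (fun x _ => sub_ne_zero.2 (s.dist j i hj x))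
    have cf : ContinuousOn (fun x => (s.S j x - s.S i x) * z j (c - s.Θ i x) x) (uIcc y0 y1) :=
      ((s.hS j).sub (s.hS i)).continuousOn.mul (cz j)
    have key := offdiag (q := y) (K := K) (A := 3 * a) (ε := ε1) hδ' hK n1 y' hle cκ (cf.mono hs')
      (fun x hx => hκb i j hj.symm _ (hwinT x (hs' hx)) x (hsub (hs' hx)))
      (fun x hx x' hx' hd => by
        refine hosc i j hj.symm _ (hwinT x (hs' hx)) x (hsub (hs' hx)) _ (hwinT x' (hs' hx')) x'
          (hsub (hs' hx')) ?_ ?_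
        · have := hΘσ i x' (hsub (hs' hx')) x (hsub (hs' hx))
          have e : c - s.Θ i x - (c - s.Θ i x') = s.Θ i x' - s.Θ i x := by ring
          rw [e]; rw [abs_sub_comm x x'] at hd
          nlinarith
        · nlinarith)
      (fun x hx x' hx' => by
        have hxx' := P.sol i j hj.symm c x (hsub (hs' hx)) x' (hsub (hs' hx'))
          (hwin x (hs' hx)) (hwin x' (hs' hx'))
        have hs'' : uIcc x x' ⊆ uIcc y0 y1 := (uIcc_subset_Icc hx hx').trans hs'
        rw [intervalIntegral.integral_add ((cf.mono hs'').intervalIntegrable)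
          (((cF j).mono hs'').intervalIntegrable)] at hxx'
        have e1 := hW j _ (hwin x (hs' hx)) x (hsub (hs' hx))
        have e2 := hW j _ (hwin x' (hs' hx')) x' (hsub (hs' hx'))
        have e3 := abs_int_le_of_bdd (f := fun y => F j (c - s.Θ i y) y) (hsub (hs' hx))
          (hsub (hs' hx')) ha
          (fun y hy => hF j _ (hwin y (hs'' hy)) y (hsub (hs'' hy)))
        rw [abs_le] at *
        constructor <;> linarith [e1.1, e1.2, e2.1, e2.2, e3.1, e3.2])
      (by
        have := uIcc_dist_le (hsub hy) (hsub hy')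
        rw [abs_of_nonneg (by linarith)] at this; linarith)
    have e0 : ∫ x in y'..y, s.M 0 i j (c - s.Θ i x) x * z j (c - s.Θ i x) x =
        ∫ x in y'..y, s.M 0 i j (c - s.Θ i x) x / (s.S j x - s.S i x) *
          ((s.S j x - s.S i x) * z j (c - s.Θ i x) x) := by
      congr 1; ext x
      have := sub_ne_zero.2 (s.dist j i hj x)
      field_simp
    rw [e0]
    refine key.trans (add_le_add le_rfl (mul_le_mul_of_nonneg_left ?_ hε1p.le))
    have hs'' : uIcc y' y ⊆ uIcc y0 y1 := by rw [uIcc_of_le hle]; exact hs'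
    calc ∫ x in y'..y, |(s.S j x - s.S i x) * z j (c - s.Θ i x) x|
        ≤ ∫ x in y'..y, 2 * σ * |z j (c - s.Θ i x) x| := by
          refine intervalIntegral.integral_mono_on hle ((cf.abs.mono hs'').intervalIntegrable)
            (((cz j).abs.mono hs'').intervalIntegrable.const_mul _) ?_
          intro x hx
          rw [abs_mul]
          refine mul_le_mul_of_nonneg_right ?_ (abs_nonneg _)
          have g1 := hSσ i x (hsub (hs' hx))
          have g2 := hSσ j x (hsub (hs' hx))
          rw [abs_le] at *; constructor <;> linarith [g1.1, g1.2, g2.1, g2.2]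
      _ = 2 * σ * ∫ x in y'..y, |z j (c - s.Θ i x) x| := by
          rw [intervalIntegral.integral_const_mul]
      _ ≤ 2 * σ * Q := by
          refine mul_le_mul_of_nonneg_left ((le_abs_self _).trans (le_trans ?_ (hQ j))) (by positivity)
          refine intervalIntegral.abs_integral_mono_interval ?_
            (Filter.Eventually.of_forall fun x => abs_nonneg _) (cz j).abs.intervalIntegrable
          have a1 := hs'' left_mem_uIcc
          have a2 := hs'' right_mem_uIcc
          rw [uIcc, mem_Icc] at a1 a2
          intro x hx
          rw [uIoc_of_le hle] at hx
          simp only [uIoc, mem_Ioc]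
          exact ⟨a1.1.trans_lt hx.1, hx.2.trans a2.2⟩
  set E : ℝ := m * (n1 * (K * (3 * a)) + ε1 * (2 * σ * Q)) + a with hE
  have hE0 : 0 ≤ E := by positivity
  have hdiff1 : ∀ y ∈ uIcc y0 y1, ∀ y' ∈ uIcc y0 y1, y' ≤ y →
      |z i (c - s.Θ i y) y - z i (c - s.Θ i y') y'|
       ≤ E + s.A * abs (∫ x in y'..y, |z i (c - s.Θ i x) x|) := by
    intro y hy y' hy' hle
    have hs'' : uIcc y' y ⊆ uIcc y0 y1 := uIcc_subset_uIcc hy' hy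
    rw [P.mild i c y' (hsub hy') y (hsub hy) (hwin y' hy') (hwin y hy)]
    have ci : ∀ j, ContinuousOn (fun x => s.M 0 i j (c - s.Θ i x) x * z j (c - s.Θ i x) x) (uIcc y' y) :=
      fun j => ((cM j).mul (cz j)).mono hs''
    rw [intervalIntegral.integral_add
      ((continuousOn_finsetSum _ fun j _ => ci j).intervalIntegrable)
      (((cH i).mono hs'').intervalIntegrable),
      intervalIntegral.integral_finsetSum (fun j _ => (ci j).intervalIntegrable),
      ← Finset.add_sum_erase _ _ (Finset.mem_univ i)]
    have b1 : |∫ x in y'..y, s.M 0 i i (c - s.Θ i x) x * z i (c - s.Θ i x) x|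
        ≤ s.A * abs (∫ x in y'..y, |z i (c - s.Θ i x) x|) := by
      rw [abs_of_nonneg (intervalIntegral.integral_nonneg hle fun x _ => abs_nonneg _),
        ← intervalIntegral.integral_const_mul]
      refine (intervalIntegral.abs_integral_le_integral_abs hle).trans ?_
      refine intervalIntegral.integral_mono_on hle (ci i).abs.intervalIntegrable
        (((cz i).abs.mono hs'').intervalIntegrable.const_mul _) ?_
      intro x hx
      have hx' : x ∈ uIcc y0 y1 := hs'' (by rwa [uIcc_of_le hle])
      rw [abs_mul]
      refine mul_le_mul_of_nonneg_right ?_ (abs_nonneg _)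
      simpa using s.hMb 0 i i _ (hwinT x hx') x (hsub hx')
    have b2 : |∑ j ∈ Finset.univ.erase i, ∫ x in y'..y, s.M 0 i j (c - s.Θ i x) x * z j (c - s.Θ i x) x|
        ≤ m * (n1 * (K * (3 * a)) + ε1 * (2 * σ * Q)) := by
      refine (Finset.abs_sum_le_sum_abs _ _).trans ?_
      refine (Finset.sum_le_card_nsmul _ _ (n1 * (K * (3 * a)) + ε1 * (2 * σ * Q)) (fun j hj =>
        hoff j (Finset.ne_of_mem_erase hj) y hy y' hy' hle)).trans ?_
      rw [nsmul_eq_mul]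
      refine mul_le_mul_of_nonneg_right ?_ (by positivity)
      rw [hmdef]; exact_mod_cast Finset.card_le_univ _
    have b3 : |∫ x in y'..y, H i (c - s.Θ i x) x| ≤ a :=
      abs_int_le_of_bdd (hsub hy') (hsub hy) ha
        (fun x hx => hH i _ (hwin x (hs'' hx)) x (hsub (hs'' hx)))
    refine (abs_add_le _ _).trans ?_
    refine (add_le_add (abs_add_le _ _) le_rfl).trans ?_
    linarith
  have hdiff : ∀ y ∈ uIcc y0 y1, ∀ y' ∈ uIcc y0 y1,
      |z i (c - s.Θ i y) y - z i (c - s.Θ i y') y'|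
       ≤ E + s.A * abs (∫ x in y'..y, |z i (c - s.Θ i x) x|) := by
    intro y hy y' hy'
    rcases le_total y' y with h | h
    · exact hdiff1 y hy y' hy' h
    · rw [abs_sub_comm, intervalIntegral.integral_symm, abs_neg]
      exact hdiff1 y' hy' y hy h
  have := diag (u := fun y => z i (c - s.Θ i y) y) (p := min y0 y1) (q := max y0 y1) hA
    (δ := 1 / (2 * s.A + 1)) (by positivity) (by
      rw [mul_one_div, div_le_one (by positivity)]; linarith) hE0 (cz i) hdiff n0 y1 right_mem_uIcc y0
      left_mem_uIcc ((uIcc_dist_le hy1 hy0).trans hd0)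
  refine this.trans (mul_le_mul_of_nonneg_left ?_ (by positivity))
  have e5 : m * (ε1 * (2 * σ * Q)) ≤ ε * Q := by
    have : ε1 * (2 * σ) = ε / (m + 1) := by rw [hε1]; field_simp
    have h2 : m * (ε / (m + 1)) ≤ ε := by
      rw [mul_div_assoc', div_le_iff₀ (by positivity)]; nlinarith
    calc m * (ε1 * (2 * σ * Q)) = m * (ε1 * (2 * σ)) * Q := by ring
      _ ≤ ε * Q := by rw [this]; exact mul_le_mul_of_nonneg_right h2 hQ0
  rw [hE]
  nlinarith

end HypObs
namespace HypObs
open Set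
variable {ι : Type} [Fintype ι]

theorem PointBound (s : Sys ι) : ∃ C1 : ℝ, 1 ≤ C1 ∧ ∀ ε > 0, ∃ N : ℝ, 0 ≤ N ∧ ∀ β, s.Topt ≤ β → β ≤ s.T →
    ∀ (z W F H : ι → ℝ → ℝ → ℝ) (a : ℝ), 0 ≤ a → Pair s β z W F H →
    Bdd β a W → Bdd β a F → Bdd β a H → (∀ t ∈ Icc 0 β, (fun i => z i t 0) ∈ s.Bd) →
    ∀ (i : ι), ∀ t ∈ Icc 0 β, ∀ x ∈ Icc (0:ℝ) 1, ∀ c, c = t + s.Θ i x → ∀ O Q : ℝ, 0 ≤ O → 0 ≤ Q →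
    (∀ j, c - s.Θ j 1 ∈ Icc 0 β → |z j (c - s.Θ j 1) 1| ≤ O) →
    (∀ i j, ∀ y0 ∈ Icc (0:ℝ) 1, ∀ y1 ∈ Icc (0:ℝ) 1, c - s.Θ i y0 ∈ Icc 0 β → c - s.Θ i y1 ∈ Icc 0 β →
      abs (∫ y in y0..y1, |z j (c - s.Θ i y) y|) ≤ Q) →
    |z i t x| ≤ C1 * (O + N * a + ε * Q) := by
  obtain ⟨C0, hC0, h⟩ := SegBound s
  have hCB := s.hCB
  refine ⟨C0 * (s.CB * C0 + 1), by nlinarith [mul_nonneg hCB (zero_le_one.trans hC0)], ?_⟩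
  intro ε hε
  obtain ⟨N, hN, h⟩ := h ε hε
  refine ⟨N, hN, ?_⟩
  intro β hβ0 hβ z W F H a ha P hW hF hH hB i t ht x hx c hc O Q hO hQ hobs hseg
  have h' := h β hβ z W F H a ha P hW hF hH
  have one : (1:ℝ) ∈ Icc (0:ℝ) 1 := by simp
  have zer : (0:ℝ) ∈ Icc (0:ℝ) 1 := by simp
  have htc : c - s.Θ i x = t := by rw [hc]; ring
  have htw : c - s.Θ i x ∈ Icc 0 β := by rw [htc]; exact ht
  have hG : 0 ≤ N * a + ε * Q := by positivity
  have hp0 : 0 ≤ s.CB * C0 := mul_nonneg hCB (zero_le_one.trans hC0)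
  -- case 1
  have case1 : c - s.Θ i 1 ∈ Icc 0 β → |z i t x| ≤ C0 * (s.CB * C0 + 1) * (O + N * a + ε * Q) := by
    intro h1
    have e := h' i c 1 one x hx h1 htw Q (fun j => hseg i j 1 one x hx h1 htw)
    rw [htc] at e
    have e2 := hobs i h1
    refine e.trans ?_
    have : |z i (c - s.Θ i 1) 1| + N * a + ε * Q ≤ O + N * a + ε * Q := by linarith
    calc C0 * (|z i (c - s.Θ i 1) 1| + N * a + ε * Q) ≤ C0 * (O + N * a + ε * Q) :=
          mul_le_mul_of_nonneg_left this (by linarith)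
      _ ≤ _ := by
          refine mul_le_mul_of_nonneg_right ?_ (by linarith)
          nlinarith
  have case2 : c ∈ Icc 0 β → |z i t x| ≤ C0 * (s.CB * C0 + 1) * (O + N * a + ε * Q) := by
    intro h0
    have hw0 : ∀ j, c - s.Θ j 0 ∈ Icc 0 β := fun j => by rw [s.Θ_zero, sub_zero]; exact h0
    have hb := s.BP β c (C0 * (O + N * a + ε * Q)) hβ0 h0 (by
      refine mul_nonneg (by linarith) (by linarith)) _ (hB c h0) (fun j hj => by
        change c - s.Θ j 1 ∈ Icc 0 β at hj
        have e := h' j c 1 one 0 zer hj (hw0 j) Q (fun l => hseg j l 1 one 0 zer hj (hw0 j))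
        rw [s.Θ_zero, sub_zero] at e
        refine e.trans (mul_le_mul_of_nonneg_left ?_ (by linarith))
        linarith [hobs j hj])
    have e := h' i c 0 zer x hx (hw0 i) htw Q (fun j => hseg i j 0 zer x hx (hw0 i) htw)
    rw [htc, s.Θ_zero, sub_zero] at e
    have hbi := hb i
    refine e.trans ?_
    calc C0 * (|z i c 0| + N * a + ε * Q)
        ≤ C0 * (s.CB * (C0 * (O + N * a + ε * Q)) + (O + N * a + ε * Q)) := 
          mul_le_mul_of_nonneg_left (by linarith) (by linarith)
      _ = _ := by ring
  have hT := abs_le.1 (s.hΘ i)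
  change _ ≤ s.Θ i 1 ∧ s.Θ i 1 ≤ _ at hT
  rcases s.Θ_mono i with hm | hm
  · have a1 := hm hx.1
    have a2 := hm hx.2
    rw [s.Θ_zero] at a1
    rcases le_or_gt c β with hcb | hcb
    · exact case2 ⟨by linarith [ht.1], hcb⟩
    · exact case1 ⟨by linarith, by linarith [ht.2]⟩
  · have a1 := hm hx.1
    have a2 := hm hx.2
    rw [s.Θ_zero] at a1
    rcases le_or_gt 0 c with hcb | hcb
    · exact case2 ⟨hcb, by linarith [ht.2]⟩
    · exact case1 ⟨by linarith [ht.1], by linarith⟩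

theorem SupLemma (s : Sys ι) : ∃ C : ℝ, 0 ≤ C ∧ ∀ β, s.Topt ≤ β → β ≤ s.T →
    ∀ (z W F H : ι → ℝ → ℝ → ℝ) (a : ℝ), 0 ≤ a → Pair s β z W F H →
    Bdd β a W → Bdd β a F → Bdd β a H → (∀ t ∈ Icc 0 β, (fun i => z i t 0) ∈ s.Bd) →
    (∀ i, ∀ t ∈ Icc 0 β, z i t 1 = 0) → Bdd β (C * a) z := by
  obtain ⟨C1, hC1, h⟩ := PointBound s
  obtain ⟨N, hN, h⟩ := h (1 / (2 * C1)) (by positivity)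
  refine ⟨2 * C1 * N, by positivity, ?_⟩
  intro β hβ0 hβ z W F H a ha P hW hF hH hB hz1
  have hβp : 0 ≤ β := s.hT0.le.trans hβ0
  have hcont : ContinuousOn (fun p : ℝ × ℝ => fun i => z i p.1 p.2) (Icc 0 β ×ˢ Icc 0 1) :=
    continuousOn_pi.2 P.cz
  obtain ⟨p, hp, hmax⟩ := (isCompact_Icc.prod isCompact_Icc).exists_isMaxOn
    (s := Icc 0 β ×ˢ Icc (0:ℝ) 1) ⟨(0, 0), by simp [hβp]⟩ hcont.norm
  set Z : ℝ := ‖fun i => z i p.1 p.2‖ with hZ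
  have hZ0 : 0 ≤ Z := norm_nonneg _
  have hb : Bdd β Z z := fun i t ht x hx =>
    (norm_le_pi_norm (fun i => z i t x) i).trans (hmax (a := (t, x)) ⟨ht, hx⟩)
  have key : Bdd β (C1 * (0 + N * a + 1 / (2 * C1) * Z)) z := by
    intro i t ht x hx
    refine h β hβ0 hβ z W F H a ha P hW hF hH hB i t ht x hx _ rfl 0 Z le_rfl hZ0 ?_ ?_
    · intro j hj; rw [hz1 j _ hj]; simp
    · intro i j y0 hy0 y1 hy1 h0 h1
      refine abs_int_le_of_bdd hy0 hy1 hZ0 fun y hy => ?_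
      rw [abs_abs]
      exact hb j _ (s.Θ_between i h0 h1 hy) y (uIcc_subset_Icc hy0 hy1 hy)
  have e : C1 * (0 + N * a + 1 / (2 * C1) * Z) = C1 * N * a + Z / 2 := by
    field_simp; ring
  rw [e] at key
  have hZle : Z ≤ C1 * N * a + Z / 2 :=
    (pi_norm_le_iff_of_nonneg (by positivity)).2 fun i => key i p.1 hp.1 p.2 hp.2
  intro i t ht x hx
  have := hb i t ht x hx
  linarith

end HypObs
namespace HypObs
open Set MeasureTheory
variable {ι : Type} [Fintype ι]

theorem csq {α : Type*} [MeasurableSpace α] {μ : Measure α} [IsProbabilityMeasure μ]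
    {f : α → ENNReal} (hf : AEMeasurable f μ) : (∫⁻ x, f x ∂μ) ^ 2 ≤ ∫⁻ x, f x ^ 2 ∂μ := by
  have h := ENNReal.lintegral_mul_le_Lp_mul_Lq μ Real.HolderConjugate.two_two hf
    (g := fun _ => 1) aemeasurable_const
  simp only [Pi.mul_apply, mul_one, ENNReal.one_rpow, lintegral_one, measure_univ,
    ENNReal.rpow_two, one_pow] at h
  calc (∫⁻ x, f x ∂μ) ^ 2 ≤ ((∫⁻ x, f x ^ 2 ∂μ) ^ (1/2 : ℝ)) ^ 2 := by gcongr
    _ = _ := by rw [← ENNReal.rpow_two, ← ENNReal.rpow_mul]; norm_num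

theorem sum_sq_le {κ : Type*} [Fintype κ] (f : κ → ENNReal) :
    (∑ i, f i) ^ 2 ≤ (Fintype.card κ : ENNReal) * ∑ i, f i ^ 2 := by
  have := ENNReal.rpow_sum_le_const_mul_sum_rpow (s := Finset.univ) (f := f) (p := 2) (by norm_num)
  norm_num at this
  exact this

theorem prob01 : IsProbabilityMeasure ((volume : Measure ℝ).restrict (Icc (0:ℝ) 1)) :=
  ⟨by simp⟩

theorem lw {g : ℝ × ℝ → ENNReal} (hg : Measurable g) {Θ : ℝ → ℝ} (hΘ : Measurable Θ) :
    ∫⁻ c, (∫⁻ y in Icc (0:ℝ) 1, g (c - Θ y, y)) ^ 2 ≤ ∫⁻ y in Icc (0:ℝ) 1, ∫⁻ t, g (t, y) ^ 2 := by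
  haveI := prob01
  have hm : Measurable (fun p : ℝ × ℝ => g (p.1 - Θ p.2, p.2)) :=
    hg.comp ((measurable_fst.sub (hΘ.comp measurable_snd)).prodMk measurable_snd)
  calc ∫⁻ c, (∫⁻ y in Icc (0:ℝ) 1, g (c - Θ y, y)) ^ 2
      ≤ ∫⁻ c, ∫⁻ y in Icc (0:ℝ) 1, g (c - Θ y, y) ^ 2 := by
        refine lintegral_mono fun c => csq ?_
        exact (hm.comp (measurable_const.prodMk measurable_id)).aemeasurable
    _ = ∫⁻ y in Icc (0:ℝ) 1, ∫⁻ c, g (c - Θ y, y) ^ 2 := 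
        lintegral_lintegral_swap (hm.pow_const 2).aemeasurable
    _ = _ := by
        refine lintegral_congr fun y => ?_
        exact lintegral_sub_right_eq_self (fun c => g (c, y) ^ 2) (Θ y)

noncomputable def zt (T : ℝ) (f : ℝ → ℝ → ℝ) : ℝ × ℝ → ENNReal :=
  (Icc 0 T ×ˢ Icc 0 1).indicator (fun p => ENNReal.ofReal |f p.1 p.2|)

theorem zt_meas {T : ℝ} {f : ℝ → ℝ → ℝ} (hf : CO T f) : Measurable (zt T f) := by
  classical
  have : ContinuousOn (fun p : ℝ × ℝ => ENNReal.ofReal |f p.1 p.2|) (Icc 0 T ×ˢ Icc 0 1) :=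
    ENNReal.continuous_ofReal.comp_continuousOn hf.abs
  unfold zt
  rw [← Set.piecewise_eq_indicator]
  exact this.measurable_piecewise continuousOn_const (measurableSet_Icc.prod measurableSet_Icc)

theorem zt_in {T : ℝ} {f : ℝ → ℝ → ℝ} {t x : ℝ} (ht : t ∈ Icc 0 T) (hx : x ∈ Icc (0:ℝ) 1) :
    zt T f (t, x) = ENNReal.ofReal |f t x| := by
  unfold zt; rw [indicator_of_mem]; exact ⟨ht, hx⟩

theorem zt_out {T : ℝ} {f : ℝ → ℝ → ℝ} {t x : ℝ} (ht : t ∉ Icc 0 T) :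
    zt T f (t, x) = 0 := by
  unfold zt; rw [indicator_of_notMem]; exact fun h => ht h.1

theorem zt_le {T Z : ℝ} {f : ℝ → ℝ → ℝ} (h : ∀ t ∈ Icc 0 T, ∀ x ∈ Icc (0:ℝ) 1, |f t x| ≤ Z) (p) :
    zt T f p ≤ ENNReal.ofReal Z := by
  unfold zt
  by_cases hp : p ∈ Icc 0 T ×ˢ Icc (0:ℝ) 1
  · rw [indicator_of_mem hp]; exact ENNReal.ofReal_le_ofReal (h _ hp.1 _ hp.2)
  · rw [indicator_of_notMem hp]; exact zero_le

theorem slice_t {T : ℝ} {f : ℝ → ℝ → ℝ} (hf : CO T f) {x : ℝ} (hx : x ∈ Icc (0:ℝ) 1) :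
    ContinuousOn (fun t => f t x) (Icc 0 T) :=
  hf.comp (f := fun t => (t, x)) (by fun_prop) (fun t ht => ⟨ht, hx⟩)

theorem slice_x {T : ℝ} {f : ℝ → ℝ → ℝ} (hf : CO T f) {t : ℝ} (ht : t ∈ Icc (0:ℝ) T) :
    ContinuousOn (fun x => f t x) (Icc 0 1) :=
  hf.comp (f := fun x => (t, x)) (by fun_prop) (fun x hx => ⟨ht, hx⟩)

theorem zt_int {T : ℝ} (hT : 0 ≤ T) {f : ℝ → ℝ → ℝ} (hf : CO T f) {x : ℝ} (hx : x ∈ Icc (0:ℝ) 1) :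
    ∫⁻ t, zt T f (t, x) ^ 2 = ENNReal.ofReal (∫ t in (0:ℝ)..T, f t x ^ 2) := by
  have e1 : ∀ t, zt T f (t, x) ^ 2 = (Icc 0 T).indicator (fun t => ENNReal.ofReal (f t x ^ 2)) t := by
    intro t
    by_cases ht : t ∈ Icc 0 T
    · rw [zt_in ht hx, indicator_of_mem ht, ← ENNReal.ofReal_pow (abs_nonneg _), sq_abs]
    · rw [zt_out ht, indicator_of_notMem ht]; simp
  simp_rw [e1]
  rw [lintegral_indicator measurableSet_Icc, intervalIntegral.integral_of_le hT,
    ← integral_Icc_eq_integral_Ioc, ofReal_integral_eq_lintegral_ofReal]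
  · exact ((slice_t hf hx).pow 2).integrableOn_Icc
  · exact Filter.Eventually.of_forall fun t => sq_nonneg _

theorem exists_bdd {β : ℝ} {z : ι → ℝ → ℝ → ℝ} (hz : ∀ i, CO β (z i)) : ∃ Z, 0 ≤ Z ∧ Bdd β Z z := by
  obtain ⟨C, hC⟩ := (isCompact_Icc.prod isCompact_Icc).exists_bound_of_continuousOn
    (s := Icc 0 β ×ˢ Icc (0:ℝ) 1) (f := fun p : ℝ × ℝ => fun i => z i p.1 p.2) (continuousOn_pi.2 hz)
  exact ⟨|C|, abs_nonneg _, fun i t ht x hx => ((norm_le_pi_norm (fun i => z i t x) i).trans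
    (hC (t, x) ⟨ht, hx⟩)).trans (le_abs_self _)⟩

end HypObs
namespace HypObs
open Set MeasureTheory
variable {ι : Type} [Fintype ι]

theorem L2Lemma (s : Sys ι) : ∃ C : ℝ, 0 ≤ C ∧
    ∀ (z W F H : ι → ℝ → ℝ → ℝ) (a : ℝ), 0 ≤ a → Pair s s.T z W F H →
    Bdd s.T a W → Bdd s.T a F → Bdd s.T a H → (∀ t ∈ Icc 0 s.T, (fun i => z i t 0) ∈ s.Bd) →
    ∀ i, ∀ x ∈ Icc (0:ℝ) 1, ∫ t in (0:ℝ)..s.T, z i t x ^ 2 ≤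
      C * (a ^ 2 + ∑ j, ∫ t in (0:ℝ)..s.T, z j t 1 ^ 2) := by
  obtain ⟨C1, hC1, h⟩ := PointBound s
  set n : ℝ := (Fintype.card ι : ℝ) with hn
  have hn0 : 0 ≤ n := Nat.cast_nonneg _
  set ε : ℝ := 1 / (C1 * 3 * (n + 1) ^ 2) with hε
  have hεp : 0 < ε := by positivity
  obtain ⟨N, hN, h⟩ := h ε hεp
  have hT0 : 0 ≤ s.T := (s.hT0.trans s.hT).le
  refine ⟨3 * C1 ^ 2 * (n + N ^ 2 * s.T + ε ^ 2 * n ^ 3 * (6 * n * C1 ^ 2 * (n + N ^ 2 * s.T))),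
    by positivity, ?_⟩
  intro z W F H a ha P hW hF hH hB
  obtain ⟨Z, hZ0, hZ⟩ := exists_bdd P.cz
  have hzm : ∀ j, Measurable (zt s.T (z j)) := fun j => zt_meas (P.cz j)
  have one : (1:ℝ) ∈ Icc (0:ℝ) 1 := by simp
  haveI := prob01
  set O : ℝ → ENNReal := fun c => ∑ j, zt s.T (z j) (c - s.Θ j 1, 1) with hO
  set ℓ : ι × ι → ℝ → ENNReal := fun p c =>
    ∫⁻ y in Icc (0:ℝ) 1, zt s.T (z p.2) (c - s.Θ p.1 y, y) with hℓ
  set Q : ℝ → ENNReal := fun c => ∑ p, ℓ p c with hQ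
  have hOm : Measurable O := Finset.measurable_sum _ fun j _ =>
    (hzm j).comp ((measurable_id.sub_const _).prodMk measurable_const)
  have hℓm : ∀ p, Measurable (ℓ p) := fun p => by
    refine Measurable.lintegral_prod_right' (f := fun q : ℝ × ℝ => zt s.T (z p.2) (q.1 - s.Θ p.1 q.2, q.2)) ?_
    exact (hzm p.2).comp ((measurable_fst.sub ((s.Θ_cont p.1).measurable.comp measurable_snd)).prodMk
      measurable_snd)
  have hQm : Measurable Q := Finset.measurable_sum _ fun p _ => hℓm p
  have hztf : ∀ j p, zt s.T (z j) p ≠ ⊤ := fun j p =>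
    ((zt_le (hZ j) p).trans_lt ENNReal.ofReal_lt_top).ne
  have hOf : ∀ c, O c ≠ ⊤ := fun c => ENNReal.sum_ne_top.2 fun j _ => hztf j _
  have hℓf : ∀ p c, ℓ p c ≠ ⊤ := fun p c => by
    refine ((lintegral_mono (g := fun _ => ENNReal.ofReal Z) (fun y => zt_le (hZ p.2) _)).trans_lt ?_).ne
    rw [lintegral_const, measure_univ, mul_one]
    exact ENNReal.ofReal_lt_top
  have hQf : ∀ c, Q c ≠ ⊤ := fun c => ENNReal.sum_ne_top.2 fun p _ => hℓf p c
  -- pointwise bound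
  have hpt : ∀ i t x, x ∈ Icc (0:ℝ) 1 → zt s.T (z i) (t, x) ≤ ENNReal.ofReal C1 *
      (O (t + s.Θ i x) + (Icc 0 s.T).indicator (fun _ => ENNReal.ofReal (N * a)) t
        + ENNReal.ofReal ε * Q (t + s.Θ i x)) := by
    intro i t x hx
    by_cases ht : t ∈ Icc 0 s.T
    swap
    · rw [zt_out ht]; exact zero_le
    rw [zt_in ht hx, indicator_of_mem ht]
    set c := t + s.Θ i x with hc
    have key := h s.T s.hT.le le_rfl z W F H a ha P hW hF hH hB i t ht x hx c rfl
      (O c).toReal (Q c).toReal ENNReal.toReal_nonneg ENNReal.toReal_nonneg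
      (by
        intro j hj
        rw [← ENNReal.ofReal_le_iff_le_toReal (hOf c), ← zt_in hj one]
        exact Finset.single_le_sum (f := fun j => zt s.T (z j) (c - s.Θ j 1, 1))
          (fun _ _ => zero_le) (Finset.mem_univ j))
      (by
        intro i j y0 hy0 y1 hy1 h0 h1
        rw [← ENNReal.ofReal_le_iff_le_toReal (hQf c)]
        refine le_trans ?_ (Finset.single_le_sum (f := fun p => ℓ p c)
          (fun _ _ => zero_le) (Finset.mem_univ (i, j)))
        have hcont := ((P.cz j).along (s := s) (i := i) hy0 hy1 h0 h1).abs
        rw [intervalIntegral.abs_intervalIntegral_eq, abs_of_nonneg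
          (integral_nonneg fun y => abs_nonneg _), ofReal_integral_eq_lintegral_ofReal
          ((hcont.integrableOn_compact isCompact_uIcc).mono_set uIoc_subset_uIcc)
          (Filter.Eventually.of_forall fun y => abs_nonneg _)]
        calc ∫⁻ y in uIoc y0 y1, ENNReal.ofReal |z j (c - s.Θ i y) y|
            = ∫⁻ y in uIoc y0 y1, zt s.T (z j) (c - s.Θ i y, y) := by
              refine setLIntegral_congr_fun measurableSet_uIoc fun y hy => ?_
              exact (zt_in (s.Θ_between i h0 h1 (uIoc_subset_uIcc hy))
                (uIcc_subset_Icc hy0 hy1 (uIoc_subset_uIcc hy))).symm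
          _ ≤ _ := lintegral_mono_set (uIoc_subset_uIcc.trans (uIcc_subset_Icc hy0 hy1)))
    refine (ENNReal.ofReal_le_ofReal key).trans (le_of_eq ?_)
    rw [ENNReal.ofReal_mul (by linarith), ENNReal.ofReal_add (by positivity) (by positivity),
      ENNReal.ofReal_add (by positivity) (by positivity), ENNReal.ofReal_mul hεp.le,
      ENNReal.ofReal_toReal (hOf c), ENNReal.ofReal_toReal (hQf c)]
  -- integrated bound
  set ob : ℝ := ∑ j, ∫ t in (0:ℝ)..s.T, z j t 1 ^ 2 with hob
  have hob0 : 0 ≤ ob := Finset.sum_nonneg fun j _ =>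
    intervalIntegral.integral_nonneg hT0 fun t _ => sq_nonneg _
  set I : ENNReal := ∑ j, ∫⁻ y in Icc (0:ℝ) 1, ∫⁻ t, zt s.T (z j) (t, y) ^ 2 with hI
  have hzi : ∀ j, ∀ y ∈ Icc (0:ℝ) 1, ∫⁻ t, zt s.T (z j) (t, y) ^ 2 ≤ ENNReal.ofReal (s.T * Z ^ 2) := by
    intro j y hy
    rw [zt_int hT0 (P.cz j) hy]
    refine ENNReal.ofReal_le_ofReal ?_
    have := intervalIntegral.integral_mono_on (μ := volume) (f := fun t => z j t y ^ 2) (g := fun _ => Z ^ 2) hT0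
      (((slice_t (P.cz j) hy).pow 2).intervalIntegrable_of_Icc hT0)
      (intervalIntegrable_const (c := Z ^ 2))
      (fun t ht => show z j t y ^ 2 ≤ Z ^ 2 by
        rw [← sq_abs]; exact pow_le_pow_left₀ (abs_nonneg _) (hZ j t ht y hy) 2)
    simpa using this
  have hIf : I ≠ ⊤ := ENNReal.sum_ne_top.2 fun j _ => by
    refine ((setLIntegral_mono measurable_const (hzi j)).trans_lt ?_).ne
    rw [lintegral_const, measure_univ, mul_one]
    exact ENNReal.ofReal_lt_top
  have nE : (Fintype.card ι : ENNReal) = ENNReal.ofReal n := by rw [hn, ENNReal.ofReal_natCast]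
  have hO2 : ∫⁻ c, O c ^ 2 ≤ ENNReal.ofReal (n * ob) := by
    calc ∫⁻ c, O c ^ 2 ≤ ∫⁻ c, (Fintype.card ι : ENNReal) * ∑ j, zt s.T (z j) (c - s.Θ j 1, 1) ^ 2 :=
          lintegral_mono fun c => sum_sq_le _
      _ = (Fintype.card ι : ENNReal) * ∑ j, ∫⁻ c, zt s.T (z j) (c - s.Θ j 1, 1) ^ 2 := by
          rw [lintegral_const_mul', lintegral_finset_sum]
          · intro j _
            exact ((hzm j).comp ((measurable_id.sub_const _).prodMk measurable_const)).pow_const 2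
          · exact ENNReal.natCast_ne_top _
      _ = ENNReal.ofReal n * ∑ j, ENNReal.ofReal (∫ t in (0:ℝ)..s.T, z j t 1 ^ 2) := by
          rw [nE]; congr 1
          refine Finset.sum_congr rfl fun j _ => ?_
          rw [lintegral_sub_right_eq_self (fun c => zt s.T (z j) (c, 1) ^ 2) (s.Θ j 1),
            zt_int hT0 (P.cz j) one]
      _ = _ := by
          rw [ENNReal.ofReal_mul hn0, hob, ENNReal.ofReal_sum_of_nonneg]
          exact fun j _ => intervalIntegral.integral_nonneg hT0 fun t _ => sq_nonneg _
  have hQ2 : ∫⁻ c, Q c ^ 2 ≤ ENNReal.ofReal (n ^ 3 * I.toReal) := by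
    calc ∫⁻ c, Q c ^ 2 ≤ ∫⁻ c, (Fintype.card (ι × ι) : ENNReal) * ∑ p, ℓ p c ^ 2 :=
          lintegral_mono fun c => sum_sq_le _
      _ = (Fintype.card (ι × ι) : ENNReal) * ∑ p, ∫⁻ c, ℓ p c ^ 2 := by
          rw [lintegral_const_mul', lintegral_finset_sum]
          · intro p _
            exact (hℓm p).pow_const 2
          · exact ENNReal.natCast_ne_top _
      _ ≤ (Fintype.card (ι × ι) : ENNReal) * ∑ p : ι × ι, ∫⁻ y in Icc (0:ℝ) 1, ∫⁻ t, zt s.T (z p.2) (t, y) ^ 2 := by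
          refine mul_le_mul_right (Finset.sum_le_sum fun p _ => ?_) _
          exact lw (hzm p.2) (s.Θ_cont p.1).measurable
      _ = _ := by
          rw [Fintype.sum_prod_type]
          simp only
          rw [Finset.sum_const, Finset.card_univ, ← hI, Fintype.card_prod,
            nsmul_eq_mul, ENNReal.ofReal_mul (by positivity), ENNReal.ofReal_toReal hIf,
            ENNReal.ofReal_pow hn0, ← nE]
          push_cast; ring
  have hJ : ∀ i, ∀ x ∈ Icc (0:ℝ) 1, ∫⁻ t, zt s.T (z i) (t, x) ^ 2 ≤
      ENNReal.ofReal (3 * C1 ^ 2 * (n * ob + N ^ 2 * s.T * a ^ 2 + ε ^ 2 * (n ^ 3 * I.toReal))) := by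
    intro i x hx
    have hm1 : Measurable fun t => O (t + s.Θ i x) ^ 2 := (hOm.comp (measurable_id.add_const _)).pow_const 2
    have hm2 : Measurable fun t => Q (t + s.Θ i x) ^ 2 := (hQm.comp (measurable_id.add_const _)).pow_const 2
    calc ∫⁻ t, zt s.T (z i) (t, x) ^ 2
        ≤ ∫⁻ t, (ENNReal.ofReal C1) ^ 2 * (3 * (O (t + s.Θ i x) ^ 2 +
           ((Icc 0 s.T).indicator (fun _ => ENNReal.ofReal ((N * a) ^ 2)) t +
           (ENNReal.ofReal ε) ^ 2 * Q (t + s.Θ i x) ^ 2))) := by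
          refine lintegral_mono fun t => ?_
          refine (pow_le_pow_left₀ zero_le (hpt i t x hx) 2).trans ?_
          rw [mul_pow]
          gcongr
          have := sum_sq_le (κ := Fin 3) ![O (t + s.Θ i x),
            (Icc 0 s.T).indicator (fun _ => ENNReal.ofReal (N * a)) t, ENNReal.ofReal ε * Q (t + s.Θ i x)]
          simp only [Fin.sum_univ_three, Fintype.card_fin, Matrix.cons_val_zero, Matrix.cons_val_one,
            Matrix.cons_val] at this
          refine this.trans (le_of_eq ?_)
          have e : (Icc 0 s.T).indicator (fun _ => ENNReal.ofReal (N * a)) t ^ 2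
            = (Icc 0 s.T).indicator (fun _ => ENNReal.ofReal ((N * a) ^ 2)) t := by
            by_cases ht : t ∈ Icc 0 s.T
            · rw [indicator_of_mem ht, indicator_of_mem ht, ENNReal.ofReal_pow (by positivity)]
            · rw [indicator_of_notMem ht, indicator_of_notMem ht]; simp
          rw [e, mul_pow (ENNReal.ofReal ε), add_assoc, Nat.cast_ofNat]
      _ = (ENNReal.ofReal C1) ^ 2 * (3 * ((∫⁻ c, O c ^ 2) + (ENNReal.ofReal ((N * a) ^ 2) * ENNReal.ofReal s.T
           + (ENNReal.ofReal ε) ^ 2 * ∫⁻ c, Q c ^ 2))) := by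
          rw [lintegral_const_mul' _ _ (by simp), lintegral_const_mul' _ _ (by simp),
            lintegral_add_left hm1, lintegral_add_left (measurable_const.indicator measurableSet_Icc),
            lintegral_const_mul' _ _ (by simp), lintegral_indicator_const measurableSet_Icc,
            lintegral_add_right_eq_self (fun c => O c ^ 2),
            lintegral_add_right_eq_self (fun c => Q c ^ 2), Real.volume_Icc, sub_zero]
      _ ≤ (ENNReal.ofReal C1) ^ 2 * (3 * (ENNReal.ofReal (n * ob) + (ENNReal.ofReal ((N * a) ^ 2) * ENNReal.ofReal s.T
           + (ENNReal.ofReal ε) ^ 2 * ENNReal.ofReal (n ^ 3 * I.toReal)))) := by gcongr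
      _ = _ := by
          have h3 : (3 : ENNReal) = ENNReal.ofReal 3 := by norm_num
          have hI0 : 0 ≤ I.toReal := ENNReal.toReal_nonneg
          rw [h3, ← ENNReal.ofReal_pow (by linarith), ← ENNReal.ofReal_pow hεp.le,
            ← ENNReal.ofReal_mul (by positivity), ← ENNReal.ofReal_mul (by positivity),
            ← ENNReal.ofReal_add (by positivity) (by positivity),
            ← ENNReal.ofReal_add (by positivity) (by positivity),
            ← ENNReal.ofReal_mul (by positivity), ← ENNReal.ofReal_mul (by positivity)]
          congr 1; ring
  have hI0 : 0 ≤ I.toReal := ENNReal.toReal_nonneg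
  have hIb : I.toReal ≤ n * (3 * C1 ^ 2 * (n * ob + N ^ 2 * s.T * a ^ 2 + ε ^ 2 * (n ^ 3 * I.toReal))) := by
    refine ENNReal.toReal_le_of_le_ofReal (by positivity) ?_
    calc I ≤ ∑ j : ι, ENNReal.ofReal (3 * C1 ^ 2 * (n * ob + N ^ 2 * s.T * a ^ 2 + ε ^ 2 * (n ^ 3 * I.toReal))) := by
          refine Finset.sum_le_sum fun j _ => ?_
          refine (setLIntegral_mono measurable_const (hJ j)).trans (le_of_eq ?_)
          rw [lintegral_const, measure_univ, mul_one]
      _ = _ := by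
          rw [Finset.sum_const, Finset.card_univ, nsmul_eq_mul, nE, ← ENNReal.ofReal_mul hn0]
  have hε2 : n * (3 * C1 ^ 2 * (ε ^ 2 * n ^ 3)) ≤ 1 / 2 := by
    have e : n * (3 * C1 ^ 2 * (ε ^ 2 * n ^ 3)) = (1 / 3) * (n / (n + 1)) ^ 4 := by
      rw [hε]; field_simp
    rw [e]
    have : (n / (n + 1)) ^ 4 ≤ 1 := pow_le_one₀ (by positivity) (by rw [div_le_one (by positivity)]; linarith)
    linarith
  set G := n * ob + N ^ 2 * s.T * a ^ 2 with hG
  have hG' : G ≤ (n + N ^ 2 * s.T) * (a ^ 2 + ob) := by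
    rw [hG]
    have : 0 ≤ n * a ^ 2 := by positivity
    have : 0 ≤ N ^ 2 * s.T * ob := by positivity
    nlinarith
  have hI2 : I.toReal ≤ 6 * n * C1 ^ 2 * G := by
    have := mul_le_mul_of_nonneg_right hε2 hI0
    nlinarith
  intro i x hx
  have hf := hJ i x hx
  rw [zt_int hT0 (P.cz i) hx, ENNReal.ofReal_le_ofReal_iff (by positivity)] at hf
  refine hf.trans ?_
  have : ε ^ 2 * (n ^ 3 * I.toReal) ≤ ε ^ 2 * n ^ 3 * (6 * n * C1 ^ 2 * (n + N ^ 2 * s.T)) * (a ^ 2 + ob) := by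
    calc ε ^ 2 * (n ^ 3 * I.toReal) ≤ ε ^ 2 * (n ^ 3 * (6 * n * C1 ^ 2 * ((n + N ^ 2 * s.T) * (a ^ 2 + ob)))) := by
          gcongr
          exact hI2.trans (by gcongr)
      _ = _ := by ring
  calc 3 * C1 ^ 2 * (G + ε ^ 2 * (n ^ 3 * I.toReal))
      ≤ 3 * C1 ^ 2 * ((n + N ^ 2 * s.T) * (a ^ 2 + ob) + ε ^ 2 * n ^ 3 * (6 * n * C1 ^ 2 * (n + N ^ 2 * s.T)) * (a ^ 2 + ob)) := by
        gcongr
    _ = _ := by ring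

end HypObs
namespace HypObs
open Set MeasureTheory Filter Topology
variable {ι : Type} [Fintype ι]

theorem Sys.Θ_strict (s : Sys ι) (i : ι) : StrictMono (s.Θ i) ∨ StrictAnti (s.Θ i) := by
  rcases s.sgn i with h | h
  · left; exact strictMono_of_hasDerivAt_pos (s.Θ_deriv i) h
  · right; exact strictAnti_of_hasDerivAt_neg (s.Θ_deriv i) h

structure C1 (β : ℝ) (f ft fx : ℝ → ℝ → ℝ) : Prop where
  c : CO β f
  ct : CO β ft
  cx : CO β fx
  dt : ∀ t ∈ Ioo 0 β, ∀ x ∈ Ioo (0:ℝ) 1, HasDerivAt (fun r => f r x) (ft t x) t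
  dx : ∀ t ∈ Ioo 0 β, ∀ x ∈ Ioo (0:ℝ) 1, HasDerivAt (fun y => f t y) (fx t x) x

theorem C1.strict {β : ℝ} {f ft fx : ℝ → ℝ → ℝ} (h : C1 β f ft fx) {t x : ℝ} (ht : t ∈ Ioo 0 β)
    (hx : x ∈ Ioo (0:ℝ) 1) : HasFDerivAt (fun p : ℝ × ℝ => f p.1 p.2)
      ((ContinuousLinearMap.toSpanSingleton ℝ (ft t x)).coprod
        (ContinuousLinearMap.toSpanSingleton ℝ (fx t x))) (t, x) := by
  have hn : Ioo 0 β ×ˢ Ioo (0:ℝ) 1 ∈ 𝓝 (t, x) := (isOpen_Ioo.prod isOpen_Ioo).mem_nhds ⟨ht, hx⟩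
  have hn' : Icc 0 β ×ˢ Icc (0:ℝ) 1 ∈ 𝓝 (t, x) :=
    mem_of_superset hn (prod_mono Ioo_subset_Icc_self Ioo_subset_Icc_self)
  have := hasStrictFDerivAt_uncurry_coprod (𝕜 := ℝ) (u := (t, x)) (f := f)
    (f₁ := fun t x => ContinuousLinearMap.toSpanSingleton ℝ (ft t x))
    (f₂ := fun t x => ContinuousLinearMap.toSpanSingleton ℝ (fx t x))
    (by filter_upwards [hn] with v hv; exact (h.dt v.1 hv.1 v.2 hv.2).hasFDerivAt)
    (by filter_upwards [hn] with v hv; exact (h.dx v.1 hv.1 v.2 hv.2).hasFDerivAt)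
    (by
      have := (ContinuousLinearMap.toSpanSingletonCLE (𝕜 := ℝ) (E := ℝ)).continuous.continuousAt.comp
        (h.ct.continuousAt hn')
      exact this)
    (by
      have := (ContinuousLinearMap.toSpanSingletonCLE (𝕜 := ℝ) (E := ℝ)).continuous.continuousAt.comp
        (h.cx.continuousAt hn')
      exact this)
  exact this.hasFDerivAt

theorem Along.of_le {s : Sys ι} {i : ι} {β : ℝ} {f g : ℝ → ℝ → ℝ}
    (h : ∀ c : ℝ, ∀ y0 ∈ Icc (0:ℝ) 1, ∀ y1 ∈ Icc (0:ℝ) 1, y0 < y1 →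
    c - s.Θ i y0 ∈ Icc 0 β → c - s.Θ i y1 ∈ Icc 0 β →
    f (c - s.Θ i y1) y1 - f (c - s.Θ i y0) y0 = ∫ y in y0..y1, g (c - s.Θ i y) y) :
    Along (s.Θ i) β f g := by
  intro c y0 hy0 y1 hy1 h0 h1
  rcases lt_trichotomy y0 y1 with hlt | heq | hgt
  · exact h c y0 hy0 y1 hy1 hlt h0 h1
  · subst heq; simp
  · rw [intervalIntegral.integral_symm, ← h c y1 hy1 y0 hy0 hgt h1 h0]; ring

theorem C1.along {s : Sys ι} {β : ℝ} {f ft fx : ℝ → ℝ → ℝ} (h : C1 β f ft fx) (i : ι) :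
    Along (s.Θ i) β f (fun t x => fx t x - s.S i x * ft t x) := by
  refine Along.of_le fun c y0 hy0 y1 hy1 hlt h0 h1 => ?_
  symm
  have hs : Icc y0 y1 = uIcc y0 y1 := (uIcc_of_le hlt.le).symm
  refine intervalIntegral.integral_eq_sub_of_hasDerivAt_of_le (f := fun y => f (c - s.Θ i y) y) hlt.le ?_ ?_ ?_
  · rw [hs]; exact h.c.along hy0 hy1 h0 h1
  · intro y hy
    have ht : c - s.Θ i y ∈ Ioo 0 β := by
      rcases s.Θ_strict i with hm | hm
      · have a1 := hm hy.1
        have a2 := hm hy.2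
        exact ⟨by linarith [h1.1], by linarith [h0.2]⟩
      · have a1 := hm hy.1
        have a2 := hm hy.2
        exact ⟨by linarith [h0.1], by linarith [h1.2]⟩
    have hy' : y ∈ Ioo (0:ℝ) 1 := ⟨hy0.1.trans_lt hy.1, hy.2.trans_le hy1.2⟩
    have hd := (h.strict ht hy').comp_hasDerivAt (f := fun y => (c - s.Θ i y, y)) y
      (((s.Θ_deriv i y).const_sub c).prodMk (hasDerivAt_id y))
    convert! hd using 1
    simp [ContinuousLinearMap.toSpanSingleton_apply]; ring
  · refine ContinuousOn.intervalIntegrable ?_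
    exact (h.cx.along hy0 hy1 h0 h1).sub ((s.hS i).continuousOn.mul (h.ct.along hy0 hy1 h0 h1))

/-- clamped extension -/
noncomputable def ext (β : ℝ) (f : ℝ → ℝ → ℝ) (t x : ℝ) : ℝ := f (max 0 (min β t)) (max 0 (min 1 x))

theorem clamp_mem {β : ℝ} (hβ : 0 ≤ β) (t : ℝ) : max 0 (min β t) ∈ Icc 0 β :=
  ⟨le_max_left _ _, max_le hβ (min_le_left _ _)⟩

theorem ext_cont {β : ℝ} (hβ : 0 ≤ β) {f : ℝ → ℝ → ℝ} (hf : CO β f) :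
    Continuous (fun p : ℝ × ℝ => ext β f p.1 p.2) := by
  refine hf.comp_continuous (f := fun p : ℝ × ℝ => (max 0 (min β p.1), max 0 (min 1 p.2)))
    (by fun_prop) fun p => ⟨clamp_mem hβ _, clamp_mem zero_le_one _⟩

theorem ext_eq {β : ℝ} {f : ℝ → ℝ → ℝ} {t x : ℝ} (ht : t ∈ Icc 0 β) (hx : x ∈ Icc (0:ℝ) 1) :
    ext β f t x = f t x := by
  unfold ext
  rw [min_eq_right ht.2, max_eq_right ht.1, min_eq_right hx.2, max_eq_right hx.1]

/-- integral in time -/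
noncomputable def It (f : ℝ → ℝ → ℝ) (t x : ℝ) : ℝ := ∫ r in (0:ℝ)..t, f r x

theorem It_ext {β : ℝ} {f : ℝ → ℝ → ℝ} {t x : ℝ} (ht : t ∈ Icc 0 β) (hx : x ∈ Icc (0:ℝ) 1) :
    It f t x = ∫ r in (0:ℝ)..t, ext β f r x := by
  refine intervalIntegral.integral_congr fun r hr => ?_
  rw [uIcc_of_le ht.1] at hr
  exact (ext_eq ⟨hr.1, hr.2.trans ht.2⟩ hx).symm

theorem It_cont {β : ℝ} (hβ : 0 ≤ β) {f : ℝ → ℝ → ℝ} (hf : CO β f) : CO β (It f) := by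
  have h1 : Continuous (fun p : ℝ × ℝ => ∫ r in (0:ℝ)..p.1, ext β f r p.2) := by
    have hu : Continuous (Function.uncurry fun (p : ℝ × ℝ) (r : ℝ) => ext β f r p.2) :=
      (ext_cont hβ hf).comp (f := fun q : (ℝ × ℝ) × ℝ => (q.2, q.1.2)) (by fun_prop)
    exact intervalIntegral.continuous_parametric_intervalIntegral_of_continuous hu continuous_fst
  exact h1.continuousOn.congr fun p hp => It_ext hp.1 hp.2

theorem It_deriv {β : ℝ} {f : ℝ → ℝ → ℝ} (hf : CO β f) {t x : ℝ} (ht : t ∈ Icc 0 β)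
    (hx : x ∈ Icc (0:ℝ) 1) : HasDerivWithinAt (fun r => It f r x) (f t x) (Icc 0 β) t := by
  have hβ := ht.1.trans ht.2
  have hc : Continuous fun r => ext β f r x := (ext_cont hβ hf).comp (f := fun r => (r, x)) (by fun_prop)
  have := (intervalIntegral.integral_hasDerivAt_right (hc.intervalIntegrable 0 t)
    (hc.stronglyMeasurableAtFilter _ _) hc.continuousAt).hasDerivWithinAt (s := Icc 0 β)
  rw [ext_eq ht hx] at this
  exact this.congr (fun r hr => It_ext hr hx) (It_ext ht hx)

theorem It_dx {β : ℝ} {f ft fx : ℝ → ℝ → ℝ} (h : C1 β f ft fx) {t x : ℝ} (ht : t ∈ Ioo 0 β)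
    (hx : x ∈ Ioo (0:ℝ) 1) : HasDerivAt (fun y => It f t y) (It fx t x) x := by
  have hβ := (ht.1.trans ht.2).le
  obtain ⟨Z, hZ0, hZ⟩ := exists_bdd (ι := Unit) (z := fun _ => fx) (fun _ => h.cx)
  have hsl : ∀ {g : ℝ → ℝ → ℝ}, CO β g → ∀ y ∈ Icc (0:ℝ) 1, ContinuousOn (fun r => g r y) (uIcc 0 t) :=
    fun hg y hy => by
      rw [uIcc_of_le ht.1.le]; exact (slice_t hg hy).mono (Icc_subset_Icc_right ht.2.le)
  have hio := Ioo_subset_Icc_self (a := (0:ℝ)) (b := 1)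
  refine (intervalIntegral.hasDerivAt_integral_of_dominated_loc_of_deriv_le (μ := volume)
    (F := fun y r => f r y) (F' := fun y r => fx r y) (bound := fun _ => Z) (s := Ioo 0 1)
    (Ioo_mem_nhds hx.1 hx.2) ?_ ?_ ?_ ?_ ?_ ?_).2
  · filter_upwards [Ioo_mem_nhds hx.1 hx.2] with y hy
    exact ((hsl h.c y (hio hy)).mono uIoc_subset_uIcc).aestronglyMeasurable measurableSet_uIoc
  · exact (hsl h.c x (hio hx)).intervalIntegrable
  · exact ((hsl h.cx x (hio hx)).mono uIoc_subset_uIcc).aestronglyMeasurable measurableSet_uIoc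
  · refine Eventually.of_forall fun r hr y hy => ?_
    rw [uIoc_of_le ht.1.le] at hr
    exact hZ () r ⟨hr.1.le, hr.2.trans ht.2.le⟩ y (hio hy)
  · exact intervalIntegrable_const
  · refine Eventually.of_forall fun r hr y hy => ?_
    rw [uIoc_of_le ht.1.le] at hr
    exact h.dx r ⟨hr.1, hr.2.trans_lt ht.2⟩ y hy

noncomputable def pot (S : ℝ → ℝ) (f : ℝ → ℝ → ℝ) (t x : ℝ) : ℝ :=
  It f t x + ∫ y in (0:ℝ)..x, S y * f 0 y

theorem pot_x {S : ℝ → ℝ} (hS : Continuous S) {β : ℝ} (hβ : 0 ≤ β) {f : ℝ → ℝ → ℝ} (hf : CO β f) :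
    ContinuousOn (fun x => ∫ y in (0:ℝ)..x, S y * f 0 y) (Icc 0 1) ∧
    ∀ x ∈ Icc (0:ℝ) 1, HasDerivWithinAt (fun x => ∫ y in (0:ℝ)..x, S y * f 0 y) (S x * f 0 x) (Icc 0 1) x := by
  have h : ∀ x ∈ Icc (0:ℝ) 1, HasDerivWithinAt (fun x => ∫ y in (0:ℝ)..x, S y * f 0 y) (S x * f 0 x) (Icc 0 1) x := by
    intro x hx
    have hc : Continuous fun y => S y * ext β f 0 y :=
      hS.mul ((ext_cont hβ hf).comp (f := fun r => (0, r)) (by fun_prop))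
    have := (intervalIntegral.integral_hasDerivAt_right (hc.intervalIntegrable 0 x)
      (hc.stronglyMeasurableAtFilter _ _) hc.continuousAt).hasDerivWithinAt (s := Icc 0 1)
    rw [ext_eq (left_mem_Icc.2 hβ) hx] at this
    have e : ∀ x ∈ Icc (0:ℝ) 1, ∫ y in (0:ℝ)..x, S y * f 0 y = ∫ y in (0:ℝ)..x, S y * ext β f 0 y := by
      intro x hx
      refine intervalIntegral.integral_congr fun r hr => ?_
      rw [uIcc_of_le hx.1] at hr
      show S r * f 0 r = S r * ext β f 0 r
      rw [ext_eq (left_mem_Icc.2 hβ) ⟨hr.1, hr.2.trans hx.2⟩]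
    exact this.congr e (e x hx)
  exact ⟨fun x hx => (h x hx).continuousWithinAt, h⟩

theorem pot_C1 {S : ℝ → ℝ} (hS : Continuous S) {β : ℝ} (hβ : 0 ≤ β) {f ft fx g : ℝ → ℝ → ℝ}
    (h : C1 β f ft fx) (hg : CO β g) (he : ∀ t ∈ Icc 0 β, ∀ x ∈ Icc (0:ℝ) 1, fx t x = S x * ft t x + g t x) :
    C1 β (pot S f) f (fun t x => S x * f t x + It g t x) := by
  have hpx := pot_x hS hβ h.c
  refine ⟨?_, h.c, ?_, ?_, ?_⟩
  · exact (It_cont hβ h.c).add (hpx.1.comp continuous_snd.continuousOn fun p hp => hp.2)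
  · exact ((hS.comp continuous_snd).continuousOn.mul h.c).add (It_cont hβ hg)
  · intro t ht x hx
    exact ((It_deriv h.c (Ioo_subset_Icc_self ht) (Ioo_subset_Icc_self hx)).hasDerivAt
      (Icc_mem_nhds ht.1 ht.2)).add_const _
  · intro t ht x hx
    have hx' := Ioo_subset_Icc_self hx
    have h1 := (It_dx h ht hx).add ((hpx.2 x hx').hasDerivAt (Icc_mem_nhds hx.1 hx.2))
    convert! h1 using 1
    have hsub : Icc 0 t ⊆ Icc 0 β := Icc_subset_Icc_right ht.2.le
    have e1 : It fx t x = S x * (∫ r in (0:ℝ)..t, ft r x) + It g t x := by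
      unfold It
      rw [← intervalIntegral.integral_const_mul, ← intervalIntegral.integral_add]
      · refine intervalIntegral.integral_congr fun r hr => ?_
        rw [uIcc_of_le ht.1.le] at hr
        exact he r (hsub hr) x hx'
      · exact (((slice_t h.ct hx').mono hsub).intervalIntegrable_of_Icc ht.1.le).const_mul _
      · exact ((slice_t hg hx').mono hsub).intervalIntegrable_of_Icc ht.1.le
    have e2 : ∫ r in (0:ℝ)..t, ft r x = f t x - f 0 x := by
      refine intervalIntegral.integral_eq_sub_of_hasDerivAt_of_le (f := fun r => f r x) ht.1.le
        ((slice_t h.c hx').mono hsub) ?_ (((slice_t h.ct hx').mono hsub).intervalIntegrable_of_Icc ht.1.le)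
      intro r hr
      exact h.dt r ⟨hr.1, hr.2.trans ht.2⟩ x hx
    rw [e1, e2]; ring

end HypObs
namespace HypObs
open Set MeasureTheory Filter Topology
variable {ι : Type} [Fintype ι]

theorem Along.mono {s : Sys ι} {i : ι} {β β' : ℝ} {f g : ℝ → ℝ → ℝ} (h : Along (s.Θ i) β' f g) (hb : β ≤ β') :
    Along (s.Θ i) β f g := fun c y0 hy0 y1 hy1 h0 h1 =>
  h c y0 hy0 y1 hy1 ⟨h0.1, h0.2.trans hb⟩ ⟨h1.1, h1.2.trans hb⟩

theorem CO.mono' {β β' : ℝ} {f : ℝ → ℝ → ℝ} (h : CO β' f) (hb : β ≤ β') : CO β f :=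
  ContinuousOn.mono h (prod_mono (Icc_subset_Icc_right hb) le_rfl)

theorem Along.congr {s : Sys ι} {i : ι} {β : ℝ} {f g f' g' : ℝ → ℝ → ℝ} (h : Along (s.Θ i) β f g)
    (hf : ∀ t ∈ Icc 0 β, ∀ x ∈ Icc (0:ℝ) 1, f' t x = f t x)
    (hg : ∀ t ∈ Icc 0 β, ∀ x ∈ Icc (0:ℝ) 1, g' t x = g t x) : Along (s.Θ i) β f' g' := by
  intro c y0 hy0 y1 hy1 h0 h1
  rw [hf _ h0 _ hy0, hf _ h1 _ hy1, h c y0 hy0 y1 hy1 h0 h1]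
  exact (intervalIntegral.integral_congr fun y hy =>
    (hg _ (s.Θ_between i h0 h1 hy) _ (uIcc_subset_Icc hy0 hy1 hy))).symm

theorem Along.int {s : Sys ι} {i : ι} {β : ℝ} {g : ℝ → ℝ → ℝ} (hg : CO β g) {c y0 y1 : ℝ}
    (hy0 : y0 ∈ Icc (0:ℝ) 1) (hy1 : y1 ∈ Icc (0:ℝ) 1)
    (h0 : c - s.Θ i y0 ∈ Icc 0 β) (h1 : c - s.Θ i y1 ∈ Icc 0 β) :
    IntervalIntegrable (fun y => g (c - s.Θ i y) y) volume y0 y1 :=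
  (CO.along hg hy0 hy1 h0 h1).intervalIntegrable

theorem Along.sub {s : Sys ι} {i : ι} {β : ℝ} {f g f' g' : ℝ → ℝ → ℝ} (h : Along (s.Θ i) β f g)
    (h' : Along (s.Θ i) β f' g') (hg : CO β g) (hg' : CO β g') :
    Along (s.Θ i) β (fun t x => f t x - f' t x) (fun t x => g t x - g' t x) := by
  intro c y0 hy0 y1 hy1 h0 h1
  rw [intervalIntegral.integral_sub (Along.int hg hy0 hy1 h0 h1) (Along.int hg' hy0 hy1 h0 h1),
    ← h c y0 hy0 y1 hy1 h0 h1, ← h' c y0 hy0 y1 hy1 h0 h1]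
  ring

theorem Along.smul {s : Sys ι} {i : ι} {β : ℝ} {f g : ℝ → ℝ → ℝ} (h : Along (s.Θ i) β f g) (k : ℝ) :
    Along (s.Θ i) β (fun t x => k * f t x) (fun t x => k * g t x) := by
  intro c y0 hy0 y1 hy1 h0 h1
  rw [intervalIntegral.integral_const_mul, ← h c y0 hy0 y1 hy1 h0 h1]
  ring

theorem Along.lim {s : Sys ι} {i : ι} {β : ℝ} {f g : ℝ → ℝ → ℝ} (hg : CO β g)
    (h : ∀ ε > 0, ∃ f' g' : ℝ → ℝ → ℝ, Along (s.Θ i) β f' g' ∧ CO β g' ∧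
      ∀ t ∈ Icc 0 β, ∀ x ∈ Icc (0:ℝ) 1, |f' t x - f t x| ≤ ε ∧ |g' t x - g t x| ≤ ε) :
    Along (s.Θ i) β f g := by
  intro c y0 hy0 y1 hy1 h0 h1
  refine eq_of_abs_sub_le_all fun ε hε => ?_
  obtain ⟨f', g', ha, hc, hb⟩ := h (ε / 3) (by positivity)
  have e := ha c y0 hy0 y1 hy1 h0 h1
  have e2 := intervalIntegral.integral_sub (Along.int hc hy0 hy1 h0 h1) (Along.int hg hy0 hy1 h0 h1)
  have e3 := abs_int_le_of_bdd (f := fun y => g' (c - s.Θ i y) y - g (c - s.Θ i y) y) hy0 hy1 (a := ε / 3) (by positivity)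
    fun y hy => (hb _ (s.Θ_between i h0 h1 hy) _ (uIcc_subset_Icc hy0 hy1 hy)).2
  rw [e2] at e3
  have e4 := (hb _ h0 _ hy0).1
  have e5 := (hb _ h1 _ hy1).1
  rw [abs_le] at *
  constructor <;> linarith [e3.1, e3.2, e4.1, e4.2, e5.1, e5.2]

theorem ftc_within {β : ℝ} {f f' : ℝ → ℝ} (hd : ∀ t ∈ Icc 0 β, HasDerivWithinAt f (f' t) (Icc 0 β) t)
    (hc : ContinuousOn f' (Icc 0 β)) {p q : ℝ} (hp : p ∈ Icc 0 β) (hq : q ∈ Icc 0 β) :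
    ∫ t in p..q, f' t = f q - f p := by
  have key : ∀ {p q : ℝ}, p ∈ Icc 0 β → q ∈ Icc 0 β → p ≤ q → ∫ t in p..q, f' t = f q - f p := by
    intro p q hp hq hpq
    have hsub : Icc p q ⊆ Icc 0 β := Icc_subset_Icc hp.1 hq.2
    refine intervalIntegral.integral_eq_sub_of_hasDerivAt_of_le hpq
      (fun t ht => ((hd t (hsub ht)).continuousWithinAt).mono hsub) (fun t ht => ?_)
      ((hc.mono hsub).intervalIntegrable_of_Icc hpq)
    exact (hd t (hsub (Ioo_subset_Icc_self ht))).hasDerivAt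
      (Icc_mem_nhds (lt_of_le_of_lt hp.1 ht.1) (lt_of_lt_of_le ht.2 hq.2))
  rcases le_total p q with h | h
  · exact key hp hq h
  · rw [intervalIntegral.integral_symm, key hq hp h]; ring

theorem Sys.T_pos (s : Sys ι) : 0 < s.T := s.hT0.trans s.hT

noncomputable def FW (s : Sys ι) (U : ι → ℝ → ℝ → ℝ) (i : ι) (t x : ℝ) : ℝ :=
  ∑ j, (s.M 0 i j t x * (U j t x - U j 0 x) - It (fun r y => s.M 1 i j r y * (U j r y - U j 0 y)) t x)

theorem CO.zero {β : ℝ} {f : ℝ → ℝ → ℝ} (h : CO β f) (hβ : 0 ≤ β) : CO β (fun _ x => f 0 x) :=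
  (slice_x h (left_mem_Icc.2 hβ)).comp (f := fun p : ℝ × ℝ => p.2) (by fun_prop) fun _ hp => hp.2

theorem FW_int_cont {s : Sys ι} {β : ℝ} (h0 : 0 ≤ β) (hβ : β ≤ s.T) {U : ι → ℝ → ℝ → ℝ} (hU : ∀ i, CO β (U i)) (i j : ι) :
    CO β (fun r y => s.M 1 i j r y * (U j r y - U j 0 y)) :=
  (CO.mono' (s.hM 1 i j) hβ).mul (ContinuousOn.sub (hU j) (CO.zero (hU j) h0))

theorem FW_cont {s : Sys ι} {β : ℝ} (h0 : 0 ≤ β) (hβ : β ≤ s.T) {U : ι → ℝ → ℝ → ℝ} (hU : ∀ i, CO β (U i)) (i : ι) :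
    CO β (FW s U i) := by
  refine continuousOn_finsetSum _ fun j _ => ?_
  exact ((CO.mono' (s.hM 0 i j) hβ).mul (ContinuousOn.sub (hU j) (CO.zero (hU j) h0))).sub
    (It_cont h0 (FW_int_cont h0 hβ hU i j))

theorem It_bdd {β a : ℝ} {f : ℝ → ℝ → ℝ} (h : ∀ t ∈ Icc 0 β, ∀ x ∈ Icc (0:ℝ) 1, |f t x| ≤ a) {t x : ℝ}
    (ht : t ∈ Icc 0 β) (hx : x ∈ Icc (0:ℝ) 1) : |It f t x| ≤ β * a := by
  have ha : 0 ≤ a := (abs_nonneg _).trans (h t ht x hx)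
  have := intervalIntegral.norm_integral_le_of_norm_le_const (a := 0) (b := t) (f := fun r => f r x) (C := a)
    (fun r hr => by
      rw [uIoc_of_le ht.1] at hr
      exact h r ⟨hr.1.le, hr.2.trans ht.2⟩ x hx)
  rw [Real.norm_eq_abs, sub_zero, abs_of_nonneg ht.1] at this
  unfold It
  nlinarith [ht.2]

noncomputable def Sys.CF (s : Sys ι) : ℝ := (Fintype.card ι : ℝ) * (2 * s.A + s.T * (2 * (s.A * s.R)))

theorem Sys.CF_nonneg (s : Sys ι) : 0 ≤ s.CF := by
  have := s.T_pos; have := s.hA; have := s.hR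
  unfold CF; positivity

theorem FW_bdd {s : Sys ι} {β a : ℝ} (hβ : β ≤ s.T) {U : ι → ℝ → ℝ → ℝ} (ha : 0 ≤ a) (hU : Bdd β a U) :
    Bdd β (s.CF * a) (FW s U) := by
  intro i t ht x hx
  have hA := s.hA; have hR := s.hR
  have h0 : (0:ℝ) ∈ Icc 0 β := ⟨le_rfl, ht.1.trans ht.2⟩
  have hd : ∀ j, ∀ r ∈ Icc 0 β, ∀ y ∈ Icc (0:ℝ) 1, |U j r y - U j 0 y| ≤ 2 * a := fun j r hr y hy => by
    refine (abs_sub _ _).trans ?_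
    linarith [hU j r hr y hy, hU j 0 h0 y hy]
  have hsub : Icc 0 β ⊆ Icc 0 s.T := Icc_subset_Icc_right hβ
  have : ∀ j, |s.M 0 i j t x * (U j t x - U j 0 x) - It (fun r y => s.M 1 i j r y * (U j r y - U j 0 y)) t x|
      ≤ (2 * s.A + s.T * (2 * (s.A * s.R))) * a := by
    intro j
    have h1 : |s.M 0 i j t x * (U j t x - U j 0 x)| ≤ s.A * (2 * a) := by
      rw [abs_mul]
      have := s.hMb 0 i j t (hsub ht) x hx
      rw [pow_zero, mul_one] at this
      exact mul_le_mul this (hd j t ht x hx) (abs_nonneg _) hA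
    have h2 := It_bdd (β := β) (a := s.A * s.R * (2 * a)) (f := fun r y => s.M 1 i j r y * (U j r y - U j 0 y)) (fun r hr y hy => by
      rw [abs_mul]
      have := s.hMb 1 i j r (hsub hr) y hy
      rw [pow_one] at this
      exact mul_le_mul this (hd j r hr y hy) (abs_nonneg _) (by positivity)) ht hx
    have h3 : β * (s.A * s.R * (2 * a)) ≤ s.T * (s.A * s.R * (2 * a)) := by gcongr
    refine (abs_sub _ _).trans ?_
    linarith
  refine (Finset.abs_sum_le_sum_abs _ _).trans ((Finset.sum_le_sum fun j _ => this j).trans ?_)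
  rw [Finset.sum_const, nsmul_eq_mul, Finset.card_univ]
  unfold Sys.CF; rw [mul_assoc]

theorem It_sub {β : ℝ} {f g : ℝ → ℝ → ℝ} (hf : CO β f) (hg : CO β g) {t x : ℝ} (ht : t ∈ Icc 0 β) (hx : x ∈ Icc (0:ℝ) 1) :
    It (fun r y => f r y - g r y) t x = It f t x - It g t x := by
  have hsub : Icc 0 t ⊆ Icc 0 β := Icc_subset_Icc_right ht.2
  exact intervalIntegral.integral_sub (((slice_t hf hx).mono hsub).intervalIntegrable_of_Icc ht.1)
    (((slice_t hg hx).mono hsub).intervalIntegrable_of_Icc ht.1)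

theorem FW_sub {s : Sys ι} {β : ℝ} (hβ : β ≤ s.T) {U V : ι → ℝ → ℝ → ℝ} (hU : ∀ i, CO β (U i)) (hV : ∀ i, CO β (V i))
    (i : ι) {t x : ℝ} (ht : t ∈ Icc 0 β) (hx : x ∈ Icc (0:ℝ) 1) :
    FW s (fun i t x => U i t x - V i t x) i t x = FW s U i t x - FW s V i t x := by
  unfold FW
  rw [← Finset.sum_sub_distrib]
  refine Finset.sum_congr rfl fun j _ => ?_
  have h0 := ht.1.trans ht.2
  have := It_sub (FW_int_cont h0 hβ hU i j) (FW_int_cont h0 hβ hV i j) ht hx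
  have e : It (fun r y => s.M 1 i j r y * (U j r y - V j r y - (U j 0 y - V j 0 y))) t x = 
    It (fun r y => s.M 1 i j r y * (U j r y - U j 0 y) - s.M 1 i j r y * (V j r y - V j 0 y)) t x := by
    congr 1; funext r y; ring
  rw [e, this]; ring

/-- time derivative of `FW` -/
theorem FW_deriv {s : Sys ι} {β : ℝ} (hβ : β ≤ s.T) {U z : ι → ℝ → ℝ → ℝ} (hU : ∀ i, CO β (U i))
    {t x : ℝ} (ht : t ∈ Icc 0 β) (hx : x ∈ Icc (0:ℝ) 1)
    (hd : ∀ j, HasDerivWithinAt (fun r => U j r x) (z j t x) (Icc 0 β) t) (i : ι) :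
    HasDerivWithinAt (fun r => FW s U i r x) (∑ j, s.M 0 i j t x * z j t x) (Icc 0 β) t := by
  have h0 := ht.1.trans ht.2
  unfold FW
  refine HasDerivWithinAt.fun_sum fun j _ => ?_
  have hm := (s.hMd 0 i j t ⟨ht.1, ht.2.trans hβ⟩ x hx).mono (Icc_subset_Icc_right hβ)
  have := (hm.mul ((hd j).sub_const (U j 0 x))).sub (It_deriv (FW_int_cont h0 hβ hU i j) ht hx)
  convert! this using 1
  push_cast; ring

theorem FW_zero {s : Sys ι} {U : ι → ℝ → ℝ → ℝ} (i : ι) (x : ℝ) : FW s U i 0 x = 0 := by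
  simp [FW, It]

theorem FW_eq {s : Sys ι} {β : ℝ} (hβ : β ≤ s.T) {U z : ι → ℝ → ℝ → ℝ} (hU : ∀ i, CO β (U i)) (hz : ∀ i, CO β (z i))
    (hd : ∀ j, ∀ t ∈ Icc 0 β, ∀ x ∈ Icc (0:ℝ) 1, HasDerivWithinAt (fun r => U j r x) (z j t x) (Icc 0 β) t) (i : ι)
    {t x : ℝ} (ht : t ∈ Icc 0 β) (hx : x ∈ Icc (0:ℝ) 1) :
    FW s U i t x = It (fun r y => ∑ j, s.M 0 i j r y * z j r y) t x := by
  have := ftc_within (f := fun r => FW s U i r x) (f' := fun r => ∑ j, s.M 0 i j r x * z j r x)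
    (fun r hr => FW_deriv hβ hU hr hx (fun j => hd j r hr x hx) i)
    (slice_t (f := fun r y => ∑ j, s.M 0 i j r y * z j r y) (continuousOn_finsetSum _ fun j _ =>
      (CO.mono' (s.hM 0 i j) hβ).mul (hz j)) hx) ⟨le_rfl, ht.1.trans ht.2⟩ ht
  rw [FW_zero, sub_zero] at this
  exact this.symm

structure Cl (s : Sys ι) (w wt wx : ι → ℝ → ℝ → ℝ) : Prop where
  c1 : ∀ i, C1 s.T (w i) (wt i) (wx i)
  eq : ∀ i, ∀ t ∈ Icc 0 s.T, ∀ x ∈ Icc (0:ℝ) 1, wx i t x = s.S i x * wt i t x + ∑ j, s.M 0 i j t x * w j t x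
  bd : ∀ t ∈ Icc 0 s.T, (fun i => w i t 0) ∈ s.Bd

/-- potential-like functions -/
structure PL (s : Sys ι) (W : ι → ℝ → ℝ → ℝ) : Prop where
  c : ∀ i, CO s.T (W i)
  mild : ∀ i, Along (s.Θ i) s.T (W i) (FW s W i)
  sol : ∀ i j, i ≠ j → Along (s.Θ i) s.T (pot (s.S j) (W j))
    (fun t x => (s.S j x - s.S i x) * W j t x + It (FW s W j) t x)
  bd : ∀ t ∈ Icc 0 s.T, (fun i => W i t 0) ∈ s.Bd
  z0 : ∀ i, W i 0 0 = 0

theorem Mw_cont {s : Sys ι} {β : ℝ} (hβ : β ≤ s.T) (l : ℕ) {w : ι → ℝ → ℝ → ℝ} (hw : ∀ i, CO β (w i)) (i : ι) :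
    CO β (fun t x => ∑ j, s.M l i j t x * w j t x) :=
  continuousOn_finsetSum _ fun j _ => (CO.mono' (s.hM l i j) hβ).mul (hw j)

theorem int_mem {κ : Type} [Fintype κ] (Bd : Submodule ℝ (κ → ℝ)) {f : κ → ℝ → ℝ} {p q : ℝ} (hpq : p ≤ q)
    (hf : ∀ i, ContinuousOn (f i) (Icc p q)) (h : ∀ t ∈ Icc p q, (fun i => f i t) ∈ Bd) :
    (fun i => ∫ t in p..q, f i t) ∈ Bd := by
  by_contra hcon
  obtain ⟨φ, hφ, hφ0⟩ := Submodule.exists_le_ker_of_notMem hcon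
  apply hφ
  have e : ∀ y : κ → ℝ, φ y = ∑ i, y i * φ (Pi.basisFun ℝ κ i) := by
    intro y
    conv_lhs => rw [← (Pi.basisFun ℝ κ).sum_repr y]
    simp
  rw [e]
  have hi : ∀ i, IntervalIntegrable (f i) volume p q := fun i => (hf i).intervalIntegrable_of_Icc hpq
  simp_rw [← intervalIntegral.integral_mul_const]
  rw [← intervalIntegral.integral_finsetSum (fun i _ => (hi i).mul_const _)]
  rw [intervalIntegral.integral_congr (g := fun _ => 0)]
  · simp
  · intro t ht
    rw [uIcc_of_le hpq] at ht
    have := hφ0 (h t ht)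
    rw [LinearMap.mem_ker, e] at this
    exact this

theorem Cl.potC1 {s : Sys ι} {w wt wx : ι → ℝ → ℝ → ℝ} (h : Cl s w wt wx) (i : ι) :
    C1 s.T (pot (s.S i) (w i)) (w i) (fun t x => s.S i x * w i t x +
      It (fun t x => ∑ j, s.M 0 i j t x * w j t x) t x) :=
  pot_C1 (s.hS i) s.T_pos.le (h.c1 i) (Mw_cont le_rfl 0 (fun i => (h.c1 i).c) i) (h.eq i)

theorem pot_deriv {S : ℝ → ℝ} {β : ℝ} {f : ℝ → ℝ → ℝ} (hf : CO β f) {t x : ℝ} (ht : t ∈ Icc 0 β)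
    (hx : x ∈ Icc (0:ℝ) 1) : HasDerivWithinAt (fun r => pot S f r x) (f t x) (Icc 0 β) t :=
  (It_deriv hf ht hx).add_const _

theorem Cl.FW_eq {s : Sys ι} {w wt wx : ι → ℝ → ℝ → ℝ} (h : Cl s w wt wx) (i : ι) 
    {t x : ℝ} (ht : t ∈ Icc 0 s.T) (hx : x ∈ Icc (0:ℝ) 1) :
    FW s (fun i => pot (s.S i) (w i)) i t x = It (fun t x => ∑ j, s.M 0 i j t x * w j t x) t x :=
  HypObs.FW_eq le_rfl (fun i => (h.potC1 i).c) (fun i => (h.c1 i).c)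
    (fun j t ht x hx => pot_deriv (h.c1 j).c ht hx) i ht hx

theorem Cl.pair {s : Sys ι} {w wt wx : ι → ℝ → ℝ → ℝ} (h : Cl s w wt wx) :
    Pair s s.T w (fun i => pot (s.S i) (w i)) (FW s (fun i => pot (s.S i) (w i))) (fun _ _ _ => 0) := by
  refine ⟨fun i => (h.c1 i).c, FW_cont s.T_pos.le le_rfl (fun i => (h.potC1 i).c), fun _ => continuousOn_const, ?_, ?_⟩
  · intro i
    refine ((h.c1 i).along i).congr (fun _ _ _ _ => rfl) fun t ht x hx => ?_
    rw [h.eq i t ht x hx]; ring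
  · intro i j _
    refine ((h.potC1 j).along i).congr (fun _ _ _ _ => rfl) fun t ht x hx => ?_
    rw [h.FW_eq j ht hx]; ring

theorem Cl.PL {s : Sys ι} {w wt wx : ι → ℝ → ℝ → ℝ} (h : Cl s w wt wx) : PL s (fun i => pot (s.S i) (w i)) := by
  have hc : ∀ i, CO s.T (fun t x => ∑ j, s.M 0 i j t x * w j t x) := Mw_cont le_rfl 0 (fun i => (h.c1 i).c)
  refine ⟨fun i => (h.potC1 i).c, ?_, ?_, ?_, ?_⟩
  · intro i
    refine ((h.potC1 i).along i).congr (fun _ _ _ _ => rfl) fun t ht x hx => ?_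
    rw [h.FW_eq i ht hx]; ring
  · intro i j _
    have := pot_C1 (s.hS j) s.T_pos.le (h.potC1 j) (It_cont s.T_pos.le (hc j)) (fun _ _ _ _ => rfl)
    refine (this.along i).congr (fun _ _ _ _ => rfl) fun t ht x hx => ?_
    have : It (FW s (fun i => pot (s.S i) (w i)) j) t x = It (It (fun t x => ∑ k, s.M 0 j k t x * w k t x)) t x := by
      refine intervalIntegral.integral_congr fun r hr => ?_
      rw [uIcc_of_le ht.1] at hr
      exact h.FW_eq j ⟨hr.1, hr.2.trans ht.2⟩ hx
    rw [this]; ring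
  · intro t ht
    have := int_mem s.Bd ht.1 (f := fun i r => w i r 0) (fun i => (slice_t (h.c1 i).c (left_mem_Icc.2 zero_le_one)).mono
      (Icc_subset_Icc_right ht.2)) fun r hr => h.bd r ⟨hr.1, hr.2.trans ht.2⟩
    convert this using 2 with i
    simp [pot, It]
  · intro i; simp [pot, It]

end HypObs
namespace HypObs
open Set MeasureTheory Filter Topology
variable {ι : Type} [Fintype ι]

def Dt (T : ℝ) (f g : ℝ → ℝ → ℝ) : Prop :=
  ∀ t ∈ Ico 0 T, ∀ x ∈ Icc (0:ℝ) 1, HasDerivWithinAt (fun r => f r x) (g t x) (Ico 0 T) t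

def COo (T : ℝ) (f : ℝ → ℝ → ℝ) : Prop := ∀ β < T, CO β f

theorem Icc_sub_Ico {β T : ℝ} (h : β < T) : Icc 0 β ⊆ Ico 0 T := fun _ ht => ⟨ht.1, lt_of_le_of_lt ht.2 h⟩

/-- uniform limit as `h → 0+` -/
def UL (β : ℝ) (f : ℝ → ℝ → ℝ → ℝ) (g : ℝ → ℝ → ℝ) : Prop :=
  ∀ ε > 0, ∃ δ > 0, ∀ h, 0 < h → h < δ → ∀ t ∈ Icc 0 β, ∀ x ∈ Icc (0:ℝ) 1, |f h t x - g t x| ≤ ε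

noncomputable def Dq (f : ℝ → ℝ → ℝ) (h t x : ℝ) : ℝ := (f (t + h) x - f t x) / h

theorem UL.add {β : ℝ} {f f' : ℝ → ℝ → ℝ → ℝ} {g g' : ℝ → ℝ → ℝ} (h1 : UL β f g) (h2 : UL β f' g') :
    UL β (fun h t x => f h t x + f' h t x) (fun t x => g t x + g' t x) := by
  intro ε hε
  obtain ⟨δ, hδ, h⟩ := h1 (ε / 2) (by positivity)
  obtain ⟨δ', hδ', h'⟩ := h2 (ε / 2) (by positivity)
  refine ⟨min δ δ', lt_min hδ hδ', fun k hk hkd t ht x hx => ?_⟩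
  have e1 := h k hk (hkd.trans_le (min_le_left _ _)) t ht x hx
  have e2 := h' k hk (hkd.trans_le (min_le_right _ _)) t ht x hx
  rw [abs_le] at *
  constructor <;> linarith [e1.1, e1.2, e2.1, e2.2]

theorem UL.sum {β : ℝ} {f : ι → ℝ → ℝ → ℝ → ℝ} {g : ι → ℝ → ℝ → ℝ} (h1 : ∀ i, UL β (f i) (g i)) :
    UL β (fun h t x => ∑ i, f i h t x) (fun t x => ∑ i, g i t x) := by
  classical
  have : ∀ J : Finset ι, UL β (fun h t x => ∑ i ∈ J, f i h t x) (fun t x => ∑ i ∈ J, g i t x) := by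
    intro J
    induction J using Finset.induction_on with
    | empty => intro ε hε; exact ⟨1, one_pos, fun h _ _ t _ x _ => by simpa using hε.le⟩
    | insert a J ha ih => 
      simp_rw [Finset.sum_insert ha]
      exact (h1 a).add ih
  exact this _

theorem UL.mul {β : ℝ} {f f' : ℝ → ℝ → ℝ → ℝ} {g g' : ℝ → ℝ → ℝ} (h1 : UL β f g) (h2 : UL β f' g')
    (hg : CO β g) (hg' : CO β g') :
    UL β (fun h t x => f h t x * f' h t x) (fun t x => g t x * g' t x) := by
  intro ε hε
  obtain ⟨K, hK0, hK⟩ := exists_bdd (ι := Unit) (z := fun _ => g) (fun _ => hg)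
  obtain ⟨K', hK0', hK'⟩ := exists_bdd (ι := Unit) (z := fun _ => g') (fun _ => hg')
  set e := min 1 (ε / (K + K' + 1)) with he
  have he0 : 0 < e := by positivity
  have hee : e * (K + K' + 1) ≤ ε := by
    have : e ≤ ε / (K + K' + 1) := min_le_right _ _
    rwa [le_div_iff₀ (by positivity)] at this
  obtain ⟨δ, hδ, h⟩ := h1 e he0
  obtain ⟨δ', hδ', h'⟩ := h2 e he0
  refine ⟨min δ δ', lt_min hδ hδ', fun k hk hkd t ht x hx => ?_⟩
  have e1 := h k hk (hkd.trans_le (min_le_left _ _)) t ht x hx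
  have e2 := h' k hk (hkd.trans_le (min_le_right _ _)) t ht x hx
  have e3 := hK () t ht x hx
  have e4 := hK' () t ht x hx
  have e5 : |f' k t x| ≤ K' + 1 := by
    have : f' k t x = (f' k t x - g' t x) + g' t x := by ring
    rw [this]
    refine (abs_add_le _ _).trans ?_
    have : e ≤ 1 := min_le_left _ _
    linarith
  have : f k t x * f' k t x - g t x * g' t x = (f k t x - g t x) * f' k t x + g t x * (f' k t x - g' t x) := by ring
  rw [this]
  refine (abs_add_le _ _).trans ?_
  rw [abs_mul, abs_mul]
  have e6 := mul_le_mul e1 e5 (abs_nonneg _) he0.le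
  have e7 := mul_le_mul e3 e2 (abs_nonneg _) hK0
  nlinarith

theorem CO.unif {β : ℝ} {f : ℝ → ℝ → ℝ} (hf : CO β f) : ∀ ε > 0, ∃ δ > 0, ∀ t ∈ Icc 0 β, ∀ x ∈ Icc (0:ℝ) 1,
    ∀ t' ∈ Icc 0 β, ∀ x' ∈ Icc (0:ℝ) 1, |t - t'| < δ → |x - x'| < δ → |f t x - f t' x'| ≤ ε := by
  intro ε hε
  have huc := (isCompact_Icc.prod isCompact_Icc).uniformContinuousOn_of_continuous hf
  rw [Metric.uniformContinuousOn_iff] at huc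
  obtain ⟨δ, hδ, h⟩ := huc ε hε
  refine ⟨δ, hδ, fun t ht x hx t' ht' x' hx' h1 h2 => ?_⟩
  have := h (t, x) ⟨ht, hx⟩ (t', x') ⟨ht', hx'⟩ (by
      rw [Prod.dist_eq, Real.dist_eq, Real.dist_eq]
      exact max_lt h1 h2)
  rw [Real.dist_eq] at this
  exact this.le

theorem UL.shift {β T : ℝ} (hβ : β < T) {f : ℝ → ℝ → ℝ} (hf : COo T f) : UL β (fun h t x => f (t + h) x) f := by
  intro ε hε
  obtain ⟨δ, hδ, h⟩ := (hf ((β + T) / 2) (by linarith)).unif ε hε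
  refine ⟨min δ ((T - β) / 2), lt_min hδ (by linarith), fun k hk hkd t ht x hx => ?_⟩
  have h1 := hkd.trans_le (min_le_left _ _)
  have h2 := hkd.trans_le (min_le_right _ _)
  refine h _ ⟨by linarith [ht.1], by linarith [ht.2]⟩ x hx t ⟨ht.1, by linarith [ht.2]⟩ x hx ?_ (by simpa using hδ)
  rw [add_sub_cancel_left, abs_of_pos hk]; exact h1

theorem UL.dq {β T : ℝ} (hβ : β < T) {f g : ℝ → ℝ → ℝ} (hg : COo T g) (hd : Dt T f g) : UL β (Dq f) g := by
  intro ε hε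
  obtain ⟨δ, hδ, h⟩ := (hg ((β + T) / 2) (by linarith)).unif ε hε
  refine ⟨min δ ((T - β) / 2), lt_min hδ (by linarith), fun k hk hkd t ht x hx => ?_⟩
  have h1 := hkd.trans_le (min_le_left _ _)
  have h2 := hkd.trans_le (min_le_right _ _)
  have hsub : Icc t (t + k) ⊆ Ico 0 T := fun r hr => ⟨ht.1.trans hr.1, by linarith [hr.2, ht.2]⟩
  have := (convex_Icc t (t + k)).norm_image_sub_le_of_norm_hasDerivWithin_le
    (f := fun r => f r x - g t x * r) (f' := fun r => g r x - g t x) (C := ε) (x := t) (y := t + k)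
    (fun r hr => by
      have := ((hd r (hsub hr) x hx).mono hsub).sub ((hasDerivWithinAt_id r (Icc t (t + k))).const_mul (g t x))
      rw [mul_one] at this
      exact this)
    (fun r hr => h r ⟨ht.1.trans hr.1, by linarith [hr.2, ht.2]⟩ x hx t ⟨ht.1, by linarith [ht.2]⟩ x hx
      (by rw [abs_lt]; constructor <;> linarith [hr.1, hr.2]) (by simpa using hδ))
    ⟨le_rfl, by linarith⟩ ⟨by linarith, le_rfl⟩
  rw [Real.norm_eq_abs, Real.norm_eq_abs, add_sub_cancel_left, abs_of_pos hk] at this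
  have e : Dq f k t x - g t x = (f (t + k) x - g t x * (t + k) - (f t x - g t x * t)) / k := by
    unfold Dq; field_simp; ring
  rw [e, abs_div, abs_of_pos hk, div_le_iff₀ hk]
  exact this

theorem Along.shift {s : Sys ι} {i : ι} {β β' h : ℝ} {f g : ℝ → ℝ → ℝ} (ha : Along (s.Θ i) β' f g)
    (h0 : 0 ≤ h) (hb : β + h ≤ β') :
    Along (s.Θ i) β (fun t x => f (t + h) x) (fun t x => g (t + h) x) := by
  intro c y0 hy0 y1 hy1 h0' h1'
  have := ha (c + h) y0 hy0 y1 hy1 ⟨by linarith [h0'.1], by linarith [h0'.2]⟩ ⟨by linarith [h1'.1], by linarith [h1'.2]⟩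
  have e : ∀ y, c + h - s.Θ i y = c - s.Θ i y + h := fun y => by ring
  simp only [e] at this
  exact this

theorem CO.shift {β β' h : ℝ} {f : ℝ → ℝ → ℝ} (hf : CO β' f) (h0 : 0 ≤ h) (hb : β + h ≤ β') :
    CO β (fun t x => f (t + h) x) :=
  ContinuousOn.comp hf (f := fun p : ℝ × ℝ => (p.1 + h, p.2)) (by fun_prop)
    fun p hp => ⟨⟨by linarith [hp.1.1], by linarith [hp.1.2]⟩, hp.2⟩

theorem CO.dq {β β' h : ℝ} {f : ℝ → ℝ → ℝ} (hf : CO β' f) (h0 : 0 < h) (hb : β + h ≤ β') :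
    CO β (Dq f h) :=
  (ContinuousOn.sub (hf.shift h0.le hb) (hf.mono' (by linarith))).div_const h

theorem Along.dq {s : Sys ι} {i : ι} {β β' h : ℝ} {f g : ℝ → ℝ → ℝ} (ha : Along (s.Θ i) β' f g) (hg : CO β' g)
    (h0 : 0 < h) (hb : β + h ≤ β') : Along (s.Θ i) β (Dq f h) (Dq g h) := by
  have := ((ha.shift h0.le hb).sub (ha.mono (by linarith)) (hg.shift h0.le hb) (hg.mono' (by linarith))).smul (1 / h)
  refine this.congr (fun t _ x _ => ?_) (fun t _ x _ => ?_) <;> unfold Dq <;> ring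

structure RegIn (s : Sys ι) (U w F H Ht : ι → ℝ → ℝ → ℝ) : Prop where
  cw : ∀ i, COo s.T (w i)
  cF : ∀ i, COo s.T (F i)
  cH : ∀ i, COo s.T (H i)
  cHt : ∀ i, COo s.T (Ht i)
  sol : ∀ i j, i ≠ j → ∀ β < s.T, Along (s.Θ i) β (U j) (fun t x => (s.S j x - s.S i x) * w j t x + F j t x)
  mild : ∀ i, ∀ β < s.T, Along (s.Θ i) β (w i) (fun t x => ∑ j, s.M 0 i j t x * w j t x + H i t x)
  dU : ∀ i, Dt s.T (U i) (w i)
  dF : ∀ i, Dt s.T (F i) (fun t x => ∑ j, s.M 0 i j t x * w j t x + H i t x)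
  dH : ∀ i, Dt s.T (H i) (Ht i)
  one : ∀ i, ∀ t ∈ Ico 0 s.T, w i t 1 = w i 0 1
  bd : ∀ t ∈ Ico 0 s.T, (fun i => w i t 0) ∈ s.Bd

structure RegOut (s : Sys ι) (w H Ht z : ι → ℝ → ℝ → ℝ) : Prop where
  cz : ∀ i, COo s.T (z i)
  dz : ∀ i, Dt s.T (w i) (z i)
  sol : ∀ i j, i ≠ j → ∀ β < s.T, Along (s.Θ i) β (w j) (fun t x => (s.S j x - s.S i x) * z j t x +
    (∑ k, s.M 0 j k t x * w k t x + H j t x))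
  mild : ∀ i, ∀ β < s.T, Along (s.Θ i) β (z i) (fun t x => ∑ j, s.M 0 i j t x * z j t x +
    (∑ j, s.M 1 i j t x * w j t x + Ht i t x))
  one : ∀ i, ∀ t ∈ Ico 0 s.T, z i t 1 = 0
  bd : ∀ t ∈ Ico 0 s.T, (fun i => z i t 0) ∈ s.Bd

theorem Sys.hMD (s : Sys ι) (l : ℕ) (i j : ι) : Dt s.T (s.M l i j) (fun t x => (l + 1 : ℝ) * s.M (l + 1) i j t x) :=
  fun t ht x hx => (s.hMd l i j t ⟨ht.1, ht.2.le⟩ x hx).mono Ico_subset_Icc_self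

/-- commutator -/
noncomputable def Eh (s : Sys ι) (w H : ι → ℝ → ℝ → ℝ) (i : ι) (h t x : ℝ) : ℝ :=
  Dq (fun t x => ∑ j, s.M 0 i j t x * w j t x + H i t x) h t x - ∑ j, s.M 0 i j t x * Dq (w j) h t x

theorem Eh_UL {s : Sys ι} {U w F H Ht : ι → ℝ → ℝ → ℝ} (r : RegIn s U w F H Ht) {β : ℝ} (hβ : β < s.T) (i : ι) :
    UL β (Eh s w H i) (fun t x => ∑ j, s.M 1 i j t x * w j t x + Ht i t x) := by
  have hM1 : ∀ j, COo s.T (s.M 1 i j) := fun j b hb => (s.hM 1 i j).mono (prod_mono (Icc_subset_Icc_right hb.le) le_rfl)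
  have h1 : ∀ j, UL β (Dq (s.M 0 i j)) (s.M 1 i j) := fun j => UL.dq hβ (hM1 j) (by simpa using s.hMD 0 i j)
  have h2 := (UL.sum fun j => (h1 j).mul (UL.shift hβ (r.cw j)) (hM1 j β hβ) (r.cw j β hβ)).add
    (UL.dq hβ (r.cHt i) (r.dH i))
  convert! h2 using 1
  funext h t x
  unfold Eh Dq
  rw [add_sub_add_comm, ← Finset.sum_sub_distrib, add_div, add_sub_right_comm, Finset.sum_div,
    ← Finset.sum_sub_distrib]
  congr 1
  refine Finset.sum_congr rfl fun j _ => ?_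
  ring

theorem Eh_cont {s : Sys ι} {U w F H Ht : ι → ℝ → ℝ → ℝ} (r : RegIn s U w F H Ht) {β β' h : ℝ} (hβ' : β' < s.T) (h0 : 0 < h)
    (hb : β + h ≤ β') (i : ι) : CO β (Eh s w H i h) := by
  refine ContinuousOn.sub (CO.dq (β' := β') ?_ h0 hb) ?_
  · exact (Mw_cont hβ'.le 0 (fun i => r.cw i β' hβ') i).add (r.cH i β' hβ')
  · exact Mw_cont (by linarith) 0 (fun i => (r.cw i β' hβ').dq h0 hb) i

theorem pairDq {s : Sys ι} {U w F H Ht : ι → ℝ → ℝ → ℝ} (r : RegIn s U w F H Ht) {β β' h : ℝ} (hβ' : β' < s.T) (h0 : 0 < h)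
    (hb : β + h ≤ β') : Pair s β (fun i => Dq (w i) h) (fun i => Dq (U i) h) (fun i => Dq (F i) h) (fun i => Eh s w H i h) := by
  refine ⟨fun i => (r.cw i β' hβ').dq h0 hb, fun i => (r.cF i β' hβ').dq h0 hb, Eh_cont r hβ' h0 hb, ?_, ?_⟩
  · intro i
    refine Along.congr ((r.mild i β' hβ').dq ((Mw_cont hβ'.le 0 (fun i => r.cw i β' hβ') i).add (r.cH i β' hβ')) h0 hb)
      (fun _ _ _ _ => rfl) fun t _ x _ => ?_
    unfold Eh; ring
  · intro i j hij
    have hc : CO β' (fun t x => (s.S j x - s.S i x) * w j t x + F j t x) :=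
      ContinuousOn.add (ContinuousOn.mul
        (((s.hS j).comp continuous_snd).sub ((s.hS i).comp continuous_snd)).continuousOn (r.cw j β' hβ')) (r.cF j β' hβ')
    refine Along.congr ((r.sol i j hij β' hβ').dq hc h0 hb) (fun _ _ _ _ => rfl) fun t _ x _ => ?_
    unfold Dq; ring

theorem Pair.sub {s : Sys ι} {β : ℝ} (hβ : β ≤ s.T) {z W F H z' W' F' H' : ι → ℝ → ℝ → ℝ} (h : Pair s β z W F H) (h' : Pair s β z' W' F' H') :
    Pair s β (fun i t x => z i t x - z' i t x) (fun i t x => W i t x - W' i t x) (fun i t x => F i t x - F' i t x)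
      (fun i t x => H i t x - H' i t x) := by
  refine ⟨fun i => ContinuousOn.sub (h.cz i) (h'.cz i), fun i => ContinuousOn.sub (h.cF i) (h'.cF i), 
    fun i => ContinuousOn.sub (h.cH i) (h'.cH i), fun i => ?_, fun i j hij => ?_⟩
  · refine ((h.mild i).sub (h'.mild i) ((Mw_cont hβ 0 h.cz i).add (h.cH i)) ((Mw_cont hβ 0 h'.cz i).add (h'.cH i))).congr
      (fun _ _ _ _ => rfl) fun t _ x _ => ?_
    simp_rw [mul_sub]
    rw [Finset.sum_sub_distrib]; ring
  · have hc : ∀ {z F : ι → ℝ → ℝ → ℝ}, (∀ i, CO β (z i)) → (∀ i, CO β (F i)) →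
        CO β (fun t x => (s.S j x - s.S i x) * z j t x + F j t x) := fun hz hF =>
      ContinuousOn.add (ContinuousOn.mul
        (((s.hS j).comp continuous_snd).sub ((s.hS i).comp continuous_snd)).continuousOn (hz j)) (hF j)
    refine ((h.sol i j hij).sub (h'.sol i j hij) (hc h.cz h.cF) (hc h'.cz h'.cF)).congr
      (fun _ _ _ _ => rfl) fun t _ x _ => ?_
    ring

end HypObs
namespace HypObs
open Set MeasureTheory Filter Topology
variable {ι : Type} [Fintype ι]

theorem UL.cauchy {β : ℝ} {f : ℝ → ℝ → ℝ → ℝ} {g : ℝ → ℝ → ℝ} (h : UL β f g) : ∀ ε > 0, ∃ δ > 0,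
    ∀ h, 0 < h → h < δ → ∀ h', 0 < h' → h' < δ → ∀ t ∈ Icc 0 β, ∀ x ∈ Icc (0:ℝ) 1, |f h t x - f h' t x| ≤ ε := by
  intro ε hε
  obtain ⟨δ, hδ, H⟩ := h (ε / 2) (by positivity)
  refine ⟨δ, hδ, fun k hk hkd k' hk' hkd' t ht x hx => ?_⟩
  have e1 := H k hk hkd t ht x hx
  have e2 := H k' hk' hkd' t ht x hx
  rw [abs_le] at *
  constructor <;> linarith [e1.1, e1.2, e2.1, e2.2]

/-- finite families of positive thresholds -/
theorem exists_delta {P : ι → ℝ → Prop} (hmono : ∀ i δ δ', δ' ≤ δ → P i δ → P i δ') (h : ∀ i, ∃ δ > 0, P i δ) :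
    ∃ δ > 0, ∀ i, P i δ := by
  choose d hd hP using h
  rcases isEmpty_or_nonempty ι with he | he
  · exact ⟨1, one_pos, fun i => (he.false i).elim⟩
  · refine ⟨Finset.univ.inf' Finset.univ_nonempty d, ?_, fun i => hmono i _ _ (Finset.inf'_le _ (Finset.mem_univ i)) (hP i)⟩
    rw [gt_iff_lt, Finset.lt_inf'_iff]
    exact fun i _ => hd i

theorem Reg_cauchy {s : Sys ι} {U w F H Ht : ι → ℝ → ℝ → ℝ} (r : RegIn s U w F H Ht) {β : ℝ} (hβ0 : s.Topt ≤ β) (hβ : β < s.T) :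
    ∀ ε > 0, ∃ δ > 0, ∀ h, 0 < h → h < δ → ∀ h', 0 < h' → h' < δ → ∀ i, ∀ t ∈ Icc 0 β, ∀ x ∈ Icc (0:ℝ) 1,
      |Dq (w i) h t x - Dq (w i) h' t x| ≤ ε := by
  intro ε hε
  obtain ⟨C, hC0, hC⟩ := SupLemma s
  set e := ε / (C + 1) with he
  have he0 : 0 < e := by positivity
  have cG : ∀ i, COo s.T (fun t x => ∑ j, s.M 0 i j t x * w j t x + H i t x) := fun i b hb =>
    ContinuousOn.add (Mw_cont hb.le 0 (fun i => r.cw i b hb) i) (r.cH i b hb)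
  have key : ∀ f : ι → ℝ → ℝ → ℝ → ℝ, ∀ g : ι → ℝ → ℝ → ℝ, (∀ i, UL β (f i) (g i)) → ∃ δ > 0, ∀ i,
      ∀ h, 0 < h → h < δ → ∀ h', 0 < h' → h' < δ → ∀ t ∈ Icc 0 β, ∀ x ∈ Icc (0:ℝ) 1, |f i h t x - f i h' t x| ≤ e := by
    intro f g hfg
    refine exists_delta ?_ fun i => (hfg i).cauchy e he0
    intro i δ δ' hd hP h h0 hh h' h0' hh'
    exact hP h h0 (hh.trans_le hd) h' h0' (hh'.trans_le hd)
  obtain ⟨d1, hd1, k1⟩ := key _ _ fun i => UL.dq hβ (r.cw i) (r.dU i)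
  obtain ⟨d2, hd2, k2⟩ := key _ _ fun i => UL.dq hβ (cG i) (r.dF i)
  obtain ⟨d3, hd3, k3⟩ := key _ _ fun i => Eh_UL r hβ i
  refine ⟨min (min d1 d2) (min d3 ((s.T - β) / 2)), by
    refine lt_min (lt_min hd1 hd2) (lt_min hd3 (by linarith)), ?_⟩
  intro h h0 hh h' h0' hh' i t ht x hx
  simp only [lt_min_iff] at hh hh'
  have hβ' : (β + s.T) / 2 < s.T := by linarith
  have p := (pairDq r hβ' h0 (β := β) (by linarith)).sub hβ.le (pairDq r hβ' h0' (β := β) (by linarith))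
  have := hC β hβ0 hβ.le _ _ _ _ e he0.le p 
    (fun i t ht x hx => k1 i h h0 hh.1.1 h' h0' hh'.1.1 t ht x hx)
    (fun i t ht x hx => k2 i h h0 hh.1.2 h' h0' hh'.1.2 t ht x hx)
    (fun i t ht x hx => k3 i h h0 hh.2.1 h' h0' hh'.2.1 t ht x hx)
    (fun t ht => by
      have hb : ∀ h, 0 < h → h < (s.T - β) / 2 → (fun i => Dq (w i) h t 0) ∈ s.Bd := by
        intro h h0 hh
        have := s.Bd.smul_mem (1 / h) (s.Bd.sub_mem (r.bd (t + h) ⟨by linarith [ht.1], by linarith [ht.2]⟩) (r.bd t (Icc_sub_Ico hβ ht)))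
        convert this using 1
        funext i; simp [Dq]; ring
      exact s.Bd.sub_mem (hb h h0 hh.2.2) (hb h' h0' hh'.2.2))
    (fun i t ht => by
      have e1 := r.one i t (Icc_sub_Ico hβ ht)
      have e2 := r.one i (t + h) ⟨by linarith [ht.1], by linarith [ht.2]⟩
      have e3 := r.one i (t + h') ⟨by linarith [ht.1], by linarith [ht.2]⟩
      simp [Dq, e1, e2, e3]) i t ht x hx
  refine this.trans ?_
  have : e * (C + 1) = ε := by rw [he]; field_simp
  nlinarith

noncomputable def Dw (s : Sys ι) (w : ι → ℝ → ℝ → ℝ) (i : ι) (t x : ℝ) : ℝ := derivWithin (fun r => w i r x) (Ico 0 s.T) t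

theorem Dt.eq {T : ℝ} {f g : ℝ → ℝ → ℝ} (h : Dt T f g) {t x : ℝ} (ht : t ∈ Ico 0 T) (hx : x ∈ Icc (0:ℝ) 1) :
    derivWithin (fun r => f r x) (Ico 0 T) t = g t x :=
  (h t ht x hx).derivWithin (uniqueDiffOn_Ico 0 T t ht)

theorem Dt.of_Icc {T : ℝ} {f g : ℝ → ℝ → ℝ} (h : ∀ β < T, ∀ t ∈ Icc 0 β, ∀ x ∈ Icc (0:ℝ) 1,
    HasDerivWithinAt (fun r => f r x) (g t x) (Icc 0 β) t) : Dt T f g := by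
  intro t ht x hx
  refine (h ((t + T) / 2) (by linarith [ht.2]) t ⟨ht.1, by linarith [ht.2]⟩ x hx).mono_of_mem_nhdsWithin ?_
  rw [mem_nhdsWithin_iff_exists_mem_nhds_inter]
  refine ⟨Iio ((t + T) / 2), Iio_mem_nhds (by linarith [ht.2]), fun r hr => ⟨hr.2.1, le_of_lt hr.1⟩⟩

theorem COo.of_ge {T β0 : ℝ} {f : ℝ → ℝ → ℝ} (h0 : β0 < T) (h : ∀ β, β0 ≤ β → β < T → CO β f) : COo T f :=
  fun β hβ => (h (max β β0) (le_max_right _ _) (max_lt hβ h0)).mono' (le_max_left _ _)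

theorem Reg_UL {s : Sys ι} {U w F H Ht : ι → ℝ → ℝ → ℝ} (r : RegIn s U w F H Ht) :
    (∀ i, COo s.T (Dw s w i)) ∧ (∀ i, Dt s.T (w i) (Dw s w i)) ∧ ∀ β < s.T, ∀ i, UL β (Dq (w i)) (Dw s w i) := by
  -- pointwise limit
  have hex : ∀ i, ∀ t ∈ Ico 0 s.T, ∀ x ∈ Icc (0:ℝ) 1, ∃ l, Tendsto (fun h => Dq (w i) h t x) (𝓝[>] 0) (𝓝 l) := by
    intro i t ht x hx
    apply cauchy_map_iff_exists_tendsto.1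
    have hβ : max t s.Topt < s.T := max_lt ht.2 s.hT
    rw [Metric.cauchy_iff]
    refine ⟨inferInstance, fun ε hε => ?_⟩
    obtain ⟨δ, hδ, h⟩ := Reg_cauchy r (le_max_right _ _) hβ (ε / 2) (by positivity)
    refine ⟨(fun h => Dq (w i) h t x) '' Ioo 0 δ, image_mem_map (Ioo_mem_nhdsGT hδ), ?_⟩
    rintro _ ⟨p, hp, rfl⟩ _ ⟨q, hq, rfl⟩
    have := h p hp.1 hp.2 q hq.1 hq.2 i t ⟨ht.1, le_max_left _ _⟩ x hx
    rw [Real.dist_eq]; linarith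
  classical
  set z : ι → ℝ → ℝ → ℝ := fun i t x => limUnder (𝓝[>] 0) (fun h => Dq (w i) h t x) with hz
  have hlim : ∀ i, ∀ t ∈ Ico 0 s.T, ∀ x ∈ Icc (0:ℝ) 1, Tendsto (fun h => Dq (w i) h t x) (𝓝[>] 0) (𝓝 (z i t x)) :=
    fun i t ht x hx => tendsto_nhds_limUnder (hex i t ht x hx)
  have hUL0 : ∀ β, s.Topt ≤ β → β < s.T → ∀ i, UL β (Dq (w i)) (z i) := by
    intro β h0 hβ i ε hε
    obtain ⟨δ, hδ, h⟩ := Reg_cauchy r h0 hβ ε hε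
    refine ⟨δ, hδ, fun k hk hkd t ht x hx => ?_⟩
    have h1 := (hlim i t (Icc_sub_Ico hβ ht) x hx).const_sub (Dq (w i) k t x)
    refine le_of_tendsto h1.abs ?_
    filter_upwards [Ioo_mem_nhdsGT hδ] with k' hk'
    exact h k hk hkd k' hk'.1 hk'.2 i t ht x hx
  have hUL : ∀ β, β < s.T → ∀ i, UL β (Dq (w i)) (z i) := by
    intro β hβ i ε hε
    obtain ⟨δ, hδ, h⟩ := hUL0 (max β s.Topt) (le_max_right _ _) (max_lt hβ s.hT) i ε hε
    exact ⟨δ, hδ, fun k hk hkd t ht x hx => h k hk hkd t ⟨ht.1, ht.2.trans (le_max_left _ _)⟩ x hx⟩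
  have hcz : ∀ i, COo s.T (z i) := by
    intro i β hβ
    have ht : TendstoUniformlyOn (fun h (p : ℝ × ℝ) => Dq (w i) h p.1 p.2) (fun p => z i p.1 p.2) (𝓝[>] 0) (Icc 0 β ×ˢ Icc 0 1) := by
      rw [Metric.tendstoUniformlyOn_iff]
      intro ε hε
      obtain ⟨δ, hδ, h⟩ := hUL β hβ i (ε / 2) (by positivity)
      filter_upwards [Ioo_mem_nhdsGT hδ] with k hk p hp
      rw [Real.dist_eq, abs_sub_comm]
      linarith [h k hk.1 hk.2 p.1 hp.1 p.2 hp.2]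
    refine ht.continuousOn (Eventually.frequently ?_)
    have : 0 < (s.T - β) / 2 := by linarith
    filter_upwards [Ioo_mem_nhdsGT this] with k hk
    exact (r.cw i ((β + s.T) / 2) (by linarith)).dq hk.1 (by linarith [hk.2])
  have hdz : ∀ i, Dt s.T (w i) (z i) := by
    intro i
    refine Dt.of_Icc fun β hβ t ht x hx => ?_
    have hw : ∀ t ∈ Icc 0 β, w i t x = w i 0 x + It (z i) t x := by
      intro t ht
      have hsub : Icc 0 t ⊆ Icc 0 β := Icc_subset_Icc_right ht.2
      have := intervalIntegral.integral_eq_sub_of_hasDeriv_right_of_le (f := fun r => w i r x) (f' := fun r => z i r x) ht.1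
        ((slice_t (r.cw i β hβ) hx).mono hsub) (fun q hq => ?_)
        (((slice_t (hcz i β hβ) hx).mono hsub).intervalIntegrable_of_Icc ht.1)
      · unfold It; rw [this]; ring
      · rw [hasDerivWithinAt_iff_tendsto_slope' (notMem_Ioi.2 le_rfl)]
        have h1 := hlim i q (Icc_sub_Ico hβ (hsub (Ioo_subset_Icc_self hq))) x hx
        have h2 : Tendsto (fun p : ℝ => p - q) (𝓝[>] q) (𝓝[>] 0) := by
          refine tendsto_nhdsWithin_iff.2 ⟨?_, ?_⟩
          · have : Tendsto (fun p : ℝ => p - q) (𝓝 q) (𝓝 (q - q)) := (continuous_id.sub continuous_const).tendsto q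
            rw [sub_self] at this
            exact this.mono_left nhdsWithin_le_nhds
          · filter_upwards [self_mem_nhdsWithin] with p hp
            exact sub_pos.2 (mem_Ioi.1 hp)
        refine (h1.comp h2).congr fun p => ?_
        simp only [Function.comp, Dq, slope_def_field]
        rw [add_sub_cancel]
    have := ((It_deriv (hcz i β hβ) ht hx).const_add (w i 0 x))
    exact this.congr hw (hw t ht)
  have heq : ∀ i, ∀ t ∈ Ico 0 s.T, ∀ x ∈ Icc (0:ℝ) 1, Dw s w i t x = z i t x := fun i t ht x hx => (hdz i).eq ht hx
  refine ⟨fun i β hβ => (hcz i β hβ).congr fun p hp => heq i _ (Icc_sub_Ico hβ hp.1) _ hp.2, ?_, ?_⟩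
  · intro i t ht x hx; rw [heq i t ht x hx]; exact hdz i t ht x hx
  · intro β hβ i ε hε
    obtain ⟨δ, hδ, h⟩ := hUL β hβ i ε hε
    refine ⟨δ, hδ, fun k hk hkd t ht x hx => ?_⟩
    rw [heq i t (Icc_sub_Ico hβ ht) x hx]
    exact h k hk hkd t ht x hx

end HypObs
namespace HypObs
open Set MeasureTheory Filter Topology
variable {ι : Type} [Fintype ι]

theorem UL.const {β : ℝ} (g : ℝ → ℝ → ℝ) : UL β (fun _ => g) g :=
  fun ε hε => ⟨1, one_pos, fun h _ _ t _ x _ => by simpa using hε.le⟩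

theorem Along.of_UL {s : Sys ι} {i : ι} {β δ : ℝ} (hδ : 0 < δ) {f g : ℝ → ℝ → ℝ → ℝ} {f0 g0 : ℝ → ℝ → ℝ}
    (ha : ∀ h, 0 < h → h < δ → Along (s.Θ i) β (f h) (g h) ∧ CO β (g h))
    (hf : UL β f f0) (hg : UL β g g0) (hc : CO β g0) : Along (s.Θ i) β f0 g0 := by
  refine Along.lim hc fun ε hε => ?_
  obtain ⟨d1, hd1, h1⟩ := hf ε hε
  obtain ⟨d2, hd2, h2⟩ := hg ε hε
  set h := min δ (min d1 d2) / 2 with hh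
  have hm : 0 < min δ (min d1 d2) := lt_min hδ (lt_min hd1 hd2)
  have h0 : 0 < h := by positivity
  have hlt : h < min δ (min d1 d2) := by rw [hh]; linarith
  simp only [lt_min_iff] at hlt
  refine ⟨f h, g h, (ha h h0 hlt.1).1, (ha h h0 hlt.1).2, fun t ht x hx => ⟨h1 h h0 hlt.2.1 t ht x hx, h2 h h0 hlt.2.2 t ht x hx⟩⟩

theorem S_cont {s : Sys ι} {β : ℝ} (i j : ι) : CO β (fun _ x => s.S j x - s.S i x) :=
  (((s.hS j).comp continuous_snd).sub ((s.hS i).comp continuous_snd)).continuousOn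

theorem M_COo (s : Sys ι) (l : ℕ) (i j : ι) : COo s.T (s.M l i j) := fun _ hb => CO.mono' (s.hM l i j) hb.le

theorem Reg {s : Sys ι} {U w F H Ht : ι → ℝ → ℝ → ℝ} (r : RegIn s U w F H Ht) : RegOut s w H Ht (Dw s w) := by
  obtain ⟨hc, hd, hu⟩ := Reg_UL r
  have cG : ∀ i, COo s.T (fun t x => ∑ j, s.M 0 i j t x * w j t x + H i t x) := fun i b hb =>
    ContinuousOn.add (Mw_cont hb.le 0 (fun i => r.cw i b hb) i) (r.cH i b hb)
  have cE : ∀ i, COo s.T (fun t x => ∑ j, s.M 1 i j t x * w j t x + Ht i t x) := fun i b hb =>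
    ContinuousOn.add (Mw_cont hb.le 1 (fun i => r.cw i b hb) i) (r.cHt i b hb)
  refine ⟨hc, hd, ?_, ?_, ?_, ?_⟩
  · intro i j hij β hβ
    have hδ : 0 < (s.T - β) / 2 := by linarith
    have hβ' : (β + s.T) / 2 < s.T := by linarith
    refine Along.of_UL hδ (f := Dq (U j)) (g := fun h t x => (s.S j x - s.S i x) * Dq (w j) h t x + Dq (F j) h t x) ?_ 
      (UL.dq hβ (r.cw j) (r.dU j)) (((UL.const _).mul (hu β hβ j) (S_cont i j) (hc j β hβ)).add
        (UL.dq hβ (cG j) (r.dF j))) (ContinuousOn.add (ContinuousOn.mul (S_cont i j) (hc j β hβ)) (cG j β hβ))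
    intro h h0 hh
    have p := pairDq r hβ' h0 (β := β) (by linarith)
    exact ⟨p.sol i j hij, ContinuousOn.add (ContinuousOn.mul (S_cont i j) (p.cz j)) (p.cF j)⟩
  · intro i β hβ
    have hδ : 0 < (s.T - β) / 2 := by linarith
    have hβ' : (β + s.T) / 2 < s.T := by linarith
    refine Along.of_UL hδ (f := Dq (w i)) (g := fun h t x => ∑ j, s.M 0 i j t x * Dq (w j) h t x + Eh s w H i h t x) ?_ 
      (hu β hβ i) ((UL.sum fun j => (UL.const (s.M 0 i j)).mul (hu β hβ j) (M_COo s 0 i j β hβ) (hc j β hβ)).add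
        (Eh_UL r hβ i)) (ContinuousOn.add (Mw_cont hβ.le 0 (fun i => hc i β hβ) i) (cE i β hβ))
    intro h h0 hh
    have p := pairDq r hβ' h0 (β := β) (by linarith)
    exact ⟨p.mild i, ContinuousOn.add (Mw_cont hβ.le 0 p.cz i) (p.cH i)⟩
  · intro i t ht
    have h1 : HasDerivWithinAt (fun r => w i r 1) 0 (Ico 0 s.T) t :=
      (hasDerivWithinAt_const t (Ico 0 s.T) (w i 0 1)).congr (fun q hq => r.one i q hq) (r.one i t ht)
    exact h1.derivWithin (uniqueDiffOn_Ico 0 s.T t ht)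
  · intro t ht
    have hcl : IsClosed (s.Bd : Set (ι → ℝ)) := s.Bd.closed_of_finiteDimensional
    have hβ : (t + s.T) / 2 < s.T := by linarith [ht.2]
    have : Tendsto (fun h => (fun i => Dq (w i) h t 0)) (𝓝[>] (0:ℝ)) (𝓝 (fun i => Dw s w i t 0)) := by
      rw [tendsto_pi_nhds]
      intro i
      rw [Metric.tendsto_nhds]
      intro ε hε
      obtain ⟨δ, hδ, h⟩ := hu _ hβ i (ε / 2) (by positivity)
      filter_upwards [Ioo_mem_nhdsGT hδ] with k hk
      rw [Real.dist_eq]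
      linarith [h k hk.1 hk.2 t ⟨ht.1, by linarith [ht.2]⟩ 0 (left_mem_Icc.2 zero_le_one)]
    refine hcl.mem_of_tendsto this ?_
    have hδ : 0 < (s.T - t) / 2 := by linarith [ht.2]
    filter_upwards [Ioo_mem_nhdsGT hδ] with h hh
    have := s.Bd.smul_mem (1 / h) (s.Bd.sub_mem (r.bd (t + h) ⟨by linarith [ht.1, hh.1], by linarith [hh.2]⟩) (r.bd t ht))
    have e : (fun i => Dq (w i) h t 0) = (1 / h) • ((fun i => w i (t + h) 0) - fun i => w i t 0) := by
      funext i; simp [Dq]; ring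
    rw [e]; exact this

/-- normalized time derivatives -/
noncomputable def uu (s : Sys ι) (W : ι → ℝ → ℝ → ℝ) : ℕ → ι → ℝ → ℝ → ℝ
  | 0 => Dw s W
  | l + 1 => fun i t x => Dw s (uu s W l) i t x / (l + 1)

noncomputable def HH (s : Sys ι) (W : ι → ℝ → ℝ → ℝ) (l : ℕ) (i : ι) (t x : ℝ) : ℝ :=
  ∑ p ∈ Finset.range l, ∑ j, s.M (l - p) i j t x * uu s W p j t x

noncomputable def GG (s : Sys ι) (W : ι → ℝ → ℝ → ℝ) (l : ℕ) (i : ι) (t x : ℝ) : ℝ :=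
  ∑ j, s.M 0 i j t x * uu s W l j t x + HH s W l i t x

noncomputable def Ul (s : Sys ι) (W : ι → ℝ → ℝ → ℝ) : ℕ → ι → ℝ → ℝ → ℝ
  | 0 => W
  | l + 1 => fun i t x => uu s W l i t x / (l + 1)

noncomputable def Fl (s : Sys ι) (W : ι → ℝ → ℝ → ℝ) : ℕ → ι → ℝ → ℝ → ℝ
  | 0 => FW s W
  | l + 1 => fun i t x => GG s W l i t x / (l + 1)

noncomputable def Htl (s : Sys ι) (W : ι → ℝ → ℝ → ℝ) (l : ℕ) (i : ι) (t x : ℝ) : ℝ :=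
  (l + 1) * HH s W (l + 1) i t x - ∑ j, s.M 1 i j t x * uu s W l j t x

theorem HH_cont {s : Sys ι} {W : ι → ℝ → ℝ → ℝ} {l : ℕ} (h : ∀ p < l, ∀ i, COo s.T (uu s W p i)) (i : ι) :
    COo s.T (HH s W l i) := fun β hβ => by
  refine continuousOn_finsetSum _ fun p hp => ?_
  exact Mw_cont hβ.le _ (fun i => h p (Finset.mem_range.1 hp) i β hβ) i

theorem HH_deriv {s : Sys ι} {W : ι → ℝ → ℝ → ℝ} {l : ℕ} 
    (h : ∀ p < l, ∀ i, Dt s.T (uu s W p i) (fun t x => (p + 1) * uu s W (p + 1) i t x)) (i : ι) :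
    Dt s.T (HH s W l i) (Htl s W l i) := by
  intro t ht x hx
  unfold HH
  have h1 : HasDerivWithinAt (fun r => ∑ p ∈ Finset.range l, ∑ j, s.M (l - p) i j r x * uu s W p j r x)
    (∑ p ∈ Finset.range l, ∑ j, ((((l - p : ℕ) + 1 : ℝ) * s.M (l - p + 1) i j t x) * uu s W p j t x +
      s.M (l - p) i j t x * ((p + 1) * uu s W (p + 1) j t x))) (Ico 0 s.T) t := by
    refine HasDerivWithinAt.fun_sum fun p hp => HasDerivWithinAt.fun_sum fun j _ => ?_
    exact (s.hMD (l - p) i j t ht x hx).mul (h p (Finset.mem_range.1 hp) j t ht x hx)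
  convert! h1 using 1
  set a : ℕ → ℝ := fun p => ∑ j, s.M (l + 1 - p) i j t x * uu s W p j t x with ha
  have e1 : ∑ p ∈ Finset.range l, ∑ j, ((((l - p : ℕ) + 1 : ℝ) * s.M (l - p + 1) i j t x) * uu s W p j t x +
      s.M (l - p) i j t x * ((p + 1) * uu s W (p + 1) j t x)) = 
      ∑ p ∈ Finset.range l, ((l + 1 - p : ℝ) * a p) + ∑ p ∈ Finset.range l, ((p + 1 : ℕ) : ℝ) * a (p + 1) := by
    rw [← Finset.sum_add_distrib]
    refine Finset.sum_congr rfl fun p hp => ?_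
    have hp' := Finset.mem_range.1 hp
    rw [Finset.sum_add_distrib]
    have e : l - p + 1 = l + 1 - p := by omega
    have e' : l + 1 - (p + 1) = l - p := by omega
    simp only [ha, Finset.mul_sum, e, e']
    congr 1
    · refine Finset.sum_congr rfl fun j _ => ?_
      rw [Nat.cast_sub hp'.le]; ring
    · refine Finset.sum_congr rfl fun j _ => ?_
      push_cast; ring
  have e2 : ∑ p ∈ Finset.range l, ((p + 1 : ℕ) : ℝ) * a (p + 1) = ∑ p ∈ Finset.range (l + 1), (p : ℝ) * a p := by
    rw [Finset.sum_range_succ' (fun p => (p : ℝ) * a p)]; simp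
  have e3 : ∑ p ∈ Finset.range l, ((l + 1 - p : ℝ) * a p) = ∑ p ∈ Finset.range (l + 1), ((l + 1 - p : ℝ) * a p) - a l := by
    rw [Finset.sum_range_succ]; ring
  have e4 : a l = ∑ j, s.M 1 i j t x * uu s W l j t x := by simp [ha]
  rw [e1, e2, e3, sub_add_eq_add_sub, ← Finset.sum_add_distrib]
  unfold Htl HH
  rw [← e4]
  congr 1
  rw [Finset.mul_sum]
  refine Finset.sum_congr rfl fun p hp => ?_
  simp only [ha]
  ring

theorem jet {s : Sys ι} {W : ι → ℝ → ℝ → ℝ} (h0 : RegIn s W (uu s W 0) (FW s W) (HH s W 0) (Htl s W 0)) (l : ℕ) :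
    RegIn s (Ul s W l) (uu s W l) (Fl s W l) (HH s W l) (Htl s W l) ∧
    (∀ p ≤ l, ∀ i, COo s.T (uu s W p i)) ∧
    ∀ p < l, ∀ i, Dt s.T (uu s W p i) (fun t x => (p + 1) * uu s W (p + 1) i t x) := by
  induction l with
  | zero =>
    refine ⟨h0, fun p hp i => ?_, fun p hp => by omega⟩
    obtain rfl : p = 0 := by omega
    exact h0.cw i
  | succ l ih =>
    obtain ⟨r, ihc, ihd⟩ := ih
    have o := Reg r
    have hl : (0:ℝ) < l + 1 := by positivity
    have hu : ∀ i t x, Dw s (uu s W l) i t x = (l + 1) * uu s W (l + 1) i t x := fun i t x => by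
      show _ = (l + 1) * (Dw s (uu s W l) i t x / (l + 1))
      field_simp
    have hu' : Dw s (uu s W l) = fun i t x => (l + 1) * uu s W (l + 1) i t x := by
      funext i t x; exact hu i t x
    have hdl : ∀ p < l + 1, ∀ i, Dt s.T (uu s W p i) (fun t x => (p + 1) * uu s W (p + 1) i t x) := by
      intro p hp i
      rcases Nat.lt_succ_iff_lt_or_eq.1 hp with h | rfl
      · exact ihd p h i
      · have := o.dz i; rw [hu'] at this; exact this
    have hcl : ∀ p ≤ l + 1, ∀ i, COo s.T (uu s W p i) := by
      intro p hp i
      rcases Nat.le_succ_iff.1 hp with h | rfl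
      · exact ihc p h i
      · intro β hβ
        exact (o.cz i β hβ).div_const _
    have hE : ∀ i t x, ∑ j, s.M 1 i j t x * uu s W l j t x + Htl s W l i t x = (l + 1) * HH s W (l + 1) i t x := by
      intro i t x; unfold Htl; ring
    have cH : ∀ q ≤ l + 2, ∀ i, COo s.T (HH s W q i) := fun q hq => HH_cont fun p hp => hcl p (by omega)
    have hdH := HH_deriv hdl
    have cHt : ∀ i, COo s.T (Htl s W (l + 1) i) := fun i β hβ =>
      ContinuousOn.sub (continuousOn_const.mul (cH _ le_rfl i β hβ)) (Mw_cont hβ.le 1 (fun i => hcl _ le_rfl i β hβ) i)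
    refine ⟨⟨hcl _ le_rfl, ?_, cH _ (by omega), cHt, ?_, ?_, ?_, ?_, hdH, ?_, ?_⟩, hcl, hdl⟩
    · intro i β hβ
      exact (ContinuousOn.add (Mw_cont hβ.le 0 (fun i => hcl l (by omega) i β hβ) i) (cH l (by omega) i β hβ)).div_const _
    · intro i j hij β hβ
      refine ((o.sol i j hij β hβ).smul (1 / (l + 1))).congr (fun t _ x _ => ?_) fun t _ x _ => ?_
      · simp only [Ul]; ring
      · simp only [Fl, GG, hu]; field_simp
    · intro i β hβ
      refine ((o.mild i β hβ).smul (1 / (l + 1))).congr (fun t _ x _ => ?_) fun t _ x _ => ?_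
      · simp only [hu]; field_simp
      · simp only [hE, hu, mul_left_comm _ (l + 1 : ℝ), ← Finset.mul_sum]; field_simp
    · intro i t ht x hx
      have := (hdl l (by omega) i t ht x hx).div_const (l + 1 : ℝ)
      rw [mul_div_cancel_left₀ _ hl.ne'] at this
      exact this
    · intro i t ht x hx
      have h1 : HasDerivWithinAt (fun r => ∑ j, s.M 0 i j r x * uu s W l j r x) 
        (∑ j, (s.M 1 i j t x * uu s W l j t x + s.M 0 i j t x * ((l + 1) * uu s W (l + 1) j t x))) (Ico 0 s.T) t := by
        refine HasDerivWithinAt.fun_sum fun j _ => ?_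
        have := (s.hMD 0 i j t ht x hx).mul (hdl l (by omega) j t ht x hx)
        simp only [Nat.cast_zero, zero_add, one_mul] at this
        exact this
      have h2 := (h1.add (r.dH i t ht x hx)).div_const (l + 1 : ℝ)
      convert! h2 using 1
      rw [Finset.sum_add_distrib]
      have := hE i t x
      simp only [mul_left_comm _ (l + 1 : ℝ), ← Finset.mul_sum]
      rw [eq_div_iff hl.ne']
      linarith
    · intro i t ht
      have e1 := o.one i t ht
      have e2 := o.one i 0 ⟨le_rfl, s.T_pos⟩
      show Dw s (uu s W l) i t 1 / _ = Dw s (uu s W l) i 0 1 / _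
      rw [e1, e2]
    · intro t ht
      have := s.Bd.smul_mem (1 / (l + 1 : ℝ)) (o.bd t ht)
      convert this using 1
      funext i
      show Dw s (uu s W l) i t 0 / (l + 1) = _
      simp; ring

end HypObs
namespace HypObs
open Set MeasureTheory Filter Topology
variable {ι : Type} [Fintype ι]

theorem base {s : Sys ι} {W : ι → ℝ → ℝ → ℝ} (h : PL s W) (h1 : ∀ i, ∀ t ∈ Icc 0 s.T, W i t 1 = W i 0 1) :
    RegOut s W (fun i t x => FW s W i t x - ∑ j, s.M 0 i j t x * W j t x) (fun i t x => - ∑ j, s.M 1 i j t x * W j t x)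
      (uu s W 0) := by
  have hI : Ico 0 s.T ⊆ Icc 0 s.T := Ico_subset_Icc_self
  have hFWc : ∀ i, CO s.T (FW s W i) := FW_cont s.T_pos.le le_rfl h.c
  have hG : ∀ i t x, ∑ j, s.M 0 i j t x * W j t x + (FW s W i t x - ∑ j, s.M 0 i j t x * W j t x) = FW s W i t x := 
    fun i t x => by ring
  refine Reg (U := fun i => pot (s.S i) (W i)) (F := fun i => It (FW s W i)) ⟨?_, ?_, ?_, ?_, ?_, ?_, ?_, ?_, ?_, ?_, ?_⟩
  · exact fun i β hβ => (h.c i).mono' hβ.le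
  · exact fun i β hβ => (It_cont s.T_pos.le (hFWc i)).mono' hβ.le
  · exact fun i β hβ => ((hFWc i).mono' hβ.le).sub (Mw_cont hβ.le 0 (fun i => (h.c i).mono' hβ.le) i)
  · exact fun i β hβ => (Mw_cont hβ.le 1 (fun i => (h.c i).mono' hβ.le) i).neg
  · exact fun i j hij β hβ => (h.sol i j hij).mono hβ.le
  · intro i β hβ
    simp only [hG]
    exact (h.mild i).mono hβ.le
  · exact fun i t ht x hx => (pot_deriv (h.c i) (hI ht) hx).mono hI
  · intro i t ht x hx
    simp only [hG]
    exact (It_deriv (hFWc i) (hI ht) hx).mono hI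
  · intro i t ht x hx
    have hk : HasDerivWithinAt (fun r => ∑ j, (-(s.M 0 i j r x * W j 0 x) - It (fun r y => s.M 1 i j r y * (W j r y - W j 0 y)) r x))
      (∑ j, (-(s.M 1 i j t x * W j 0 x) - s.M 1 i j t x * (W j t x - W j 0 x))) (Ico 0 s.T) t := by
      refine HasDerivWithinAt.fun_sum fun j _ => ?_
      have hm := s.hMD 0 i j t ht x hx
      simp only [Nat.cast_zero, zero_add, one_mul] at hm
      exact (hm.mul_const (W j 0 x)).neg.sub ((It_deriv (FW_int_cont s.T_pos.le le_rfl h.c i j) (hI ht) hx).mono hI)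
    convert! hk using 1
    · funext r
      show FW s W i r x - ∑ j, s.M 0 i j r x * W j r x = _
      unfold FW
      rw [← Finset.sum_sub_distrib]
      exact Finset.sum_congr rfl fun j _ => by ring
    · show -∑ j, s.M 1 i j t x * W j t x = _
      rw [← Finset.sum_neg_distrib]
      exact Finset.sum_congr rfl fun j _ => by ring
  · exact fun i t ht => h1 i t (hI ht)
  · exact fun t ht => h.bd t (hI ht)

theorem base' {s : Sys ι} {W : ι → ℝ → ℝ → ℝ} (h : PL s W) (h1 : ∀ i, ∀ t ∈ Icc 0 s.T, W i t 1 = W i 0 1) :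
    RegIn s W (uu s W 0) (FW s W) (HH s W 0) (Htl s W 0) := by
  have o := base h h1
  have hI : Ico 0 s.T ⊆ Icc 0 s.T := Ico_subset_Icc_self
  have hFWc : ∀ i, CO s.T (FW s W i) := FW_cont s.T_pos.le le_rfl h.c
  have hH : ∀ i, HH s W 0 i = fun _ _ => 0 := fun i => by funext t x; simp [HH]
  have hHt : ∀ i, Htl s W 0 i = fun _ _ => 0 := fun i => by funext t x; simp [Htl, HH]
  have hG : ∀ i t x, ∑ j, s.M 0 i j t x * W j t x + (FW s W i t x - ∑ j, s.M 0 i j t x * W j t x) = FW s W i t x := 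
    fun i t x => by ring
  refine ⟨o.cz, fun i β hβ => (hFWc i).mono' hβ.le, ?_, ?_, ?_, ?_, o.dz, ?_, ?_, ?_, o.bd⟩
  · intro i β _; rw [hH]; exact continuousOn_const
  · intro i β _; rw [hHt]; exact continuousOn_const
  · intro i j hij β hβ
    have := o.sol i j hij β hβ
    simp only [hG] at this
    exact this
  · intro i β hβ
    have := o.mild i β hβ
    simp only [hH, add_neg_cancel] at this ⊢
    exact this
  · intro i
    refine Dt.of_Icc fun β hβ t ht x hx => ?_
    have := FW_deriv (s := s) hβ.le (fun i => (h.c i).mono' hβ.le) ht hx 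
      (fun j => (o.dz j t (Icc_sub_Ico hβ ht) x hx).mono (Icc_sub_Ico hβ)) i
    simp only [hH, add_zero]
    exact this
  · intro i t ht x hx
    rw [hH, hHt]; exact hasDerivWithinAt_const _ _ _
  · intro i t ht
    rw [o.one i t ht, o.one i 0 ⟨le_rfl, s.T_pos⟩]

theorem Mw_bdd {s : Sys ι} (l : ℕ) {w : ι → ℝ → ℝ → ℝ} {b t x : ℝ} (ht : t ∈ Icc 0 s.T) (hx : x ∈ Icc (0:ℝ) 1)
    (hb : ∀ j, |w j t x| ≤ b) (i : ι) :
    |∑ j, s.M l i j t x * w j t x| ≤ (Fintype.card ι : ℝ) * (s.A * s.R ^ l * b) := by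
  have hA := s.hA; have hR := s.hR
  refine (Finset.abs_sum_le_sum_abs _ _).trans ((Finset.sum_le_sum (g := fun _ => s.A * s.R ^ l * b) fun j _ => ?_).trans ?_)
  · rw [abs_mul]
    exact mul_le_mul (s.hMb l i j t ht x hx) (hb j) (abs_nonneg _) (by positivity)
  · rw [Finset.sum_const, nsmul_eq_mul, Finset.card_univ]

theorem jet_bdd {s : Sys ι} {W : ι → ℝ → ℝ → ℝ} (h : PL s W) (h1 : ∀ i, ∀ t ∈ Icc 0 s.T, W i t 1 = W i 0 1) :
    ∃ b K : ℝ, 0 ≤ b ∧ 1 ≤ K ∧ ∀ l i, ∀ t ∈ Ico 0 s.T, ∀ x ∈ Icc (0:ℝ) 1, |uu s W l i t x| ≤ b * K ^ l := by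
  obtain ⟨C, hC0, hC⟩ := SupLemma s
  have hA := s.hA; have hR := s.hR
  have hR0 : 0 < s.R := by linarith
  obtain ⟨a1, ha1, hb1⟩ := exists_bdd h.c
  have hb2 := FW_bdd (s := s) le_rfl ha1 hb1
  set m : ℝ := (Fintype.card ι : ℝ) with hm
  have hm0 : 0 ≤ m := by positivity
  set q := C * (m * s.A + 1) with hq
  have hq0 : 0 ≤ q := by positivity
  set a0 := (1 + s.CF) * a1 with ha0
  have hCF := s.CF_nonneg
  have ha00 : 0 ≤ a0 := by positivity
  set b := C * a0 with hb
  have hb0 : 0 ≤ b := by positivity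
  have hI : Ico 0 s.T ⊆ Icc 0 s.T := Ico_subset_Icc_self
  -- application of the sup lemma at level l
  have app : ∀ l a, 0 ≤ a → (∀ i, ∀ t ∈ Ico 0 s.T, ∀ x ∈ Icc (0:ℝ) 1, |Ul s W l i t x| ≤ a ∧ |Fl s W l i t x| ≤ a ∧ |HH s W l i t x| ≤ a) →
      ∀ i, ∀ t ∈ Ico 0 s.T, ∀ x ∈ Icc (0:ℝ) 1, |uu s W l i t x| ≤ C * a := by
    intro l a ha hall i t ht x hx
    have r := (jet (base' h h1) l).1
    have hβ : max t s.Topt < s.T := max_lt ht.2 s.hT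
    refine hC (max t s.Topt) (le_max_right _ _) hβ.le (uu s W l) (Ul s W l) (Fl s W l) (HH s W l) a ha
      ⟨fun i => r.cw i _ hβ, fun i => r.cF i _ hβ, fun i => r.cH i _ hβ, fun i => r.mild i _ hβ, fun i j hij => r.sol i j hij _ hβ⟩
      (fun i t ht x hx => (hall i t (Icc_sub_Ico hβ ht) x hx).1) (fun i t ht x hx => (hall i t (Icc_sub_Ico hβ ht) x hx).2.1)
      (fun i t ht x hx => (hall i t (Icc_sub_Ico hβ ht) x hx).2.2) (fun t ht => r.bd t (Icc_sub_Ico hβ ht)) ?_ i t ⟨ht.1, le_max_left _ _⟩ x hx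
    intro i t ht
    cases l with
    | zero => exact (base h h1).one i t (Icc_sub_Ico hβ ht)
    | succ l =>
      have := (Reg (jet (base' h h1) l).1).one i t (Icc_sub_Ico hβ ht)
      show Dw s (uu s W l) i t 1 / (l + 1) = 0
      rw [this, zero_div]
  refine ⟨b, s.R * (1 + q), hb0, by nlinarith, fun l => ?_⟩
  set K := s.R * (1 + q) with hK
  have hK0 : 0 ≤ K := by positivity
  induction l using Nat.strong_induction_on with
  | _ l ih =>
    cases l with
    | zero =>
      rw [pow_zero, mul_one]
      refine app 0 a0 ha00 fun i t ht x hx => ⟨?_, ?_, ?_⟩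
      · have := hb1 i t (hI ht) x hx
        show |W i t x| ≤ _
        nlinarith
      · have := hb2 i t (hI ht) x hx
        show |FW s W i t x| ≤ _
        nlinarith
      · simp [HH]; exact ha00
    | succ l =>
      have hl : (1:ℝ) ≤ l + 1 := by linarith [(Nat.cast_nonneg l : (0:ℝ) ≤ l)]
      set Sg := ∑ p ∈ Finset.range (l + 1), s.R ^ (l + 1 - p) * (b * K ^ p) with hSg
      have hSg0 : 0 ≤ Sg := Finset.sum_nonneg fun p _ => by positivity
      have hSe : q * Sg ≤ b * K ^ (l + 1) := by
        have e : Sg = b * s.R ^ (l + 1) * ∑ p ∈ Finset.range (l + 1), (1 + q) ^ p := by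
          rw [hSg, Finset.mul_sum]
          refine Finset.sum_congr rfl fun p hp => ?_
          have hp' := Finset.mem_range.1 hp
          rw [hK, mul_pow]
          have : s.R ^ (l + 1) = s.R ^ (l + 1 - p) * s.R ^ p := by rw [← pow_add]; congr 1; omega
          rw [this]; ring
        have e2 := mul_geom_sum (1 + q) (l + 1)
        rw [add_sub_cancel_left] at e2
        have : q * Sg = b * s.R ^ (l + 1) * ((1 + q) ^ (l + 1) - 1) := by rw [e, ← e2]; ring
        rw [this, hK, mul_pow]
        have : 0 ≤ b * s.R ^ (l + 1) := by positivity
        nlinarith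
      have hub : ∀ p ≤ l, ∀ i, ∀ t ∈ Ico 0 s.T, ∀ x ∈ Icc (0:ℝ) 1, |uu s W p i t x| ≤ b * K ^ p := fun p hp => ih p (by omega)
      have hterm : ∀ p ≤ l, s.R ^ (l + 1 - p) * (b * K ^ p) ≤ Sg := fun p hp =>
        Finset.single_le_sum (f := fun p => s.R ^ (l + 1 - p) * (b * K ^ p)) (fun p _ => by positivity) (Finset.mem_range.2 (by omega))
      have hdiv : ∀ y : ℝ, |y / ((l : ℝ) + 1)| ≤ |y| := fun y => by
        rw [abs_div, abs_of_pos (by linarith : (0:ℝ) < l + 1)]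
        exact div_le_self (abs_nonneg _) hl
      have hHl : ∀ i, ∀ t ∈ Ico 0 s.T, ∀ x ∈ Icc (0:ℝ) 1, |HH s W (l + 1) i t x| ≤ m * s.A * Sg := by
        intro i t ht x hx
        unfold HH
        rw [hSg, Finset.mul_sum]
        refine (Finset.abs_sum_le_sum_abs _ _).trans (Finset.sum_le_sum fun p hp => ?_)
        have := Mw_bdd (s := s) (l + 1 - p) (hI ht) hx (fun j => hub p (by have := Finset.mem_range.1 hp; omega) j t ht x hx) i
        refine this.trans (le_of_eq ?_); ring
      have hGl : ∀ i, ∀ t ∈ Ico 0 s.T, ∀ x ∈ Icc (0:ℝ) 1, |GG s W l i t x| ≤ m * s.A * Sg := by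
        intro i t ht x hx
        unfold GG HH
        have e : ∑ j, s.M 0 i j t x * uu s W l j t x + ∑ p ∈ Finset.range l, ∑ j, s.M (l - p) i j t x * uu s W p j t x
          = ∑ p ∈ Finset.range (l + 1), ∑ j, s.M (l - p) i j t x * uu s W p j t x := by
          rw [Finset.sum_range_succ, Nat.sub_self]; ring
        rw [e, hSg, Finset.mul_sum]
        refine (Finset.abs_sum_le_sum_abs _ _).trans (Finset.sum_le_sum fun p hp => ?_)
        have hp' := Finset.mem_range.1 hp
        have := Mw_bdd (s := s) (l - p) (hI ht) hx (fun j => hub p (by omega) j t ht x hx) i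
        refine this.trans ?_
        have h3 : s.R ^ (l - p) ≤ s.R ^ (l + 1 - p) := pow_le_pow_right₀ hR (by omega)
        calc _ = m * s.A * (s.R ^ (l - p) * (b * K ^ p)) := by ring
          _ ≤ m * s.A * (s.R ^ (l + 1 - p) * (b * K ^ p)) := by gcongr
      intro i t ht x hx
      refine (app (l + 1) ((m * s.A + 1) * Sg) (by positivity) ?_ i t ht x hx).trans ?_
      · intro i t ht x hx
        have hmA : 0 ≤ m * s.A * Sg := by positivity
        refine ⟨?_, ?_, ?_⟩
        · have h3 := hub l le_rfl i t ht x hx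
          have h4 := hterm l le_rfl
          have h5 : b * K ^ l ≤ s.R ^ (l + 1 - l) * (b * K ^ l) := by
            have : (1:ℝ) ≤ s.R ^ (l + 1 - l) := one_le_pow₀ hR
            have : 0 ≤ b * K ^ l := by positivity
            nlinarith
          refine (hdiv _).trans ?_
          linarith
        · refine (hdiv _).trans ?_
          linarith [hGl i t ht x hx]
        · linarith [hHl i t ht x hx]
      · rw [← mul_assoc]; exact hSe

end HypObs
namespace HypObs
open Set MeasureTheory Filter Topology
variable {ι : Type} [Fintype ι]

theorem an_van {T : ℝ} {f : ℕ → ℝ → ℝ} (hd : ∀ l, ∀ t ∈ Ico 0 T, HasDerivWithinAt (f l) ((l + 1 : ℝ) * f (l + 1) t) (Ico 0 T) t)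
    {J : Set ℝ} (hJ : J ⊆ Ico 0 T) (hc : Convex ℝ J) (hi : (interior J).Nonempty) (h0 : ∀ t ∈ J, f 0 t = 0) :
    ∀ l, ∀ t ∈ J, f l t = 0 := by
  intro l
  induction l with
  | zero => exact h0
  | succ l ih =>
    intro t ht
    have h1 := (hd l t (hJ ht)).mono hJ
    have h2 : HasDerivWithinAt (f l) 0 J t := (hasDerivWithinAt_const t J (0:ℝ)).congr (fun r hr => ih r hr) (ih t ht)
    have := (uniqueDiffOn_convex hc hi t ht).eq_deriv _ h1 h2
    have hl : (l + 1 : ℝ) ≠ 0 := by positivity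
    exact (mul_eq_zero.1 this).resolve_left hl

theorem an_step {T b K : ℝ} (hK : 1 ≤ K) {f : ℕ → ℝ → ℝ}
    (hd : ∀ l, ∀ t ∈ Ico 0 T, HasDerivWithinAt (f l) ((l + 1 : ℝ) * f (l + 1) t) (Ico 0 T) t)
    (hb : ∀ l, ∀ t ∈ Ico 0 T, |f l t| ≤ b * K ^ l) {t0 t1 : ℝ} (ht0 : t0 ∈ Ico 0 T) (ht1 : t1 ∈ Ico 0 T)
    (h1 : ∀ l, f l t1 = 0) (h01 : |t0 - t1| ≤ 1 / (2 * K)) : f 0 t0 = 0 := by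
  have hK0 : 0 < K := by linarith
  have hb0 : 0 ≤ b := by have := (abs_nonneg _).trans (hb 0 t0 ht0); simpa using this
  set ρ := 1 / (2 * K) with hρ
  have hρ0 : 0 < ρ := by positivity
  have hseg : uIcc t1 t0 ⊆ Ico 0 T := by
    intro r hr; rw [mem_uIcc] at hr; simp only [mem_Ico] at *
    rcases hr with h | h <;> constructor <;> linarith
  have key : ∀ n : ℕ, |f 0 t0| ≤ (n + 1 : ℝ) * b * (1 / 2) ^ (n + 1) := by
    intro n
    have hder : ∀ r ∈ uIcc t1 t0, HasDerivWithinAt (fun r => ∑ l ∈ Finset.range (n + 1), f l r * (t0 - r) ^ l)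
        ((n + 1 : ℝ) * f (n + 1) r * (t0 - r) ^ n) (uIcc t1 t0) r := by
      intro r hr
      have : ∀ l, HasDerivWithinAt (fun r => f l r * (t0 - r) ^ l)
          ((l + 1 : ℝ) * f (l + 1) r * (t0 - r) ^ l - (l : ℝ) * f l r * (t0 - r) ^ (l - 1)) (uIcc t1 t0) r := by
        intro l
        have h2 : HasDerivWithinAt (fun r => t0 - r) (-1) (uIcc t1 t0) r := by
          simpa using (hasDerivAt_id r).const_sub t0 |>.hasDerivWithinAt
        have h3 := ((hd l r (hseg hr)).mono hseg).mul (h2.pow l)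
        convert! h3 using 1
        rw [Pi.pow_apply]
        ring
      have h4 := HasDerivWithinAt.fun_sum (u := Finset.range (n + 1)) fun l _ => this l
      convert! h4 using 1
      have := Finset.sum_range_sub (fun l => (l : ℝ) * f l r * (t0 - r) ^ (l - 1)) (n + 1)
      simp only [Nat.cast_add, Nat.cast_one, Nat.add_sub_cancel] at this
      rw [this]
      simp
    have hbd : ∀ r ∈ uIcc t1 t0, ‖(n + 1 : ℝ) * f (n + 1) r * (t0 - r) ^ n‖ ≤ (n + 1 : ℝ) * (b * K ^ (n + 1)) * ρ ^ n := by
      intro r hr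
      have hr1 : |t0 - r| ≤ ρ := by
        refine le_trans ?_ h01
        rw [mem_uIcc] at hr
        rcases hr with h | h
        · rw [abs_of_nonneg (by linarith), abs_of_nonneg (by linarith)]; linarith
        · rw [abs_of_nonpos (by linarith), abs_of_nonpos (by linarith)]; linarith
      rw [Real.norm_eq_abs, abs_mul, abs_mul, abs_pow, abs_of_nonneg (by positivity : (0:ℝ) ≤ n + 1)]
      have := hb (n + 1) r (hseg hr)
      gcongr
    have := (convex_uIcc t1 t0).norm_image_sub_le_of_norm_hasDerivWithin_le hder hbd left_mem_uIcc right_mem_uIcc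
    have e1 : ∑ l ∈ Finset.range (n + 1), f l t1 * (t0 - t1) ^ l = 0 := Finset.sum_eq_zero fun l _ => by rw [h1]; ring
    have e0 : ∑ l ∈ Finset.range (n + 1), f l t0 * (t0 - t0) ^ l = f 0 t0 := by
      rw [Finset.sum_range_succ']; simp
    simp only [e1, e0, sub_zero, Real.norm_eq_abs] at this
    refine this.trans ?_
    calc _ ≤ (n + 1 : ℝ) * (b * K ^ (n + 1)) * ρ ^ n * ρ := by gcongr
      _ = (n + 1 : ℝ) * b * (K * ρ) ^ (n + 1) := by ring
      _ = _ := by congr 2; rw [hρ]; field_simp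
  have hlim : Tendsto (fun n : ℕ => (n + 1 : ℝ) * b * (1 / 2) ^ (n + 1)) atTop (𝓝 0) := by
    have := (tendsto_self_mul_const_pow_of_lt_one (r := (1/2:ℝ)) (by norm_num) (by norm_num)).const_mul b
    rw [mul_zero] at this
    have := (tendsto_add_atTop_iff_nat 1).2 this
    refine this.congr fun n => ?_
    push_cast; ring
  exact abs_eq_zero.1 (le_antisymm (ge_of_tendsto' hlim key) (abs_nonneg _))

theorem an_zero {T b K : ℝ} (hK : 1 ≤ K) {f : ℕ → ℝ → ℝ}
    (hd : ∀ l, ∀ t ∈ Ico 0 T, HasDerivWithinAt (f l) ((l + 1 : ℝ) * f (l + 1) t) (Ico 0 T) t)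
    (hb : ∀ l, ∀ t ∈ Ico 0 T, |f l t| ≤ b * K ^ l) {p q : ℝ} (hp : 0 ≤ p) (hpq : p < q) (hq : q < T)
    (h0 : ∀ t ∈ Icc p q, f 0 t = 0) : ∀ t ∈ Ico 0 T, f 0 t = 0 := by
  have hK0 : 0 < K := by linarith
  set ρ := 1 / (2 * K) with hρ
  have hρ0 : 0 < ρ := by positivity
  have hp1 : p ∈ Ico 0 T := ⟨hp, by linarith⟩
  have hpz : ∀ l, f l p = 0 := fun l => an_van hd (J := Icc p q) (fun r hr => ⟨hp.trans hr.1, lt_of_le_of_lt hr.2 hq⟩)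
    (convex_Icc _ _) (by rw [interior_Icc]; exact nonempty_Ioo.2 hpq) h0 l p ⟨le_rfl, hpq.le⟩
  have step : ∀ t1 ∈ Ico 0 T, (∀ l, f l t1 = 0) → ∀ t ∈ Ico 0 T, |t - t1| ≤ ρ → ∀ l, f l t = 0 := by
    intro t1 ht1 h1 t ht htt l
    refine an_van hd (J := Ico 0 T ∩ Icc (t1 - ρ) (t1 + ρ)) inter_subset_left ((convex_Ico _ _).inter (convex_Icc _ _)) ?_ ?_ l t
      ⟨ht, by rw [abs_le] at htt; constructor <;> linarith⟩
    · rw [interior_inter, interior_Ico, interior_Icc, Ioo_inter_Ioo]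
      refine nonempty_Ioo.2 (max_lt (lt_min (by linarith [ht1.1, ht1.2]) (by linarith [ht1.1])) (lt_min (by linarith [ht1.2]) (by linarith)))
    · intro r hr
      exact an_step hK hd hb hr.1 ht1 h1 (by rw [abs_le]; constructor <;> linarith [hr.2.1, hr.2.2])
  have ind : ∀ n : ℕ, ∀ t ∈ Ico 0 T, |t - p| ≤ n * ρ → ∀ l, f l t = 0 := by
    intro n
    induction n with
    | zero =>
      intro t ht h l
      have : t = p := by
        have h' : |t - p| ≤ 0 := by simpa using h
        have := abs_eq_zero.1 (le_antisymm h' (abs_nonneg _)); linarith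
      rw [this]; exact hpz l
    | succ n ih =>
      intro t ht h
      have hn : (0:ℝ) < n + 1 := by positivity
      have hn0 : (0:ℝ) ≤ n := by positivity
      push_cast at h
      set t1 := p + (t - p) * (n / (n + 1)) with ht1
      have e1 : |t1 - p| ≤ n * ρ := by
        rw [ht1, add_sub_cancel_left, abs_mul, abs_of_nonneg (by positivity : (0:ℝ) ≤ n / (n+1))]
        calc _ ≤ ((n + 1) * ρ) * (n / (n + 1)) := by gcongr
          _ = n * ρ := by field_simp
      have e2 : |t - t1| ≤ ρ := by
        have : t - t1 = (t - p) * (1 / (n + 1)) := by rw [ht1]; field_simp; ring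
        rw [this, abs_mul, abs_of_nonneg (by positivity : (0:ℝ) ≤ 1 / (n+1))]
        calc _ ≤ ((n + 1) * ρ) * (1 / (n + 1)) := by gcongr
          _ = ρ := by field_simp
      have e3 : t1 ∈ Ico 0 T := by
        refine (convex_Ico (𝕜 := ℝ) (0:ℝ) T).segment_subset hp1 ht ?_
        refine ⟨1 - n / (n + 1), n / (n + 1), ?_, by positivity, by ring, ?_⟩
        · rw [sub_nonneg, div_le_one hn]; linarith
        · rw [ht1]; simp only [smul_eq_mul]; ring
      exact step t1 e3 (ih t1 e3 e1) t ht e2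
  intro t ht
  obtain ⟨n, hn⟩ := exists_nat_ge (|t - p| / ρ)
  exact ind n t ht (by rwa [div_le_iff₀ hρ0] at hn) 0

theorem uniq {s : Sys ι} {W : ι → ℝ → ℝ → ℝ} (h : PL s W) (h1 : ∀ i, ∀ t ∈ Icc 0 s.T, W i t 1 = W i 0 1) :
    ∀ i, ∀ t ∈ Icc 0 s.T, ∀ x ∈ Icc (0:ℝ) 1, W i t x = 0 := by
  obtain ⟨b, K, hb0, hK, hbd⟩ := jet_bdd h h1
  obtain ⟨σ, hσ, hσS, hσΘ⟩ := s.exists_σ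
  have hT := s.T_pos
  have hA := s.hA
  have r0 := base' h h1
  have o := base h h1
  have hH : ∀ i, HH s W 0 i = fun _ _ => 0 := fun i => by funext t x; simp [HH]
  have hmild : ∀ i, ∀ β < s.T, Along (s.Θ i) β (uu s W 0 i) (fun t x => ∑ j, s.M 0 i j t x * uu s W 0 j t x) := by
    intro i β hβ
    have := r0.mild i β hβ
    simp only [hH, add_zero] at this
    exact this
  set m : ℝ := (Fintype.card ι : ℝ) with hm
  have hm0 : 0 ≤ m := by positivity
  obtain ⟨η, hη0, hη1, hη2⟩ : ∃ η > 0, σ * η ≤ s.T / 8 ∧ η * (m * s.A) ≤ 1 / 2 := by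
    refine ⟨min (s.T / 8 / σ) (1 / 2 / (m * s.A + 1)), by positivity, ?_, ?_⟩
    · calc _ ≤ σ * (s.T / 8 / σ) := by gcongr; exact min_le_left _ _
        _ = _ := by field_simp
    · calc _ ≤ (1 / 2 / (m * s.A + 1)) * (m * s.A + 1) := by gcongr; exact min_le_right _ _; linarith
        _ = _ := by field_simp
  -- one step to the left
  have step : ∀ x0 ∈ Icc (0:ℝ) 1, (∀ i, ∀ t ∈ Ico 0 s.T, uu s W 0 i t x0 = 0) → ∀ x ∈ Icc (0:ℝ) 1, x0 - η ≤ x → x ≤ x0 →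
      ∀ i, ∀ t ∈ Ico 0 s.T, uu s W 0 i t x = 0 := by
    intro x0 hx0 hz x hx hx1 hx2 i
    have hloc : ∀ n : ℕ, ∀ x ∈ Icc (0:ℝ) 1, x0 - η ≤ x → x ≤ x0 → ∀ i, ∀ t, |t - s.T / 2| ≤ s.T / 4 - σ * (x0 - x) →
        |uu s W 0 i t x| ≤ b * (1 / 2) ^ n := by
      intro n
      induction n with
      | zero =>
        intro x hx hx1 hx2 i t ht
        have : 0 ≤ σ * (x0 - x) := by nlinarith
        rw [abs_le] at ht
        have := hbd 0 i t ⟨by linarith, by linarith⟩ x hx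
        simpa using this
      | succ n ih =>
        intro x hx hx1 hx2 i t ht
        have hσ0 : 0 ≤ σ * (x0 - x) := by nlinarith
        have hcr : ∀ y ∈ Icc x x0, |t + s.Θ i x - s.Θ i y - s.T / 2| ≤ s.T / 4 - σ * (x0 - y) := by
          intro y hy
          have h3 := hσΘ i x hx y ⟨hx.1.trans hy.1, hy.2.trans hx0.2⟩
          rw [abs_of_nonpos (by linarith [hy.1] : x - y ≤ 0)] at h3
          rw [abs_le] at h3 ht ⊢
          constructor <;> nlinarith
        have hin : ∀ y ∈ Icc x x0, t + s.Θ i x - s.Θ i y ∈ Icc 0 (3 * s.T / 4) := by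
          intro y hy
          have h3 := hcr y hy
          have : 0 ≤ σ * (x0 - y) := by nlinarith [hy.2]
          rw [abs_le] at h3
          constructor <;> linarith
        have ha := hmild i (3 * s.T / 4) (by linarith) (t + s.Θ i x) x0 hx0 x hx (hin x0 ⟨hx2, le_rfl⟩) (hin x ⟨le_rfl, hx2⟩)
        have hi0 := hin x0 ⟨hx2, le_rfl⟩
        rw [hz i _ ⟨hi0.1, by linarith [hi0.2]⟩, sub_zero, add_sub_cancel_right] at ha
        rw [ha]
        have hib : ∀ y ∈ uIoc x0 x, ‖∑ j, s.M 0 i j (t + s.Θ i x - s.Θ i y) y * uu s W 0 j (t + s.Θ i x - s.Θ i y) y‖ 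
            ≤ m * (s.A * s.R ^ 0 * (b * (1 / 2) ^ n)) := by
          intro y hy
          rw [uIoc_of_ge hx2] at hy
          have hy' : y ∈ Icc x x0 := ⟨hy.1.le, hy.2⟩
          have hy1 : y ∈ Icc (0:ℝ) 1 := ⟨hx.1.trans hy'.1, hy.2.trans hx0.2⟩
          have hi := hin y hy'
          exact Mw_bdd (s := s) 0 (w := uu s W 0) ⟨hi.1, by linarith [hi.2]⟩ hy1
            (fun j => ih y hy1 (by linarith [hy'.1]) hy.2 j _ (hcr y hy')) i
        have h5 := intervalIntegral.norm_integral_le_of_norm_le_const hib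
        rw [Real.norm_eq_abs] at h5
        refine h5.trans ?_
        rw [abs_of_nonpos (by linarith : x - x0 ≤ 0)]
        have hbn : 0 ≤ b * (1 / 2) ^ n := by positivity
        calc _ = (x0 - x) * (m * s.A) * (b * (1 / 2) ^ n) := by ring
          _ ≤ η * (m * s.A) * (b * (1 / 2) ^ n) := by gcongr; linarith
          _ ≤ 1 / 2 * (b * (1 / 2) ^ n) := by gcongr
          _ = _ := by ring
    have hσ0 : σ * (x0 - x) ≤ s.T / 8 := by nlinarith
    refine an_zero hK (f := fun l t => uu s W l i t x) (fun l t ht => (jet r0 (l + 1)).2.2 l (by omega) i t ht x hx)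
      (fun l t ht => hbd l i t ht x hx) (p := s.T * 3 / 8) (q := s.T * 5 / 8) (by positivity) (by linarith) (by linarith) ?_
    intro t ht
    have hlim : Tendsto (fun n : ℕ => b * (1 / 2 : ℝ) ^ n) atTop (𝓝 0) := by
      simpa using (tendsto_pow_atTop_nhds_zero_of_lt_one (r := (1/2:ℝ)) (by norm_num) (by norm_num)).const_mul b
    refine abs_eq_zero.1 (le_antisymm (ge_of_tendsto' hlim fun n => hloc n x hx hx1 hx2 i t ?_) (abs_nonneg _))
    rw [abs_le]; constructor <;> linarith [ht.1, ht.2]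
  have all : ∀ n : ℕ, ∀ x ∈ Icc (0:ℝ) 1, 1 - n * η ≤ x → ∀ i, ∀ t ∈ Ico 0 s.T, uu s W 0 i t x = 0 := by
    intro n
    induction n with
    | zero =>
      intro x hx hx1 i t ht
      have : x = 1 := le_antisymm hx.2 (by simpa using hx1)
      rw [this]; exact o.one i t ht
    | succ n ih =>
      intro x hx hx1
      push_cast at hx1
      have hn0 : (0:ℝ) ≤ n := by positivity
      refine step (min 1 (x + η)) ⟨le_min zero_le_one (by linarith [hx.1]), min_le_left _ _⟩ (ih _ ⟨le_min zero_le_one (by linarith [hx.1]), min_le_left _ _⟩ 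
        (le_min (by nlinarith) (by linarith))) x hx ?_ (le_min hx.2 (by linarith))
      linarith [min_le_right 1 (x + η)]
  have hu0 : ∀ x ∈ Icc (0:ℝ) 1, ∀ i, ∀ t ∈ Ico 0 s.T, uu s W 0 i t x = 0 := by
    intro x hx
    obtain ⟨n, hn⟩ := exists_nat_ge (1 / η)
    rw [div_le_iff₀ hη0] at hn
    exact all n x hx (by linarith [hx.1])
  have hconst : ∀ i, ∀ t ∈ Icc 0 s.T, ∀ x ∈ Icc (0:ℝ) 1, W i t x = W i 0 x := by
    intro i t ht x hx
    refine constant_of_has_deriv_right_zero (f := fun r => W i r x) (slice_t (h.c i) hx) (fun r hr => ?_) t ht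
    have := o.dz i r hr x hx
    rw [hu0 x hx i r hr] at this
    exact this.mono_of_mem_nhdsWithin (Ico_mem_nhdsGE_of_mem hr)
  have hFW : ∀ i, ∀ t ∈ Icc 0 s.T, ∀ x ∈ Icc (0:ℝ) 1, FW s W i t x = 0 := by
    intro i t ht x hx
    have hIt : ∀ j, It (fun r y => s.M 1 i j r y * (W j r y - W j 0 y)) t x = 0 := by
      intro j
      unfold It
      refine intervalIntegral.integral_zero_ae (ae_of_all _ fun r hr => ?_)
      rw [uIoc_of_le ht.1] at hr
      have : W j r x = W j 0 x := hconst j r ⟨hr.1.le, hr.2.trans ht.2⟩ x hx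
      simp [this]
    unfold FW
    refine Finset.sum_eq_zero fun j _ => ?_
    rw [hIt, hconst j t ht x hx]; ring
  intro i t ht x hx
  have hΘx : |s.Θ i x| ≤ s.Topt := by
    have h0 := s.Θ_zero i
    have h2 : |s.Θ i 1| ≤ s.Topt := s.hΘ i
    rcases s.Θ_mono i with hmo | hmo
    · have := hmo hx.1; have := hmo hx.2
      rw [abs_le] at h2 ⊢; constructor <;> linarith
    · have := hmo hx.1; have := hmo hx.2
      rw [abs_le] at h2 ⊢; constructor <;> linarith
  obtain ⟨c, hc, hc'⟩ : ∃ c, c ∈ Icc 0 s.T ∧ c - s.Θ i x ∈ Icc 0 s.T := by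
    have := s.hT
    rw [abs_le] at hΘx
    rcases le_total 0 (s.Θ i x) with h | h
    · exact ⟨s.T, ⟨hT.le, le_rfl⟩, by constructor <;> linarith⟩
    · exact ⟨0, ⟨le_rfl, hT.le⟩, by constructor <;> linarith⟩
  have ha := h.mild i c 0 ⟨le_rfl, zero_le_one⟩ x hx (by rw [s.Θ_zero, sub_zero]; exact hc) hc'
  have hz : ∫ y in (0:ℝ)..x, FW s W i (c - s.Θ i y) y = 0 := by
    refine intervalIntegral.integral_zero_ae (ae_of_all _ fun y hy => ?_)
    rw [uIoc_of_le hx.1] at hy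
    exact hFW i _ (s.Θ_between i (y0 := 0) (by rw [s.Θ_zero, sub_zero]; exact hc) hc' (by rw [uIcc_of_le hx.1]; exact ⟨hy.1.le, hy.2⟩)) y
      ⟨hy.1.le, hy.2.trans hx.2⟩
  rw [hz, s.Θ_zero, sub_zero, hconst i c hc 0 ⟨le_rfl, zero_le_one⟩, h.z0 i, sub_zero, hconst i _ hc' x hx] at ha
  rw [hconst i t ht x hx, ha]

end HypObs
namespace HypObs
open Set MeasureTheory Filter Topology
variable {ι : Type} [Fintype ι]

theorem AA {T : ℝ} {f : ℕ → ι → ℝ → ℝ → ℝ} (hc : ∀ n i, CO T (f n i)) (hb : ∀ n, Bdd T 1 (f n))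
    (hm : ∀ ε > 0, ∃ δ > 0, ∀ n i, ∀ t ∈ Icc 0 T, ∀ t' ∈ Icc 0 T, ∀ x ∈ Icc (0:ℝ) 1, ∀ x' ∈ Icc (0:ℝ) 1,
      |t - t'| ≤ δ → |x - x'| ≤ δ → |f n i t x - f n i t' x'| ≤ ε) :
    ∃ (g : ι → ℝ → ℝ → ℝ) (φ : ℕ → ℕ), StrictMono φ ∧ (∀ i, CO T (g i)) ∧ ∀ ε > 0, ∃ N, ∀ n ≥ N, ∀ i, ∀ t ∈ Icc 0 T, ∀ x ∈ Icc (0:ℝ) 1,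
      |f (φ n) i t x - g i t x| ≤ ε := by
  classical
  let K : Set (ℝ × ℝ) := Icc 0 T ×ˢ Icc (0:ℝ) 1
  have hK : IsCompact K := isCompact_Icc.prod isCompact_Icc
  haveI : CompactSpace K := isCompact_iff_compactSpace.1 hK
  let G : ℕ → BoundedContinuousFunction K (ι → ℝ) := fun n =>
    BoundedContinuousFunction.mkOfCompact ⟨fun p i => f n i p.1.1 p.1.2, continuous_pi fun i => continuousOn_iff_continuous_restrict.1 (hc n i)⟩
  have hG : ∀ n (p : K) i, G n p i = f n i p.1.1 p.1.2 := fun n p i => rfl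
  have hcomp : IsCompact (closure (range G)) := by
    refine BoundedContinuousFunction.arzela_ascoli (Metric.closedBall 0 1) (isCompact_closedBall _ _) _ ?_ ?_
    · rintro _ p ⟨n, rfl⟩
      rw [mem_closedBall_zero_iff, pi_norm_le_iff_of_nonneg zero_le_one]
      exact fun i => hb n i _ p.2.1 _ p.2.2
    · intro p
      rw [Metric.equicontinuousAt_iff]
      intro ε hε
      obtain ⟨δ, hδ, h⟩ := hm (ε / 2) (by positivity)
      refine ⟨δ, hδ, ?_⟩
      rintro q hq ⟨_, n, rfl⟩
      refine lt_of_le_of_lt ?_ (half_lt_self hε)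
      rw [dist_pi_le_iff (by positivity)]
      intro i
      rw [Subtype.dist_eq, Prod.dist_eq, max_lt_iff] at hq
      show dist (f n i p.1.1 p.1.2) (f n i q.1.1 q.1.2) ≤ _
      rw [Real.dist_eq]
      refine h n i _ p.2.1 _ q.2.1 _ p.2.2 _ q.2.2 ?_ ?_
      · rw [← Real.dist_eq, dist_comm]; exact hq.1.le
      · rw [← Real.dist_eq, dist_comm]; exact hq.2.le
  obtain ⟨g, _, φ, hφ, hlim⟩ := hcomp.tendsto_subseq (x := G) fun n => subset_closure ⟨n, rfl⟩
  refine ⟨fun i t x => if h : (t, x) ∈ K then g ⟨(t, x), h⟩ i else 0, φ, hφ, ?_, ?_⟩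
  · intro i
    rw [CO, continuousOn_iff_continuous_restrict]
    have : Continuous fun p : K => g p i := (continuous_apply i).comp g.continuous
    convert this using 1
    funext p
    simp only [restrict_apply]
    rw [dif_pos p.2]
  · intro ε hε
    rw [Metric.tendsto_atTop] at hlim
    obtain ⟨N, hN⟩ := hlim ε hε
    refine ⟨N, fun n hn i t ht x hx => ?_⟩
    have hp : (t, x) ∈ K := ⟨ht, hx⟩
    have h1 := (BoundedContinuousFunction.dist_coe_le_dist (f := (G ∘ φ) n) (g := g) ⟨(t, x), hp⟩).trans (hN n hn).le
    have h2 := (dist_le_pi_dist _ _ i).trans h1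
    rw [Real.dist_eq] at h2
    beta_reduce
    rw [dif_pos hp]
    exact h2

theorem pot_sub {S : ℝ → ℝ} (hS : Continuous S) {β : ℝ} (hβ : 0 ≤ β) {f g : ℝ → ℝ → ℝ} (hf : CO β f) (hg : CO β g) {t x : ℝ}
    (ht : t ∈ Icc 0 β) (hx : x ∈ Icc (0:ℝ) 1) :
    pot S (fun r y => f r y - g r y) t x = pot S f t x - pot S g t x := by
  unfold pot
  rw [It_sub hf hg ht hx]
  have hi : ∀ {f : ℝ → ℝ → ℝ}, CO β f → IntervalIntegrable (fun y => S y * f 0 y) volume 0 x := fun {f} hf =>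
    (hS.continuousOn.mul ((slice_x hf (left_mem_Icc.2 hβ)).mono (Icc_subset_Icc_right hx.2))).intervalIntegrable_of_Icc hx.1
  have : ∫ y in (0:ℝ)..x, S y * (f 0 y - g 0 y) = (∫ y in (0:ℝ)..x, S y * f 0 y) - ∫ y in (0:ℝ)..x, S y * g 0 y := by
    rw [← intervalIntegral.integral_sub (hi hf) (hi hg)]
    exact intervalIntegral.integral_congr fun y _ => by ring
  rw [this]; ring

theorem pot_bdd {S : ℝ → ℝ} {β a σ : ℝ} (hβ : 0 ≤ β) {f : ℝ → ℝ → ℝ} (hσ : ∀ x ∈ Icc (0:ℝ) 1, |S x| ≤ σ)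
    (h : ∀ t ∈ Icc 0 β, ∀ x ∈ Icc (0:ℝ) 1, |f t x| ≤ a) {t x : ℝ}
    (ht : t ∈ Icc 0 β) (hx : x ∈ Icc (0:ℝ) 1) : |pot S f t x| ≤ (β + σ) * a := by
  have ha : 0 ≤ a := (abs_nonneg _).trans (h t ht x hx)
  have hs0 : 0 ≤ σ := (abs_nonneg _).trans (hσ x hx)
  have h1 := It_bdd h ht hx
  have h2 : |∫ y in (0:ℝ)..x, S y * f 0 y| ≤ σ * a := by
    refine abs_int_le_of_bdd ⟨le_rfl, zero_le_one⟩ hx (by positivity) fun y hy => ?_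
    rw [uIcc_of_le hx.1] at hy
    have hy1 : y ∈ Icc (0:ℝ) 1 := ⟨hy.1, hy.2.trans hx.2⟩
    rw [abs_mul]
    exact mul_le_mul (hσ y hy1) (h 0 ⟨le_rfl, hβ⟩ y hy1) (abs_nonneg _) hs0
  unfold pot
  refine (abs_add_le _ _).trans ?_
  linarith

theorem PL.lim {s : Sys ι} {f : ℕ → ι → ℝ → ℝ → ℝ} (hf : ∀ n, PL s (f n)) {g : ι → ℝ → ℝ → ℝ} (hg : ∀ i, CO s.T (g i))
    (hl : ∀ ε > 0, ∃ N, ∀ n ≥ N, ∀ i, ∀ t ∈ Icc 0 s.T, ∀ x ∈ Icc (0:ℝ) 1, |f n i t x - g i t x| ≤ ε) : PL s g := by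
  obtain ⟨σ, hσ, hσS, hσΘ⟩ := s.exists_σ
  have hT := s.T_pos
  have hCF := s.CF_nonneg
  have hFWc := FW_cont hT.le le_rfl hg
  have hFd : ∀ n ε, 0 ≤ ε → (∀ i, ∀ t ∈ Icc 0 s.T, ∀ x ∈ Icc (0:ℝ) 1, |f n i t x - g i t x| ≤ ε) → 
      ∀ i, ∀ t ∈ Icc 0 s.T, ∀ x ∈ Icc (0:ℝ) 1, |FW s (f n) i t x - FW s g i t x| ≤ s.CF * ε := by
    intro n ε hε h i t ht x hx
    rw [← FW_sub le_rfl (hf n).c hg i ht hx]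
    exact FW_bdd le_rfl hε (U := fun i t x => f n i t x - g i t x) h i t ht x hx
  have hpt : ∀ i, ∀ t ∈ Icc 0 s.T, ∀ x ∈ Icc (0:ℝ) 1, Tendsto (fun n => f n i t x) atTop (𝓝 (g i t x)) := by
    intro i t ht x hx
    rw [Metric.tendsto_atTop]
    intro ε hε
    obtain ⟨N, hN⟩ := hl (ε / 2) (by positivity)
    refine ⟨N, fun n hn => ?_⟩
    rw [Real.dist_eq]
    linarith [hN n hn i t ht x hx]
  have h01 : (0:ℝ) ∈ Icc (0:ℝ) 1 := ⟨le_rfl, zero_le_one⟩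
  refine ⟨hg, ?_, ?_, ?_, ?_⟩
  · intro i
    refine Along.lim (hFWc i) fun ε hε => ?_
    obtain ⟨N, hN⟩ := hl (ε / (1 + s.CF)) (by positivity)
    have hN' := hN N le_rfl
    refine ⟨f N i, FW s (f N) i, (hf N).mild i, FW_cont hT.le le_rfl (hf N).c i, fun t ht x hx => ⟨(hN' i t ht x hx).trans ?_, 
      (hFd N _ (by positivity) hN' i t ht x hx).trans ?_⟩⟩
    · rw [div_le_iff₀ (by positivity)]; nlinarith
    · rw [← mul_div_assoc, div_le_iff₀ (by positivity)]; nlinarith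
  · intro i j hij
    have hSc : CO s.T (fun _ x => s.S j x - s.S i x) := 
      (((s.hS j).comp continuous_snd).sub ((s.hS i).comp continuous_snd)).continuousOn
    have hcc : ∀ {U : ι → ℝ → ℝ → ℝ}, (∀ i, CO s.T (U i)) → CO s.T (fun t x => (s.S j x - s.S i x) * U j t x + It (FW s U j) t x) :=
      fun {U} hU => (hSc.mul (hU j)).add (It_cont hT.le (FW_cont hT.le le_rfl hU j))
    refine Along.lim (hcc hg) fun ε hε => ?_
    set D := s.T + σ + (2 * σ + s.T * s.CF) with hD
    have hD0 : 0 < D := by positivity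
    obtain ⟨N, hN⟩ := hl (ε / D) (by positivity)
    have hN' := hN N le_rfl
    have hε' : 0 ≤ ε / D := by positivity
    have hDe : D * (ε / D) = ε := by field_simp
    refine ⟨pot (s.S j) (f N j), _, (hf N).sol i j hij, hcc (hf N).c, fun t ht x hx => ⟨?_, ?_⟩⟩
    · rw [← pot_sub (s.hS j) hT.le ((hf N).c j) (hg j) ht hx]
      refine (pot_bdd hT.le (hσS j) (f := fun r y => f N j r y - g j r y) (hN' j) ht hx).trans ?_
      have : 0 ≤ (2 * σ + s.T * s.CF) * (ε / D) := by positivity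
      rw [hD] at hDe
      nlinarith
    · have e : (s.S j x - s.S i x) * f N j t x + It (FW s (f N) j) t x - ((s.S j x - s.S i x) * g j t x + It (FW s g j) t x)
          = (s.S j x - s.S i x) * (f N j t x - g j t x) + It (fun r y => FW s (f N) j r y - FW s g j r y) t x := by
        rw [It_sub (FW_cont hT.le le_rfl (hf N).c j) (hFWc j) ht hx]; ring
      rw [e]
      refine (abs_add_le _ _).trans ?_
      have h1 := It_bdd (f := fun r y => FW s (f N) j r y - FW s g j r y) (hFd N _ (by positivity) hN' j) ht hx
      have h2 : |(s.S j x - s.S i x) * (f N j t x - g j t x)| ≤ (2 * σ) * (ε / D) := by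
        rw [abs_mul]
        have := hσS j x hx; have := hσS i x hx
        refine mul_le_mul ((abs_sub _ _).trans (by linarith)) (hN' j t ht x hx) (abs_nonneg _) (by positivity)
      have : 0 ≤ (s.T + σ) * (ε / D) := by positivity
      rw [hD] at hDe
      nlinarith
  · intro t ht
    have hcl : IsClosed (s.Bd : Set (ι → ℝ)) := s.Bd.closed_of_finiteDimensional
    exact hcl.mem_of_tendsto (tendsto_pi_nhds.2 fun i => hpt i t ht 0 h01) (Eventually.of_forall fun n => (hf n).bd t ht)
  · intro i
    refine tendsto_nhds_unique (hpt i 0 ⟨le_rfl, hT.le⟩ 0 h01) ?_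
    simp only [(hf _).z0]
    exact tendsto_const_nhds

end HypObs
namespace HypObs
open Set MeasureTheory Filter Topology
variable {ι : Type} [Fintype ι]

noncomputable def obs (T : ℝ) (w : ι → ℝ → ℝ → ℝ) : ℝ := ∑ j, ∫ t in (0:ℝ)..T, w j t 1 ^ 2

theorem obs_nonneg {T : ℝ} (hT : 0 ≤ T) (w : ι → ℝ → ℝ → ℝ) : 0 ≤ obs T w :=
  Finset.sum_nonneg fun _ _ => intervalIntegral.integral_nonneg hT fun _ _ => sq_nonneg _

theorem pot_tmod {S : ℝ → ℝ} {T : ℝ} {f : ℝ → ℝ → ℝ} (hf : CO T f) {t t' x μ : ℝ} (ht : t ∈ Icc 0 T) (ht' : t' ∈ Icc 0 T)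
    (hx : x ∈ Icc (0:ℝ) 1) (hμ : 0 < μ) :
    |pot S f t x - pot S f t' x| ≤ μ * (∫ r in (0:ℝ)..T, f r x ^ 2) + |t - t'| / μ := by
  have hT : 0 ≤ T := ht.1.trans ht.2
  have hfc := slice_t hf hx
  have hi : IntervalIntegrable (fun r => f r x ^ 2) volume 0 T := (hfc.pow 2).intervalIntegrable_of_Icc hT
  have key : ∀ {t t' : ℝ}, t ∈ Icc 0 T → t' ∈ Icc 0 T → t' ≤ t → |pot S f t x - pot S f t' x| ≤ μ * (∫ r in (0:ℝ)..T, f r x ^ 2) + |t - t'| / μ := by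
    intro t t' ht ht' htt
    have hsub : Icc t' t ⊆ Icc 0 T := Icc_subset_Icc ht'.1 ht.2
    rw [← ftc_within (f := fun r => pot S f r x) (f' := fun r => f r x) (fun r hr => pot_deriv hf hr hx) hfc ht' ht]
    have i1 : IntervalIntegrable (fun r => f r x ^ 2) volume t' t := ((hfc.pow 2).mono hsub).intervalIntegrable_of_Icc htt
    have h1 : |∫ r in t'..t, f r x| ≤ ∫ r in t'..t, (μ * f r x ^ 2 + 1 / μ) := by
      have := intervalIntegral.norm_integral_le_integral_norm (f := fun r => f r x) (μ := volume) htt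
      rw [Real.norm_eq_abs] at this
      refine this.trans (intervalIntegral.integral_mono_on htt ((hfc.mono hsub).norm.intervalIntegrable_of_Icc htt)
        ((i1.const_mul _).add intervalIntegrable_const) fun r _ => ?_)
      rw [Real.norm_eq_abs]
      have h2 : 0 ≤ (μ * |f r x| - 1) ^ 2 := sq_nonneg _
      have h3 : |f r x| ^ 2 = f r x ^ 2 := sq_abs _
      have h4 : μ * |f r x| ≤ μ * (μ * f r x ^ 2 + 1 / μ) := by
        have : μ * (μ * f r x ^ 2 + 1 / μ) = μ ^ 2 * f r x ^ 2 + 1 := by field_simp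
        rw [this, ← h3]
        nlinarith [mul_nonneg hμ.le (abs_nonneg (f r x))]
      exact le_of_mul_le_mul_left h4 hμ
    refine h1.trans ?_
    rw [intervalIntegral.integral_add (i1.const_mul _) intervalIntegrable_const, intervalIntegral.integral_const_mul,
      intervalIntegral.integral_const, abs_of_nonneg (by linarith)]
    have h5 : ∫ r in t'..t, f r x ^ 2 ≤ ∫ r in (0:ℝ)..T, f r x ^ 2 :=
      intervalIntegral.integral_mono_interval ht'.1 htt ht.2 (ae_of_all _ fun r => sq_nonneg _) hi
    have : (t - t') • (1 / μ) = (t - t') / μ := by rw [smul_eq_mul]; ring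
    rw [this]
    have := mul_le_mul_of_nonneg_left h5 hμ.le
    linarith
  rcases le_total t' t with h | h
  · exact key ht ht' h
  · rw [abs_sub_comm, abs_sub_comm t]; exact key ht' ht h

theorem Cl_mod (s : Sys ι) : ∀ ε > 0, ∃ δ > 0, ∀ w wt wx, Cl s w wt wx → Bdd s.T 1 (fun i => pot (s.S i) (w i)) → obs s.T w ≤ 1 →
    ∀ i, ∀ t ∈ Icc 0 s.T, ∀ t' ∈ Icc 0 s.T, ∀ x ∈ Icc (0:ℝ) 1, ∀ x' ∈ Icc (0:ℝ) 1,
      |t - t'| ≤ δ → |x - x'| ≤ δ → |pot (s.S i) (w i) t x - pot (s.S i) (w i) t' x'| ≤ ε := by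
  obtain ⟨C, hC, hL⟩ := L2Lemma s
  obtain ⟨σ, hσ, hσS, hσΘ⟩ := s.exists_σ
  have hT := s.T_pos
  have hCF := s.CF_nonneg
  intro ε hε
  set a := 1 + s.CF with ha
  set D := C * (a ^ 2 + 1) with hD
  have hD0 : 0 ≤ D := by positivity
  set μ := ε / (4 * (D + 1)) with hμ
  have hμ0 : 0 < μ := by positivity
  have hμD : μ * D ≤ ε / 4 := by
    rw [hμ, div_mul_eq_mul_div, div_le_iff₀ (by positivity)]; nlinarith
  -- choose δ
  obtain ⟨δ, hδ0, hδ1, hδ2⟩ : ∃ δ > 0, σ * δ ≤ s.T ∧ (3 * σ + 1) * δ / μ + s.CF * δ ≤ ε / 4 := by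
    refine ⟨min (s.T / σ) (ε / 4 / ((3 * σ + 1) / μ + s.CF)), by positivity, ?_, ?_⟩
    · calc _ ≤ σ * (s.T / σ) := by gcongr; exact min_le_left _ _
        _ = _ := by field_simp
    · have hp : 0 < (3 * σ + 1) / μ + s.CF := by positivity
      have := min_le_right (s.T / σ) (ε / 4 / ((3 * σ + 1) / μ + s.CF))
      rw [le_div_iff₀ hp] at this
      calc _ = min (s.T / σ) (ε / 4 / ((3 * σ + 1) / μ + s.CF)) * ((3 * σ + 1) / μ + s.CF) := by ring
        _ ≤ _ := this
  refine ⟨δ, hδ0, fun w wt wx h hW ho i t ht t' ht' x hx x' hx' htt hxx => ?_⟩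
  have hF := FW_bdd (s := s) le_rfl zero_le_one hW
  have hL2 : ∀ i, ∀ x ∈ Icc (0:ℝ) 1, ∫ r in (0:ℝ)..s.T, w i r x ^ 2 ≤ D := by
    intro i x hx
    refine (hL w _ _ _ a (by positivity) h.pair (fun i t ht x hx => (hW i t ht x hx).trans (by linarith))
      (fun i t ht x hx => (hF i t ht x hx).trans (by linarith)) (fun i t ht x hx => by simp; positivity) h.bd i x hx).trans ?_
    exact mul_le_mul_of_nonneg_left (by linarith [show ∑ j, ∫ t in (0:ℝ)..s.T, w j t 1 ^ 2 ≤ 1 from ho]) hC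
  have tm : ∀ p ∈ Icc 0 s.T, ∀ q ∈ Icc 0 s.T, ∀ y ∈ Icc (0:ℝ) 1, |pot (s.S i) (w i) p y - pot (s.S i) (w i) q y| ≤ ε / 4 + |p - q| / μ := by
    intro p hp q hq y hy
    have := pot_tmod (S := s.S i) (h.c1 i).c hp hq hy hμ0
    have := mul_le_mul_of_nonneg_left (hL2 i y hy) hμ0.le
    linarith
  set d := s.Θ i x - s.Θ i x' with hd
  have hdb : |d| ≤ σ * δ := (hσΘ i x hx x' hx').trans (by gcongr)
  obtain ⟨t1, ht1, ht1d, htt1⟩ : ∃ t1, t1 ∈ Icc 0 s.T ∧ t1 + d ∈ Icc 0 s.T ∧ |t - t1| ≤ |d| := by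
    have h1 := hdb.trans hδ1
    rcases le_total 0 d with hd0 | hd0
    · rw [abs_of_nonneg hd0] at h1 ⊢
      refine ⟨min t (s.T - d), ⟨le_min ht.1 (by linarith), (min_le_left _ _).trans ht.2⟩, ⟨add_nonneg (le_min ht.1 (by linarith)) hd0, 
        by linarith [min_le_right t (s.T - d)]⟩, ?_⟩
      rw [abs_of_nonneg (by linarith [min_le_left t (s.T - d)])]
      rcases min_cases t (s.T - d) with h | h <;> linarith [ht.2]
    · rw [abs_of_nonpos hd0] at h1 ⊢
      refine ⟨max t (-d), ⟨ht.1.trans (le_max_left _ _), max_le ht.2 h1⟩, ⟨by linarith [le_max_right t (-d)], ?_⟩, ?_⟩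
      · rcases max_cases t (-d) with h | h <;> linarith [ht.2]
      · rw [abs_of_nonpos (by linarith [le_max_left t (-d)])]
        rcases max_cases t (-d) with h | h <;> linarith [ht.1]
  have e1 := tm t ht t1 ht1 x hx
  have e3 := tm (t1 + d) ht1d t' ht' x' hx'
  have e2 : |pot (s.S i) (w i) (t1 + d) x' - pot (s.S i) (w i) t1 x| ≤ s.CF * δ := by
    have h3 : t1 + s.Θ i x - s.Θ i x = t1 := by ring
    have h4 : t1 + s.Θ i x - s.Θ i x' = t1 + d := by rw [hd]; ring
    have := h.PL.mild i (t1 + s.Θ i x) x hx x' hx' (by rw [h3]; exact ht1) (by rw [h4]; exact ht1d)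
    rw [h3, h4] at this
    rw [this]
    have h5 := intervalIntegral.norm_integral_le_of_norm_le_const (a := x) (b := x') 
      (f := fun y => FW s (fun i => pot (s.S i) (w i)) i (t1 + s.Θ i x - s.Θ i y) y) (C := s.CF * 1) fun y hy => by
        have hy := uIoc_subset_uIcc hy
        rw [Real.norm_eq_abs]
        exact hF i _ (s.Θ_between i (by rw [h3]; exact ht1) (by rw [h4]; exact ht1d) hy) y (uIcc_subset_Icc hx hx' hy)
    rw [Real.norm_eq_abs, mul_one] at h5
    refine h5.trans (mul_le_mul_of_nonneg_left ?_ hCF)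
    rwa [abs_sub_comm]
  have e4 : |t - t1| / μ + |t1 + d - t'| / μ ≤ (3 * σ + 1) * δ / μ := by
    rw [← add_div]
    refine div_le_div_of_nonneg_right ?_ hμ0.le
    have : |t1 + d - t'| ≤ |t - t1| + |d| + |t - t'| := by
      have : t1 + d - t' = -(t - t1) + d + (t - t') := by ring
      rw [this]
      refine (abs_add_le _ _).trans ?_
      have := abs_add_le (-(t - t1)) d
      rw [abs_neg] at this
      linarith
    nlinarith
  have : pot (s.S i) (w i) t x - pot (s.S i) (w i) t' x' = (pot (s.S i) (w i) t x - pot (s.S i) (w i) t1 x)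
    - (pot (s.S i) (w i) (t1 + d) x' - pot (s.S i) (w i) t1 x) + (pot (s.S i) (w i) (t1 + d) x' - pot (s.S i) (w i) t' x') := by ring
  rw [this]
  refine (abs_add_le _ _).trans ?_
  have := abs_sub (pot (s.S i) (w i) t x - pot (s.S i) (w i) t1 x) (pot (s.S i) (w i) (t1 + d) x' - pot (s.S i) (w i) t1 x)
  linarith

theorem pot_smul (S : ℝ → ℝ) (f : ℝ → ℝ → ℝ) (k t x : ℝ) : pot S (fun r y => k * f r y) t x = k * pot S f t x := by
  unfold pot It
  rw [intervalIntegral.integral_const_mul, mul_add, ← intervalIntegral.integral_const_mul k (fun y => S y * f 0 y)]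
  congr 1
  exact intervalIntegral.integral_congr fun y _ => by ring

theorem C1.smul {β : ℝ} {f ft fx : ℝ → ℝ → ℝ} (h : C1 β f ft fx) (k : ℝ) :
    C1 β (fun t x => k * f t x) (fun t x => k * ft t x) (fun t x => k * fx t x) :=
  ⟨continuousOn_const.mul h.c, continuousOn_const.mul h.ct, continuousOn_const.mul h.cx,
    fun t ht x hx => (h.dt t ht x hx).const_mul k, fun t ht x hx => (h.dx t ht x hx).const_mul k⟩

theorem Cl.smul {s : Sys ι} {w wt wx : ι → ℝ → ℝ → ℝ} (h : Cl s w wt wx) (k : ℝ) :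
    Cl s (fun i t x => k * w i t x) (fun i t x => k * wt i t x) (fun i t x => k * wx i t x) := by
  refine ⟨fun i => (h.c1 i).smul k, ?_, fun t ht => s.Bd.smul_mem k (h.bd t ht)⟩
  intro i t ht x hx
  rw [h.eq i t ht x hx, mul_add, Finset.mul_sum]
  congr 1
  · ring
  · exact Finset.sum_congr rfl fun j _ => by ring

theorem obs_smul (T k : ℝ) (w : ι → ℝ → ℝ → ℝ) : obs T (fun i t x => k * w i t x) = k ^ 2 * obs T w := by
  unfold obs
  rw [Finset.mul_sum]
  refine Finset.sum_congr rfl fun j _ => ?_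
  rw [← intervalIntegral.integral_const_mul]
  exact intervalIntegral.integral_congr fun y _ => by ring

set_option maxHeartbeats 1000000 in
theorem SupObs (s : Sys ι) : ∃ N, 0 < N ∧ ∀ w wt wx, Cl s w wt wx → ∀ i, ∀ t ∈ Icc 0 s.T, ∀ x ∈ Icc (0:ℝ) 1,
    pot (s.S i) (w i) t x ^ 2 ≤ N * obs s.T w := by
  by_contra! hcon
  have hT := s.T_pos
  have seq : ∀ n : ℕ, ∃ w wt wx, Cl s w wt wx ∧ Bdd s.T 1 (fun i => pot (s.S i) (w i)) ∧ obs s.T w ≤ 1 / (n + 1) ∧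
      ∃ t ∈ Icc 0 s.T, ∃ x ∈ Icc (0:ℝ) 1, ∃ i, |pot (s.S i) (w i) t x| = 1 := by
    intro n
    obtain ⟨w, wt, wx, h, i, t, ht, x, hx, hlt⟩ := hcon (n + 1) (by positivity)
    have hcomp : IsCompact (Icc 0 s.T ×ˢ Icc (0:ℝ) 1) := isCompact_Icc.prod isCompact_Icc
    obtain ⟨p, hp, hpm⟩ := hcomp.exists_isMaxOn ⟨(t, x), ht, hx⟩ (f := fun p : ℝ × ℝ => ‖fun i => pot (s.S i) (w i) p.1 p.2‖)
      (continuousOn_pi.2 fun i => (h.potC1 i).c).norm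
    haveI : Nonempty ι := ⟨i⟩
    set m := ‖fun i => pot (s.S i) (w i) p.1 p.2‖ with hm
    obtain ⟨i0, hi0⟩ : ∃ i0, m = |pot (s.S i0) (w i0) p.1 p.2| := by
      obtain ⟨i0, -, hi0⟩ := Finset.exists_max_image Finset.univ (fun i => |pot (s.S i) (w i) p.1 p.2|) Finset.univ_nonempty
      refine ⟨i0, le_antisymm ?_ (norm_le_pi_norm (fun i => pot (s.S i) (w i) p.1 p.2) i0)⟩
      rw [hm, pi_norm_le_iff_of_nonneg (abs_nonneg _)]
      exact fun i => hi0 i (Finset.mem_univ _)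
    have hle : ∀ i, ∀ t ∈ Icc 0 s.T, ∀ x ∈ Icc (0:ℝ) 1, |pot (s.S i) (w i) t x| ≤ m := fun i t ht x hx =>
      (norm_le_pi_norm (fun i => pot (s.S i) (w i) t x) i).trans (isMaxOn_iff.1 hpm (t, x) ⟨ht, hx⟩)
    have hob := obs_nonneg hT.le w
    have hn : (0:ℝ) < n + 1 := by positivity
    have hW0 : 0 < pot (s.S i) (w i) t x ^ 2 := lt_of_le_of_lt (by positivity) hlt
    have hWm : pot (s.S i) (w i) t x ^ 2 ≤ m ^ 2 := by
      rw [← sq_abs]; exact pow_le_pow_left₀ (abs_nonneg _) (hle i t ht x hx) 2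
    have hm0 : 0 < m := by
      have h0 : 0 ≤ m := norm_nonneg _
      rcases h0.eq_or_lt with h0 | h0
      · rw [← h0] at hWm; nlinarith
      · exact h0
    refine ⟨_, _, _, h.smul (1 / m), ?_, ?_, p.1, hp.1, p.2, hp.2, i0, ?_⟩
    · intro i t ht x hx
      have := hle i t ht x hx
      show |pot (s.S i) (fun t x => 1 / m * w i t x) t x| ≤ 1
      rw [pot_smul, abs_mul, abs_of_pos (by positivity : 0 < 1 / m)]
      calc _ ≤ 1 / m * m := by gcongr
        _ = 1 := by field_simp
    · rw [obs_smul, le_div_iff₀ hn, div_pow, one_pow, div_mul_eq_mul_div, one_mul, div_mul_eq_mul_div, div_le_one (by positivity)]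
      linarith
    · show |pot (s.S i0) (fun t x => 1 / m * w i0 t x) p.1 p.2| = 1
      rw [pot_smul, abs_mul, abs_of_pos (by positivity : 0 < 1 / m), ← hi0]
      field_simp
  choose w wt wx hcl hbd hobs τ hτ ξ hξ i0 hi0 using seq
  have hob1 : ∀ n, obs s.T (w n) ≤ 1 := fun n => (hobs n).trans (by
    rw [div_le_one (by positivity)]; linarith [(Nat.cast_nonneg n : (0:ℝ) ≤ n)])
  obtain ⟨g, φ, hφ, hgc, hlim⟩ := AA (f := fun n i => pot (s.S i) (w n i)) (fun n i => ((hcl n).potC1 i).c) hbd (fun ε hε => by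
    obtain ⟨δ, hδ, h⟩ := Cl_mod s ε hε
    exact ⟨δ, hδ, fun n => h _ _ _ (hcl n) (hbd n) (hob1 n)⟩)
  have hPL : PL s g := PL.lim (f := fun n i => pot (s.S i) (w (φ n) i)) (fun n => (hcl (φ n)).PL) hgc hlim
  have h11 : (1:ℝ) ∈ Icc (0:ℝ) 1 := ⟨zero_le_one, le_rfl⟩
  have h0T : (0:ℝ) ∈ Icc 0 s.T := ⟨le_rfl, hT.le⟩
  have hone : ∀ i, ∀ t ∈ Icc 0 s.T, g i t 1 = g i 0 1 := by
    intro i t ht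
    refine eq_of_abs_sub_le_all fun ε hε => ?_
    obtain ⟨N, hN⟩ := hlim (ε / 4) (by positivity)
    set μ := 4 * s.T / ε with hμ
    have hμ0 : 0 < μ := by positivity
    obtain ⟨n, hn⟩ := exists_nat_ge (max (N:ℝ) (4 * μ / ε))
    have hnN : N ≤ n := by exact_mod_cast (le_max_left _ _).trans hn
    have hn2 : 4 * μ / ε ≤ n := (le_max_right _ _).trans hn
    have hφn : (n:ℝ) ≤ φ n := by exact_mod_cast hφ.id_le n
    have h1 := hN n hnN i t ht 1 h11
    have h2 := hN n hnN i 0 h0T 1 h11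
    have h3 := pot_tmod (S := s.S i) ((hcl (φ n)).c1 i).c ht h0T h11 hμ0
    have h4 : ∫ r in (0:ℝ)..s.T, w (φ n) i r 1 ^ 2 ≤ 1 / (φ n + 1) := by
      refine le_trans ?_ (hobs (φ n))
      exact Finset.single_le_sum (f := fun j => ∫ r in (0:ℝ)..s.T, w (φ n) j r 1 ^ 2)
        (fun _ _ => intervalIntegral.integral_nonneg hT.le fun _ _ => sq_nonneg _) (Finset.mem_univ i)
    have h5 : μ * (∫ r in (0:ℝ)..s.T, w (φ n) i r 1 ^ 2) ≤ ε / 4 := by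
      refine (mul_le_mul_of_nonneg_left h4 hμ0.le).trans ?_
      rw [← mul_div_assoc, mul_one, div_le_iff₀ (by positivity)]
      rw [div_le_iff₀ hε] at hn2
      nlinarith
    have h6 : |t - 0| / μ ≤ ε / 4 := by
      rw [sub_zero, abs_of_nonneg ht.1, div_le_iff₀ hμ0, hμ]
      calc t ≤ s.T := ht.2
        _ = _ := by field_simp
    rw [abs_le] at h1 h2 h3 ⊢
    constructor <;> linarith
  have hz := uniq hPL hone
  obtain ⟨N, hN⟩ := hlim (1 / 2) (by norm_num)
  have := hN N le_rfl (i0 (φ N)) _ (hτ (φ N)) _ (hξ (φ N))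
  rw [hz _ _ (hτ (φ N)) _ (hξ (φ N)), sub_zero, hi0] at this
  norm_num at this

/-- interior observability -/
theorem IntObs (s : Sys ι) : ∃ N, 0 < N ∧ ∀ w wt wx, Cl s w wt wx → ∀ i, ∀ x ∈ Icc (0:ℝ) 1,
    ∫ t in (0:ℝ)..s.T, w i t x ^ 2 ≤ N * obs s.T w := by
  obtain ⟨C, hC, hL⟩ := L2Lemma s
  obtain ⟨N, hN, hS⟩ := SupObs s
  have hT := s.T_pos
  have hCF := s.CF_nonneg
  refine ⟨C * ((1 + s.CF) ^ 2 * N + 1) + 1, by positivity, fun w wt wx h i x hx => ?_⟩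
  have hob := obs_nonneg hT.le w
  set q := Real.sqrt (N * obs s.T w) with hq
  have hq2 : q ^ 2 = N * obs s.T w := Real.sq_sqrt (by positivity)
  have hq0 : 0 ≤ q := Real.sqrt_nonneg _
  have hW : Bdd s.T q (fun i => pot (s.S i) (w i)) := fun i t ht x hx => Real.abs_le_sqrt (hS w wt wx h i t ht x hx)
  have hF := FW_bdd (s := s) le_rfl hq0 hW
  have := hL w _ _ _ ((1 + s.CF) * q) (by positivity) h.pair (fun i t ht x hx => (hW i t ht x hx).trans (by nlinarith))
      (fun i t ht x hx => (hF i t ht x hx).trans (by nlinarith)) (fun i t ht x hx => by simp; positivity) h.bd i x hx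
  refine this.trans ?_
  rw [mul_pow, hq2]
  show C * ((1 + s.CF) ^ 2 * (N * obs s.T w) + obs s.T w) ≤ _
  nlinarith

end HypObs
namespace HypObs
open Set MeasureTheory Filter Topology
variable {ι : Type} [Fintype ι]

theorem gron {E J p : ℝ → ℝ} {T K : ℝ} (hT : 0 ≤ T) (hK : 0 ≤ K) (hc : ContinuousOn E (Icc 0 T))
    (hE : ∀ t ∈ Ioo 0 T, HasDerivAt E (J t) t) (hp : ContinuousOn p (Icc 0 T)) (hp0 : ∀ t ∈ Icc 0 T, 0 ≤ p t)
    (hE0 : ∀ t ∈ Icc 0 T, 0 ≤ E t) (hJ : ∀ t ∈ Ioo 0 T, J t ≤ p t + K * E t) {t : ℝ} (ht : t ∈ Icc 0 T) :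
    E T ≤ Real.exp (K * T) * (E t + ∫ r in (0:ℝ)..T, p r) := by
  set g : ℝ → ℝ → ℝ := fun r _ => p r
  have hg : CO T g := hp.comp (f := fun q : ℝ × ℝ => q.1) (by fun_prop) fun q hq => hq.1
  have hI : ∀ r ∈ Icc 0 T, HasDerivWithinAt (fun r => ∫ s in (0:ℝ)..r, p s) (p r) (Icc 0 T) r :=
    fun r hr => It_deriv hg hr (left_mem_Icc.2 zero_le_one)
  have hexp : ∀ r, HasDerivAt (fun r => Real.exp (-(K * r))) (Real.exp (-(K * r)) * (-(K * 1))) r :=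
    fun r => (((hasDerivAt_id r).const_mul K).neg).exp
  have hφ : ∀ r ∈ Ioo 0 T, HasDerivAt (fun r => Real.exp (-(K * r)) * E r - ∫ s in (0:ℝ)..r, p s)
      (Real.exp (-(K * r)) * (-(K * 1)) * E r + Real.exp (-(K * r)) * J r - p r) r := fun r hr =>
    ((hexp r).mul (hE r hr)).sub ((hI r (Ioo_subset_Icc_self hr)).hasDerivAt (Icc_mem_nhds hr.1 hr.2))
  have ha : AntitoneOn (fun r => Real.exp (-(K * r)) * E r - ∫ s in (0:ℝ)..r, p s) (Icc 0 T) := by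
    refine antitoneOn_of_deriv_nonpos (convex_Icc 0 T) ?_ ?_ ?_
    · refine ContinuousOn.sub (ContinuousOn.mul (by fun_prop) hc) fun r hr => (hI r hr).continuousWithinAt
    · rw [interior_Icc]; exact fun r hr => (hφ r hr).differentiableAt.differentiableWithinAt
    · rw [interior_Icc]
      intro r hr
      rw [(hφ r hr).deriv]
      have h1 : Real.exp (-(K * r)) ≤ 1 := Real.exp_le_one_iff.2 (by have := mul_nonneg hK hr.1.le; linarith)
      have h2 := Real.exp_pos (-(K * r))
      have h3 := hp0 r (Ioo_subset_Icc_self hr)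
      nlinarith [hJ r hr, mul_le_mul_of_nonneg_left (hJ r hr) h2.le]
  have h1 := ha ht (right_mem_Icc.2 hT) ht.2
  simp only at h1
  have hii : ∀ a ∈ Icc 0 T, ∀ b ∈ Icc 0 T, IntervalIntegrable p volume a b := fun a ha b hb =>
    (hp.mono (uIcc_subset_Icc ha hb)).intervalIntegrable
  have h2 : 0 ≤ ∫ s in (0:ℝ)..t, p s :=
    intervalIntegral.integral_nonneg ht.1 fun s hs => hp0 s ⟨hs.1, hs.2.trans ht.2⟩
  have h3 : Real.exp (-(K * t)) ≤ 1 := Real.exp_le_one_iff.2 (by have := mul_nonneg hK ht.1; linarith)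
  have h4 : Real.exp (-(K * T)) * E T ≤ E t + ∫ r in (0:ℝ)..T, p r := by nlinarith [hE0 t ht]
  calc E T = Real.exp (K * T) * (Real.exp (-(K * T)) * E T) := by
        rw [← mul_assoc, ← Real.exp_add]; simp
    _ ≤ _ := mul_le_mul_of_nonneg_left h4 (Real.exp_pos _).le

theorem slab_cont {T : ℝ} (hT : 0 ≤ T) {e : ℝ → ℝ → ℝ} (he : CO T e) :
    ContinuousOn (fun t => ∫ x in (0:ℝ)..1, e t x) (Icc 0 T) := by
  have h := intervalIntegral.continuous_parametric_intervalIntegral_of_continuous' (μ := volume)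
    (f := fun t x => ext T e t x) (ext_cont hT he) 0 1
  refine h.continuousOn.congr fun t ht => intervalIntegral.integral_congr fun x hx => ?_
  rw [uIcc_of_le zero_le_one] at hx
  exact (ext_eq ht hx).symm

theorem slab_deriv {T : ℝ} {e et : ℝ → ℝ → ℝ} (he : CO T e) (het : CO T et)
    (hd : ∀ t ∈ Icc 0 T, ∀ x ∈ Icc (0:ℝ) 1, HasDerivWithinAt (fun r => e r x) (et t x) (Icc 0 T) t) {t : ℝ}
    (ht : t ∈ Ioo 0 T) : HasDerivAt (fun t => ∫ x in (0:ℝ)..1, e t x) (∫ x in (0:ℝ)..1, et t x) t := by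
  obtain ⟨Z, hZ0, hZ⟩ := exists_bdd (ι := Unit) (z := fun _ => et) (fun _ => het)
  have hsl : ∀ {g : ℝ → ℝ → ℝ}, CO T g → ∀ y ∈ Icc (0:ℝ) T, ContinuousOn (fun r => g y r) (uIcc 0 1) :=
    fun hg y hy => by rw [uIcc_of_le zero_le_one]; exact slice_x hg hy
  have hio := Ioo_subset_Icc_self (a := (0:ℝ)) (b := T)
  refine (intervalIntegral.hasDerivAt_integral_of_dominated_loc_of_deriv_le (μ := volume)
    (F := fun t r => e t r) (F' := fun t r => et t r) (bound := fun _ => Z) (s := Ioo 0 T)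
    (Ioo_mem_nhds ht.1 ht.2) ?_ ?_ ?_ ?_ ?_ ?_).2
  · filter_upwards [Ioo_mem_nhds ht.1 ht.2] with y hy
    exact ((hsl he y (hio hy)).mono uIoc_subset_uIcc).aestronglyMeasurable measurableSet_uIoc
  · exact (hsl he t (hio ht)).intervalIntegrable
  · exact ((hsl het t (hio ht)).mono uIoc_subset_uIcc).aestronglyMeasurable measurableSet_uIoc
  · refine Eventually.of_forall fun r hr y hy => ?_
    rw [uIoc_of_le zero_le_one] at hr
    exact hZ () y (hio hy) r (Ioc_subset_Icc_self hr)
  · exact intervalIntegrable_const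
  · refine Eventually.of_forall fun r hr y hy => ?_
    rw [uIoc_of_le zero_le_one] at hr
    exact (hd y (hio hy) r (Ioc_subset_Icc_self hr)).hasDerivAt (Icc_mem_nhds hy.1 hy.2)

theorem slab_swap {T T0 : ℝ} (h0 : 0 ≤ T0) (hT : T0 ≤ T) {e : ℝ → ℝ → ℝ} (he : CO T e) :
    ∫ t in (0:ℝ)..T0, ∫ x in (0:ℝ)..1, e t x = ∫ x in (0:ℝ)..1, ∫ t in (0:ℝ)..T0, e t x := by
  refine MeasureTheory.intervalIntegral_intervalIntegral_swap ?_
  rw [uIoc_of_le h0, uIoc_of_le zero_le_one]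
  refine IntegrableOn.mono_set (t := Icc 0 T ×ˢ Icc 0 1) ?_
    (Set.prod_mono (Ioc_subset_Icc_self.trans (Icc_subset_Icc_right hT)) Ioc_subset_Icc_self)
  exact ContinuousOn.integrableOn_compact (isCompact_Icc.prod isCompact_Icc) he

set_option maxHeartbeats 1000000 in
/-- energy estimate -/
theorem Energy {S : ι → ℝ → ℝ} (hS : ∀ i, Continuous (S i)) {q : ι → ℝ} {s0 P σ A T T0 : ℝ} (hs0 : 0 < s0)
    (hP : 0 < P) (hσ : 0 < σ) (hA : 0 ≤ A) (hT0 : 0 < T0) (hT : T0 ≤ T) (hq : ∀ i, |q i| ≤ P)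
    (hqS : ∀ i, ∀ x ∈ Icc (0:ℝ) 1, s0 ≤ q i * S i x) (hSσ : ∀ i, ∀ x ∈ Icc (0:ℝ) 1, |S i x| ≤ σ) :
    ∃ K, 0 < K ∧ ∀ (w wt wx G : ι → ℝ → ℝ → ℝ) (D : ℝ), (∀ i, CO T (w i)) → (∀ i, CO T (wt i)) → (∀ i, CO T (wx i)) →
      (∀ i, ∀ t ∈ Icc 0 T, ∀ x ∈ Icc (0:ℝ) 1, HasDerivWithinAt (fun r => w i r x) (wt i t x) (Icc 0 T) t) →
      (∀ i, ∀ t ∈ Icc 0 T, ∀ x ∈ Icc (0:ℝ) 1, HasDerivWithinAt (fun y => w i t y) (wx i t x) (Icc 0 1) x) →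
      (∀ i, ∀ t ∈ Icc 0 T, ∀ x ∈ Icc (0:ℝ) 1, wx i t x = S i x * wt i t x + G i t x) →
      (∀ i, ∀ t ∈ Icc 0 T, ∀ x ∈ Icc (0:ℝ) 1, |G i t x| ≤ A * ∑ j, |w j t x|) →
      (∀ t ∈ Icc 0 T, 0 ≤ ∑ i, q i * w i t 0 ^ 2) →
      (∀ x ∈ Icc (0:ℝ) 1, ∑ i, ∫ t in (0:ℝ)..T0, w i t x ^ 2 ≤ D) →
      ∫ x in (0:ℝ)..1, ∑ i, w i T x ^ 2 ≤ K * (D + ∫ t in (0:ℝ)..T, ∑ i, w i t 1 ^ 2) := by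
  have hTp : 0 < T := hT0.trans_le hT
  set n : ℝ := (Fintype.card ι : ℝ)
  have hn : 0 ≤ n := Nat.cast_nonneg _
  set L : ℝ := 2 * P * A * n / s0 with hL
  have hL0 : 0 ≤ L := by positivity
  refine ⟨Real.exp (L * T) * (P * σ / T0 + P) / s0, by positivity, ?_⟩
  intro w wt wx G D cw cwt cwx hdt hdx heq hG h0 hD
  set e : ℝ → ℝ → ℝ := fun t x => ∑ i, q i * S i x * w i t x ^ 2 with he
  set et : ℝ → ℝ → ℝ := fun t x => ∑ i, q i * S i x * (2 * w i t x * wt i t x) with het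
  have cS : ∀ i, CO T (fun _ x => S i x) := fun i => ((hS i).comp continuous_snd).continuousOn
  have ce : CO T e := continuousOn_finsetSum _ fun i _ => ((continuousOn_const.mul (cS i)).mul ((cw i).pow 2))
  have cet : CO T et := continuousOn_finsetSum _ fun i _ =>
    ((continuousOn_const.mul (cS i)).mul ((continuousOn_const.mul (cw i)).mul (cwt i)))
  have hde : ∀ t ∈ Icc 0 T, ∀ x ∈ Icc (0:ℝ) 1, HasDerivWithinAt (fun r => e r x) (et t x) (Icc 0 T) t := by
    intro t ht x hx
    refine HasDerivWithinAt.fun_sum fun i _ => ?_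
    have := ((hdt i t ht x hx).pow 2).const_mul (q i * S i x)
    convert! this using 1
    ring
  have elow : ∀ t, ∀ x ∈ Icc (0:ℝ) 1, s0 * ∑ i, w i t x ^ 2 ≤ e t x := by
    intro t x hx
    rw [Finset.mul_sum]
    exact Finset.sum_le_sum fun i _ => mul_le_mul_of_nonneg_right (hqS i x hx) (sq_nonneg _)
  have ehigh : ∀ t, ∀ x ∈ Icc (0:ℝ) 1, e t x ≤ P * σ * ∑ i, w i t x ^ 2 := by
    intro t x hx
    rw [Finset.mul_sum]
    refine Finset.sum_le_sum fun i _ => mul_le_mul_of_nonneg_right ?_ (sq_nonneg _)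
    refine (le_abs_self _).trans ?_
    rw [abs_mul]
    exact mul_le_mul (hq i) (hSσ i x hx) (abs_nonneg _) hP.le
  have e0 : ∀ t, ∀ x ∈ Icc (0:ℝ) 1, 0 ≤ e t x := fun t x hx =>
    le_trans (mul_nonneg hs0.le (Finset.sum_nonneg fun i _ => sq_nonneg _)) (elow t x hx)
  set p : ℝ → ℝ := fun t => P * ∑ i, w i t 1 ^ 2 with hp
  have h11 : (1:ℝ) ∈ Icc (0:ℝ) 1 := right_mem_Icc.2 zero_le_one
  have h00 : (0:ℝ) ∈ Icc (0:ℝ) 1 := left_mem_Icc.2 zero_le_one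
  have cp : ContinuousOn p (Icc 0 T) :=
    continuousOn_const.mul (continuousOn_finsetSum _ fun i _ => (slice_t (cw i) h11).pow 2)
  have hp0 : ∀ t ∈ Icc 0 T, 0 ≤ p t := fun t _ => mul_nonneg hP.le (Finset.sum_nonneg fun i _ => sq_nonneg _)
  have hE0 : ∀ t ∈ Icc 0 T, 0 ≤ ∫ x in (0:ℝ)..1, e t x := fun t _ =>
    intervalIntegral.integral_nonneg zero_le_one fun x hx => e0 t x hx
  have hii : ∀ {f : ℝ → ℝ}, ContinuousOn f (Icc 0 1) → IntervalIntegrable f volume 0 1 := fun h =>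
    h.intervalIntegrable_of_Icc zero_le_one
  have hJ : ∀ t ∈ Ioo 0 T, ∫ x in (0:ℝ)..1, et t x ≤ p t + L * ∫ x in (0:ℝ)..1, e t x := by
    intro t ht'
    have ht := Ioo_subset_Icc_self ht'
    have cfl : ContinuousOn (fun x => ∑ i, q i * (2 * w i t x * wx i t x)) (Icc 0 1) :=
      continuousOn_finsetSum _ fun i _ => continuousOn_const.mul
        ((continuousOn_const.mul (slice_x (cw i) ht)).mul (slice_x (cwx i) ht))
    have hfl := ftc_within (β := 1) (f := fun x => ∑ i, q i * w i t x ^ 2)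
      (f' := fun x => ∑ i, q i * (2 * w i t x * wx i t x)) (fun x hx => by
        refine HasDerivWithinAt.fun_sum fun i _ => ?_
        have := ((hdx i t ht x hx).pow 2).const_mul (q i)
        convert! this using 1
        ring) cfl h00 h11
    have hpt : ∀ x ∈ Icc (0:ℝ) 1, et t x ≤ (∑ i, q i * (2 * w i t x * wx i t x)) + L * e t x := by
      intro x hx
      have h1 : et t x = (∑ i, q i * (2 * w i t x * wx i t x)) + ∑ i, -(2 * q i * w i t x * G i t x) := by
        rw [← Finset.sum_add_distrib]
        refine Finset.sum_congr rfl fun i _ => ?_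
        rw [heq i t ht x hx]; ring
      rw [h1]
      have h2 : ∑ i, -(2 * q i * w i t x * G i t x) ≤ ∑ i, 2 * P * |w i t x| * (A * ∑ j, |w j t x|) := by
        refine Finset.sum_le_sum fun i _ => (neg_le_abs _).trans ?_
        rw [abs_mul, abs_mul, abs_mul, abs_two]
        have := hG i t ht x hx
        have := hq i
        gcongr
      have h3 : ∑ i, 2 * P * |w i t x| * (A * ∑ j, |w j t x|) = 2 * P * A * (∑ j, |w j t x|) ^ 2 := by
        rw [← Finset.sum_mul, ← Finset.mul_sum]; ring
      have h4 : (∑ j, |w j t x|) ^ 2 ≤ n * ∑ j, w j t x ^ 2 := by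
        have := sq_sum_le_card_mul_sum_sq (s := Finset.univ) (f := fun j => |w j t x|)
        simpa [n] using this
      have h5 : 2 * P * A * (n * ∑ j, w j t x ^ 2) ≤ L * e t x := by
        have : 2 * P * A * (n * ∑ j, w j t x ^ 2) = L * (s0 * ∑ j, w j t x ^ 2) := by
          rw [hL]; field_simp
        rw [this]; exact mul_le_mul_of_nonneg_left (elow t x hx) hL0
      have h6 := mul_le_mul_of_nonneg_left h4 (by positivity : 0 ≤ 2 * P * A)
      linarith
    have ce' := slice_x ce ht
    have h7 : _ ≤ ∫ x in (0:ℝ)..1, ((∑ i, q i * (2 * w i t x * wx i t x)) + L * e t x) :=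
      intervalIntegral.integral_mono_on zero_le_one (hii (slice_x cet ht))
      (hii (cfl.add (continuousOn_const.mul ce') : ContinuousOn (fun x => (∑ i, q i * (2 * w i t x * wx i t x)) + L * e t x) _)) hpt
    rw [intervalIntegral.integral_add (hii cfl) ((hii ce').const_mul L), intervalIntegral.integral_const_mul, hfl] at h7
    have h8 : ∑ i, q i * w i t 1 ^ 2 ≤ p t := by
      rw [hp]; simp only; rw [Finset.mul_sum]
      exact Finset.sum_le_sum fun i _ => mul_le_mul_of_nonneg_right ((le_abs_self _).trans (hq i)) (sq_nonneg _)
    linarith [h0 t ht]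
  have hgr := fun t ht => gron (E := fun t => ∫ x in (0:ℝ)..1, e t x) hTp.le hL0 (slab_cont hTp.le ce)
    (fun t ht => slab_deriv ce cet hde ht) cp hp0 hE0 hJ (t := t) ht
  have hsub : Icc 0 T0 ⊆ Icc 0 T := Icc_subset_Icc_right hT
  have cE : ContinuousOn (fun t => ∫ x in (0:ℝ)..1, e t x) (Icc 0 T0) := (slab_cont hTp.le ce).mono hsub
  have hPi : ∫ r in (0:ℝ)..T, p r = P * ∫ t in (0:ℝ)..T, ∑ i, w i t 1 ^ 2 := intervalIntegral.integral_const_mul _ _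
  set ob := ∫ t in (0:ℝ)..T, ∑ i, w i t 1 ^ 2
  set ET := ∫ x in (0:ℝ)..1, e T x
  have h9 : T0 * ET ≤ Real.exp (L * T) * ((∫ t in (0:ℝ)..T0, ∫ x in (0:ℝ)..1, e t x) + T0 * (P * ob)) := by
    have h := intervalIntegral.integral_mono_on hT0.le (f := fun _ => ET)
      (g := fun t => Real.exp (L * T) * ((∫ x in (0:ℝ)..1, e t x) + P * ob)) (μ := volume)
      intervalIntegrable_const ((cE.add continuousOn_const).intervalIntegrable_of_Icc hT0.le |>.const_mul _)
      (fun t ht => by rw [← hPi]; exact hgr t (hsub ht))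
    rw [intervalIntegral.integral_const_mul, intervalIntegral.integral_add (cE.intervalIntegrable_of_Icc hT0.le)
      intervalIntegrable_const] at h
    simpa [mul_left_comm T0 P ob] using h
  have h10 : ∫ t in (0:ℝ)..T0, ∫ x in (0:ℝ)..1, e t x ≤ P * σ * D := by
    rw [slab_swap hT0.le hT ce]
    have hbd : ∀ x ∈ Icc (0:ℝ) 1, ∫ t in (0:ℝ)..T0, e t x ≤ P * σ * D := by
      intro x hx
      have hsl : ∀ i, IntervalIntegrable (fun t => w i t x ^ 2) volume 0 T0 := fun i =>
        ((((slice_t (cw i) hx).mono hsub)).pow 2).intervalIntegrable_of_Icc hT0.le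
      have h1 := intervalIntegral.integral_mono_on hT0.le (f := fun t => e t x)
        (g := fun t => P * σ * ∑ i, w i t x ^ 2) (μ := volume)
        (((slice_t ce hx).mono hsub).intervalIntegrable_of_Icc hT0.le)
        (((continuousOn_finsetSum _ fun i _ => ((slice_t (cw i) hx).mono hsub).pow 2).intervalIntegrable_of_Icc hT0.le).const_mul _)
        (fun t _ => ehigh t x hx)
      rw [intervalIntegral.integral_const_mul, intervalIntegral.integral_finsetSum fun i _ => hsl i] at h1
      exact h1.trans (mul_le_mul_of_nonneg_left (hD x hx) (by positivity))
    have h := intervalIntegral.integral_mono_on zero_le_one (f := fun x => ∫ t in (0:ℝ)..T0, e t x)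
      (g := fun _ => P * σ * D) (μ := volume) (hii ?_) intervalIntegrable_const hbd
    · simpa using h
    · have := intervalIntegral.continuous_parametric_intervalIntegral_of_continuous' (μ := volume)
        (f := fun x t => ext T e t x) ((ext_cont hTp.le ce).comp (f := fun p : ℝ × ℝ => (p.2, p.1)) (by fun_prop)) 0 T0
      refine this.continuousOn.congr fun x hx => intervalIntegral.integral_congr fun t ht => ?_
      rw [uIcc_of_le hT0.le] at ht
      exact (ext_eq (hsub ht) hx).symm
  have hTT : T ∈ Icc 0 T := right_mem_Icc.2 hTp.le
  have h12 : s0 * ∫ x in (0:ℝ)..1, ∑ i, w i T x ^ 2 ≤ ET := by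
    rw [← intervalIntegral.integral_const_mul]
    exact intervalIntegral.integral_mono_on zero_le_one
      ((hii (continuousOn_finsetSum _ fun i _ => (slice_x (cw i) hTT).pow 2)).const_mul _) (hii (slice_x ce hTT))
      fun x hx => elow T x hx
  have hob : 0 ≤ ob := intervalIntegral.integral_nonneg hTp.le fun t _ => Finset.sum_nonneg fun i _ => sq_nonneg _
  have hD0 : 0 ≤ D := le_trans (Finset.sum_nonneg fun i _ =>
    intervalIntegral.integral_nonneg hT0.le fun t _ => sq_nonneg _) (hD 0 h00)
  set X := Real.exp (L * T)
  have hX : 0 < X := Real.exp_pos _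
  have h13 : ET ≤ X * (P * σ / T0 * D + P * ob) := by
    have h := h9.trans (mul_le_mul_of_nonneg_left (add_le_add_left h10 _) hX.le)
    have e1 : X * (P * σ * D + T0 * (P * ob)) = T0 * (X * (P * σ / T0 * D + P * ob)) := by field_simp
    rw [e1] at h
    exact le_of_mul_le_mul_left h hT0
  have h14 : X * (P * σ / T0 * D + P * ob) ≤ X * ((P * σ / T0 + P) * (D + ob)) := by
    refine mul_le_mul_of_nonneg_left ?_ hX.le
    have : 0 ≤ P * σ / T0 * ob := by positivity
    have : 0 ≤ P * D := by positivity
    nlinarith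
  have h15 := h12.trans (h13.trans h14)
  rw [div_mul_eq_mul_div, le_div_iff₀ hs0]
  calc _ = s0 * ∫ x in (0:ℝ)..1, ∑ i, w i T x ^ 2 := mul_comm _ _
    _ ≤ _ := h15
    _ = _ := by ring

end HypObs
namespace HypObs
open Set MeasureTheory Filter Topology

theorem an_local {E : Type} [NormedAddCommGroup E] [NormedSpace ℝ E] [CompleteSpace E] {F : ℝ → E} {t0 : ℝ}
    (h : AnalyticAt ℝ F t0) : ∃ A R δ : ℝ, 0 ≤ A ∧ 1 ≤ R ∧ 0 < δ ∧ ∀ t, |t - t0| < δ → ∀ l : ℕ,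
      ‖((l.factorial : ℝ)⁻¹) • iteratedDeriv l F t‖ ≤ A * R ^ l := by
  obtain ⟨p, r, hp⟩ := h
  obtain ⟨ρ, hρ0, hρ⟩ := ENNReal.lt_iff_exists_nnreal_btwn.1 hp.r_pos
  have hρ0' : 0 < ρ := by exact_mod_cast hρ0
  set d : NNReal := ρ / 2 with hd
  have hd0 : 0 < d := by positivity
  have hdd : ((d : ENNReal) + d) = ρ := by
    rw [← ENNReal.coe_add, hd, add_halves]
  have hdr : ((d : ENNReal) + d) < p.radius := by rw [hdd]; exact hρ.trans_le hp.r_le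
  have hs := p.changeOriginSeries_summable_aux₁ hdr
  set A := ∑' s : Σ k l : ℕ, { s : Finset (Fin (k + l)) // s.card = l }, ‖p (s.1 + s.2.1)‖₊ * d ^ s.2.1 * d ^ s.1
  refine ⟨A, max 1 (d:ℝ)⁻¹, d, A.2, le_max_left _ _, hd0, fun t ht l => ?_⟩
  set y := t - t0 with hy
  have hyd : ‖y‖₊ < d := by
    rw [← NNReal.coe_lt_coe, coe_nnnorm, Real.norm_eq_abs]; exact ht
  have hyd' : (‖y‖₊ : ENNReal) < d := by exact_mod_cast hyd
  have hdr' : (d : ENNReal) < ρ := by exact_mod_cast NNReal.half_lt_self hρ0'.ne'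
  have hco := hp.changeOrigin (hyd'.trans (hdr'.trans hρ))
  have hf := hco.factorial_smul (1:ℝ) l
  rw [show t0 + y = t by rw [hy]; ring, ← iteratedDeriv_eq_iteratedFDeriv] at hf
  have hfac : (l.factorial : ℝ) ≠ 0 := by exact_mod_cast l.factorial_ne_zero
  rw [← hf, ← Nat.cast_smul_eq_nsmul ℝ, smul_smul, inv_mul_cancel₀ hfac, one_smul]
  have h1 : ‖p.changeOrigin y l (fun _ => (1:ℝ))‖ ≤ ‖p.changeOrigin y l‖ := by
    simpa using (p.changeOrigin y l).le_opNorm (fun _ => (1:ℝ))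
  refine h1.trans ?_
  have h2 := p.nnnorm_changeOrigin_le l (x := y) (hyd'.trans (hdr'.trans (hρ.trans_le hp.r_le)))
  have h3 := p.changeOriginSeries_summable_aux₂ (r := d) (hdr'.trans (hρ.trans_le hp.r_le)) l
  have h4 : ‖p.changeOrigin y l‖₊ * d ^ l ≤ A := by
    calc ‖p.changeOrigin y l‖₊ * d ^ l
        ≤ (∑' s : Σ k : ℕ, { s : Finset (Fin (l + k)) // s.card = k }, ‖p (l + s.1)‖₊ * d ^ s.1) * d ^ l := by
          gcongr
          refine h2.trans (Summable.tsum_le_tsum (fun s => by gcongr) ?_ h3)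
          exact NNReal.summable_of_le (fun s => by gcongr) h3
      _ = ∑' s : Σ k : ℕ, { s : Finset (Fin (l + k)) // s.card = k }, ‖p (l + s.1)‖₊ * d ^ s.1 * d ^ l :=
          (NNReal.tsum_mul_right _ _).symm
      _ ≤ A := by
          have := (NNReal.summable_sigma.1 hs).2
          rw [show A = _ from hs.tsum_sigma' (fun k => (NNReal.summable_sigma.1 hs).1 k)]
          exact this.le_tsum l (fun _ _ => zero_le)
  have h5 : ‖p.changeOrigin y l‖ * (d:ℝ) ^ l ≤ A := by exact_mod_cast h4
  have hdp : (0:ℝ) < d := hd0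
  calc ‖p.changeOrigin y l‖ = (‖p.changeOrigin y l‖ * (d:ℝ) ^ l) * (d:ℝ)⁻¹ ^ l := by
        rw [mul_assoc, ← mul_pow, mul_inv_cancel₀ hdp.ne', one_pow, mul_one]
    _ ≤ A * (max 1 (d:ℝ)⁻¹) ^ l := by
        gcongr
        exact le_max_right _ _

theorem an_bound {E : Type} [NormedAddCommGroup E] [NormedSpace ℝ E] [CompleteSpace E] {F : ℝ → E} {s : Set ℝ}
    (hs : IsCompact s) (h : ∀ t ∈ s, AnalyticAt ℝ F t) : ∃ A R : ℝ, 0 ≤ A ∧ 1 ≤ R ∧ ∀ t ∈ s, ∀ l : ℕ,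
      ‖((l.factorial : ℝ)⁻¹) • iteratedDeriv l F t‖ ≤ A * R ^ l := by
  refine hs.induction_on (p := fun s => ∃ A R : ℝ, 0 ≤ A ∧ 1 ≤ R ∧ ∀ t ∈ s, ∀ l : ℕ,
      ‖((l.factorial : ℝ)⁻¹) • iteratedDeriv l F t‖ ≤ A * R ^ l) ⟨0, 1, le_rfl, le_rfl, by simp⟩ ?_ ?_ ?_
  · rintro s s' hss ⟨A, R, hA, hR, h⟩
    exact ⟨A, R, hA, hR, fun t ht => h t (hss ht)⟩
  · rintro s s' ⟨A, R, hA, hR, h⟩ ⟨A', R', hA', hR', h'⟩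
    refine ⟨max A A', max R R', hA.trans (le_max_left _ _), hR.trans (le_max_left _ _), ?_⟩
    rintro t (ht | ht) l
    · exact (h t ht l).trans (by gcongr <;> exact le_max_left _ _)
    · exact (h' t ht l).trans (by gcongr <;> exact le_max_right _ _)
  · intro t0 ht0
    obtain ⟨A, R, δ, hA, hR, hδ, h⟩ := an_local (h t0 ht0)
    refine ⟨Metric.ball t0 δ, mem_nhdsWithin_of_mem_nhds (Metric.ball_mem_nhds _ hδ), A, R, hA, hR, ?_⟩
    intro t ht
    exact h t (by simpa [Real.dist_eq] using ht)

theorem an_deriv {E : Type} [NormedAddCommGroup E] [NormedSpace ℝ E] [CompleteSpace E] {F : ℝ → E} {s : Set ℝ}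
    (h : AnalyticOnNhd ℝ F s) (l : ℕ) {t : ℝ} (ht : t ∈ s) :
    HasDerivAt (fun r => ((l.factorial : ℝ)⁻¹) • iteratedDeriv l F r)
      (((l:ℝ) + 1) • (((l + 1).factorial : ℝ)⁻¹ • iteratedDeriv (l + 1) F t)) t := by
  have h1 : DifferentiableAt ℝ (iteratedDeriv l F) t := by
    rw [iteratedDeriv_eq_iterate]; exact (h.iterated_deriv l t ht).differentiableAt
  have h2 := h1.hasDerivAt.const_smul ((l.factorial : ℝ)⁻¹)
  rw [← iteratedDeriv_succ] at h2
  convert! h2 using 1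
  rw [smul_smul]
  congr 1
  rw [Nat.factorial_succ]; push_cast
  have : (l.factorial : ℝ) ≠ 0 := by exact_mod_cast l.factorial_ne_zero
  field_simp

end HypObs
namespace HypObs
open Set MeasureTheory Filter Topology

theorem det_const {ι : Type} [Fintype ι] (Bd : Submodule ℝ (ι → ℝ)) : ∃ CB : ℝ, 0 ≤ CB ∧ ∀ I : Finset ι,
    (∀ y ∈ Bd, (∀ i ∈ I, y i = 0) → y = 0) → ∀ e, 0 ≤ e → ∀ y ∈ Bd, (∀ i ∈ I, |y i| ≤ e) → ∀ i, |y i| ≤ CB * e := by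
  classical
  have h1 : ∀ I : Finset ι, ∃ C : ℝ, 0 ≤ C ∧ ((∀ y ∈ Bd, (∀ i ∈ I, y i = 0) → y = 0) →
      ∀ e, 0 ≤ e → ∀ y ∈ Bd, (∀ i ∈ I, |y i| ≤ e) → ∀ i, |y i| ≤ C * e) := by
    intro I
    by_cases hI : ∀ y ∈ Bd, (∀ i ∈ I, y i = 0) → y = 0
    swap
    · exact ⟨0, le_rfl, fun h => absurd h hI⟩
    set f : Bd →ₗ[ℝ] (I → ℝ) :=
      { toFun := fun y i => y.1 i.1, map_add' := fun _ _ => rfl, map_smul' := fun _ _ => rfl } with hf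
    have hk : LinearMap.ker f = ⊥ := by
      rw [LinearMap.ker_eq_bot']
      intro y hy
      exact Subtype.ext (hI y.1 y.2 fun i hi => congrFun hy ⟨i, hi⟩)
    obtain ⟨K, _, hK⟩ := f.exists_antilipschitzWith hk
    refine ⟨K, K.2, fun _ e he y hy hye i => ?_⟩
    have h2 := hK.le_mul_norm_sub ⟨y, hy⟩ 0
    rw [map_zero, add_zero, add_zero, norm_neg, norm_neg] at h2
    have h3 : ‖f ⟨y, hy⟩‖ ≤ e := (pi_norm_le_iff_of_nonneg he).2 fun i => hye i.1 i.2
    calc |y i| ≤ ‖y‖ := norm_le_pi_norm y i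
      _ ≤ K * ‖f ⟨y, hy⟩‖ := h2
      _ ≤ K * e := mul_le_mul_of_nonneg_left h3 K.2
  choose C hC0 hC using h1
  refine ⟨∑ I, C I, Finset.sum_nonneg fun I _ => hC0 I, fun I hI e he y hy hye i => (hC I hI e he y hy hye i).trans ?_⟩
  exact mul_le_mul_of_nonneg_right (Finset.single_le_sum (fun I _ => hC0 I) (Finset.mem_univ I)) he

def BdB {k m : ℕ} (B : Matrix (Fin k) (Fin m) ℝ) : Submodule ℝ (Fin (k + m) → ℝ) where
  carrier := {y | ∀ i : Fin m, y (Fin.natAdd k i) = -∑ j : Fin k, B j i * y (Fin.castAdd m j)}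
  add_mem' := fun {y z} hy hz i => by
    simp only [mem_setOf_eq] at hy hz
    simp only [Pi.add_apply, hy i, hz i, mul_add, Finset.sum_add_distrib]; ring
  zero_mem' := fun i => by simp
  smul_mem' := fun c y hy i => by
    simp only [mem_setOf_eq] at hy
    simp only [Pi.smul_apply, smul_eq_mul, hy i, mul_neg, Finset.mul_sum]
    congr 1
    exact Finset.sum_congr rfl fun j _ => by ring

theorem inj {k m : ℕ} (hkm : k ≤ m) (B : Matrix (Fin k) (Fin m) ℝ)
    (p5 : ∀ i, 1 ≤ i → i ≤ k → ∀ p : Fin i, k - i + p.1 < k) (p6 : ∀ i, 1 ≤ i → i ≤ k → ∀ p : Fin i, m - i + p.1 < m)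
    (hB : ∀ i (h1 : 1 ≤ i) (hik : i ≤ k),
      (Matrix.of fun p q : Fin i =>
        B ⟨k - i + p.1, p5 i h1 hik p⟩ ⟨m - i + q.1, p6 i h1 hik q⟩).det ≠ 0)
    (q : ℕ) (hq : q ≤ k) (y : Fin (k + m) → ℝ) (hy : y ∈ BdB B)
    (h1 : ∀ j : Fin k, j.1 < q → y (Fin.castAdd m j) = 0)
    (h2 : ∀ i : Fin m, m - k + q ≤ i.1 → y (Fin.natAdd k i) = 0) : y = 0 := by
  have hm : ∀ j : Fin k, y (Fin.castAdd m j) = 0 := by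
    by_cases hqk : q = k
    · intro j; exact h1 j (by have := j.2; omega)
    have hdet := hB (k - q) (by omega) (by omega)
    set z : Fin (k - q) → ℝ := fun p => y (Fin.castAdd m ⟨k - (k - q) + p.1, by have := p.2; omega⟩) with hz
    have hz0 : z = 0 := by
      refine Matrix.eq_zero_of_vecMul_eq_zero hdet ?_
      ext c
      have h3 := hy ⟨m - (k - q) + c.1, by have := c.2; omega⟩
      rw [h2 _ (by simp only; omega), eq_comm, neg_eq_zero] at h3
      rw [Pi.zero_apply, ← h3]
      rw [Matrix.vecMul, dotProduct]
      refine Finset.sum_of_injOn (fun p : Fin (k - q) => (⟨k - (k - q) + p.1, by have := p.2; omega⟩ : Fin k)) ?_ ?_ ?_ ?_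
      · intro p _ p' _ h
        simp only [Fin.mk.injEq] at h
        exact Fin.ext (by omega)
      · intro p _; simp
      · intro j _ hj
        rw [h1 j, mul_zero]
        by_contra hc
        exact hj ⟨⟨j.1 - q, by have := j.2; omega⟩, by simp, Fin.ext (by simp only; omega)⟩
      · intro p _
        simp only [hz, Matrix.of_apply]; ring
    intro j
    by_cases hj : j.1 < q
    · exact h1 j hj
    · have := congrFun hz0 ⟨j.1 - q, by have := j.2; omega⟩
      simp only [hz, Pi.zero_apply] at this
      rw [← this]; congr 2; exact Fin.ext (by simp only; omega)
  ext i
  refine Fin.addCases (fun j => ?_) (fun j => ?_) i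
  · simp [hm j]
  · rw [hy j]; simp [hm]

end HypObs
namespace HypObs
open Set MeasureTheory Filter Topology

theorem BPc {k m : ℕ} (hkm : k ≤ m) (B : Matrix (Fin k) (Fin m) ℝ)
    (p5 : ∀ i, 1 ≤ i → i ≤ k → ∀ p : Fin i, k - i + p.1 < k) (p6 : ∀ i, 1 ≤ i → i ≤ k → ∀ p : Fin i, m - i + p.1 < m)
    (hB : ∀ i (h1 : 1 ≤ i) (hik : i ≤ k),
      (Matrix.of fun p q : Fin i =>
        B ⟨k - i + p.1, p5 i h1 hik p⟩ ⟨m - i + q.1, p6 i h1 hik q⟩).det ≠ 0)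
    (τ : Fin (k + m) → ℝ) (hτ0 : ∀ i, 0 < τ i)
    (hpl : ∀ i j : Fin (k + m), k ≤ (i : ℕ) → (i : ℕ) ≤ j → τ j ≤ τ i) (Topt : ℝ)
    (p3 : ∀ i : Fin k, i.1 < k + m) (p4 : ∀ i : Fin k, m + i.1 < k + m)
    (hT : ∀ i : Fin k, τ ⟨i.1, p3 i⟩ + τ ⟨m + i.1, p4 i⟩ ≤ Topt) :
    ∃ CB : ℝ, 0 ≤ CB ∧ (∀ β t e : ℝ, Topt ≤ β → t ∈ Icc 0 β → 0 ≤ e → ∀ y ∈ BdB B,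
      (∀ i : Fin (k + m), t - (if (i:ℕ) < k then -τ i else τ i) ∈ Icc 0 β → |y i| ≤ e) → ∀ i, |y i| ≤ CB * e) ∧
      ∀ e : ℝ, 0 ≤ e → ∀ y ∈ BdB B, (∀ i : Fin (k + m), k ≤ (i:ℕ) → |y i| ≤ e) → ∀ i, |y i| ≤ CB * e := by
  classical
  obtain ⟨CB, h0, h⟩ := det_const (BdB B)
  refine ⟨CB, h0, fun β t e hβ ht he y hy hye => ?_, fun e he y hy hye => ?_⟩
  · refine h (Finset.univ.filter fun i => t - (if (i:ℕ) < k then -τ i else τ i) ∈ Icc 0 β) ?_ e he y hy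
      fun i hi => hye i (by simpa using hi)
    intro z hz hz0
    have hz0' : ∀ i : Fin (k + m), t - (if (i:ℕ) < k then -τ i else τ i) ∈ Icc 0 β → z i = 0 :=
      fun i hi => hz0 i (by simpa using hi)
    have hq : ∃ q ≤ k, (∀ j : Fin k, j.1 < q → t + τ (Fin.castAdd m j) ≤ β) ∧
        ∀ hq : q < k, β < t + τ ⟨q, by exact p3 ⟨q, hq⟩⟩ := by
      by_cases hex : ∃ q, ∃ hq : q < k, β < t + τ ⟨q, by exact p3 ⟨q, hq⟩⟩
      · obtain ⟨h1, h2⟩ := Nat.find_spec hex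
        refine ⟨Nat.find hex, h1.le, fun j hj => ?_, fun _ => h2⟩
        by_contra hc
        exact Nat.find_min hex hj ⟨j.2, not_le.1 hc⟩
      · refine ⟨k, le_rfl, fun j _ => ?_, fun hq => absurd hq (lt_irrefl _)⟩
        by_contra hc
        exact hex ⟨j.1, j.2, not_le.1 hc⟩
    obtain ⟨q, hqk, hq1, hq2⟩ := hq
    refine inj hkm B p5 p6 hB q hqk z hz (fun j hj => hz0' _ ?_) (fun i hi => hz0' _ ?_)
    · have := hq1 j hj
      have := hτ0 (Fin.castAdd m j)
      rw [if_pos (by simp)]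
      constructor <;> linarith [ht.1]
    · rw [if_neg (by simp)]
      have hτ := hτ0 (Fin.natAdd k i)
      have hqk' : q < k := by have := i.2; omega
      have h1 := hq2 hqk'
      have h2 := hT ⟨q, hqk'⟩
      have h3 := hpl ⟨m + q, p4 ⟨q, hqk'⟩⟩ (Fin.natAdd k i) (by simp only; omega) (by simp only [Fin.val_natAdd]; omega)
      simp only at h2
      constructor <;> linarith [ht.2]
  · refine h (Finset.univ.filter fun i => k ≤ (i:ℕ)) ?_ e he y hy fun i hi => hye i (by simpa using hi)
    intro z hz hz0
    exact inj hkm B p5 p6 hB 0 (Nat.zero_le _) z hz (fun j hj => absurd hj (Nat.not_lt_zero _))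
      (fun i _ => hz0 _ (by simp))

theorem tau_facts (k m : ℕ) (hk : 1 ≤ k) (hkm : k ≤ m)
    (lam : Fin (k + m) → ℝ → ℝ)
    (hc : ∀ i, ContinuousOn (lam i) (Icc 0 1))
    (hpos : ∀ i, ∀ x ∈ Icc (0:ℝ) 1, 0 < lam i x)
    (hdec : ∀ i j : Fin (k + m), (i : ℕ) < (j : ℕ) → (j : ℕ) < k →
      ∀ x ∈ Icc (0:ℝ) 1, lam j x < lam i x)
    (hinc : ∀ i j : Fin (k + m), k ≤ (i : ℕ) → (i : ℕ) < (j : ℕ) →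
      ∀ x ∈ Icc (0:ℝ) 1, lam i x < lam j x)
    (τ : Fin (k + m) → ℝ) (hτ : ∀ i, τ i = ∫ x in (0:ℝ)..1, (lam i x)⁻¹)
    (p1 : k - 1 < k + m) (p2 : k < k + m) (p3 : ∀ i : Fin k, i.1 < k + m) (p4 : ∀ i : Fin k, m + i.1 < k + m)
    (T₁ : ℝ) (hT₁ : T₁ = τ ⟨k - 1, p1⟩ + τ ⟨k, p2⟩)
    (Topt : ℝ)
    (hTopt : Topt =
      max (⨆ i : Fin k,
          (τ ⟨i.1, p3 i⟩ + τ ⟨m + i.1, p4 i⟩))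
        (τ ⟨k, p2⟩)) :
    (∀ i, 0 < τ i) ∧ (∀ i j : Fin (k + m), k ≤ (i : ℕ) → (i : ℕ) ≤ j → τ j ≤ τ i) ∧
    (∀ i : Fin k, τ ⟨i.1, p3 i⟩ + τ ⟨m + i.1, p4 i⟩ ≤ Topt) ∧
    (∀ i, τ i ≤ Topt) ∧ Topt ≤ T₁ := by
  have hci : ∀ i, ContinuousOn (fun x => (lam i x)⁻¹) (Icc 0 1) := fun i => (hc i).inv₀ fun x hx => (hpos i x hx).ne'
  have hii : ∀ i, IntervalIntegrable (fun x => (lam i x)⁻¹) volume 0 1 := fun i =>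
    (hci i).intervalIntegrable_of_Icc zero_le_one
  have h0 : ∀ i, 0 < τ i := fun i => by
    rw [hτ]
    exact intervalIntegral.intervalIntegral_pos_of_pos_on (hii i)
      (fun x hx => inv_pos.2 (hpos i x (Ioo_subset_Icc_self hx))) zero_lt_one
  have hcmp : ∀ i j, (∀ x ∈ Icc (0:ℝ) 1, lam i x < lam j x) → τ j ≤ τ i := fun i j h => by
    rw [hτ, hτ]
    exact intervalIntegral.integral_mono_on zero_le_one (hii j) (hii i) fun x hx =>
      inv_anti₀ (hpos i x hx) (h x hx).le
  have hpl : ∀ i j : Fin (k + m), k ≤ (i : ℕ) → (i : ℕ) ≤ j → τ j ≤ τ i := fun i j hi hij => by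
    rcases hij.lt_or_eq with h | h
    · exact hcmp _ _ (hinc i j hi h)
    · rw [Fin.ext h]
  have hmi : ∀ i j : Fin (k + m), (i : ℕ) ≤ j → (j : ℕ) < k → τ i ≤ τ j := fun i j hij hj => by
    rcases hij.lt_or_eq with h | h
    · exact hcmp _ _ (hdec i j h hj)
    · rw [Fin.ext h]
  have hT : ∀ i : Fin k, τ ⟨i.1, p3 i⟩ + τ ⟨m + i.1, p4 i⟩ ≤ Topt := fun i => by
    rw [hTopt]
    exact le_max_of_le_left (le_ciSup (f := fun i : Fin k => τ ⟨i.1, p3 i⟩ +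
      τ ⟨m + i.1, p4 i⟩) (Set.finite_range _).bddAbove i)
  have hTk : τ ⟨k, p2⟩ ≤ Topt := by rw [hTopt]; exact le_max_right _ _
  refine ⟨h0, hpl, hT, fun i => ?_, ?_⟩
  · by_cases hi : (i:ℕ) < k
    · exact le_trans (by have := h0 ⟨m + i.1, p4 ⟨i.1, hi⟩⟩; simp only; linarith) (hT ⟨i.1, hi⟩)
    · exact (hpl _ i (by simp) (by simp only; omega)).trans hTk
  · have : Nonempty (Fin k) := ⟨⟨0, by omega⟩⟩
    rw [hTopt, hT₁]
    refine max_le (ciSup_le fun i => add_le_add (hmi _ _ ?_ ?_) (hpl _ _ ?_ ?_)) ?_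
    · have := i.2; simp only; omega
    · simp only; omega
    · simp
    · simp only; omega
    · have := h0 ⟨k - 1, p1⟩; linarith

end HypObs
namespace HypObs
open Set MeasureTheory Filter Topology

noncomputable def ep {k m : ℕ} (i : Fin (k + m)) : ℝ := if (i:ℕ) < k then -1 else 1

noncomputable def pj (x : ℝ) : Icc (0:ℝ) 1 := projIcc 0 1 zero_le_one x

theorem pj_cont : Continuous pj := continuous_projIcc (h := zero_le_one)

theorem pj_of {x : ℝ} (hx : x ∈ Icc (0:ℝ) 1) : pj x = ⟨x, hx⟩ := projIcc_of_mem _ hx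

noncomputable def Sg {k m : ℕ} (lam : Fin (k + m) → ℝ → ℝ) (i : Fin (k + m)) (x : ℝ) : ℝ :=
  ep i * (lam i (pj x))⁻¹

theorem Sg_cont {k m : ℕ} {lam : Fin (k + m) → ℝ → ℝ} (hc : ∀ i, ContinuousOn (lam i) (Icc 0 1))
    (hpos : ∀ i, ∀ x ∈ Icc (0:ℝ) 1, 0 < lam i x) (i : Fin (k + m)) : Continuous (Sg lam i) := by
  refine continuous_const.mul (Continuous.inv₀ ?_ fun x => (hpos i _ (pj x).2).ne')
  exact (hc i).comp_continuous (continuous_subtype_val.comp pj_cont) fun x => (pj x).2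

theorem Sg_abs {k m : ℕ} {lam : Fin (k + m) → ℝ → ℝ} (hpos : ∀ i, ∀ x ∈ Icc (0:ℝ) 1, 0 < lam i x) (i : Fin (k + m))
    (x : ℝ) : |Sg lam i x| = (lam i (pj x))⁻¹ := by
  have := hpos i _ (pj x).2
  unfold Sg ep; split_ifs <;> simp [abs_of_pos this]

set_option maxHeartbeats 1000000 in
theorem mkSys (k m : ℕ) (hkm : k ≤ m)
    (lam : Fin (k + m) → ℝ → ℝ)
    (hc : ∀ i, ContinuousOn (lam i) (Icc 0 1))
    (hpos : ∀ i, ∀ x ∈ Icc (0:ℝ) 1, 0 < lam i x)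
    (hdec : ∀ i j : Fin (k + m), (i : ℕ) < (j : ℕ) → (j : ℕ) < k →
      ∀ x ∈ Icc (0:ℝ) 1, lam j x < lam i x)
    (hinc : ∀ i j : Fin (k + m), k ≤ (i : ℕ) → (i : ℕ) < (j : ℕ) →
      ∀ x ∈ Icc (0:ℝ) 1, lam i x < lam j x)
    (τ : Fin (k + m) → ℝ) (hτ : ∀ i, τ i = ∫ x in (0:ℝ)..1, (lam i x)⁻¹)
    (Topt : ℝ) (hτ0 : ∀ i, 0 < τ i) (hτT : ∀ i, τ i ≤ Topt)
    (B : Matrix (Fin k) (Fin m) ℝ) (CB : ℝ) (hCB : 0 ≤ CB)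
    (hBP : ∀ β t e : ℝ, Topt ≤ β → t ∈ Icc 0 β → 0 ≤ e → ∀ y ∈ BdB B,
      (∀ i : Fin (k + m), t - (if (i:ℕ) < k then -τ i else τ i) ∈ Icc 0 β → |y i| ≤ e) → ∀ i, |y i| ≤ CB * e)
    (a b : ℝ)
    (F : ℝ → C(Icc (0:ℝ) 1, Fin (k + m) → Fin (k + m) → ℝ))
    (hFa : AnalyticOnNhd ℝ F (Ioo a b)) (T0 : ℝ) (hTo0 : 0 < Topt) (hT0 : Topt < T0) (hI : Icc 0 T0 ⊆ Ioo a b) :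
    ∃ s : Sys (Fin (k + m)), s.T = T0 ∧ s.S = Sg lam ∧ s.Bd = BdB B ∧
      ∀ i j t x, s.M 0 i j t x = F t (pj x) j i * Sg lam j x := by
  have hSc := Sg_cont hc hpos
  set G : ℕ → ℝ → C(Icc (0:ℝ) 1, Fin (k + m) → Fin (k + m) → ℝ) := fun l t =>
    ((l.factorial : ℝ)⁻¹) • iteratedDeriv l F t with hG
  obtain ⟨A, R, hA, hR, hAR⟩ := an_bound (isCompact_Icc (a := (0:ℝ)) (b := T0)) fun t ht => hFa t (hI ht)
  have hGd : ∀ l, ∀ t ∈ Icc 0 T0, HasDerivAt (G l) (((l:ℝ) + 1) • G (l + 1) t) t := fun l t ht => an_deriv hFa l (hI ht)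
  obtain ⟨σ, hσ⟩ := isCompact_Icc.exists_bound_of_continuousOn (s := Icc (0:ℝ) 1)
    (continuous_pi fun i => hSc i).continuousOn
  have hΘ : ∀ i, ∫ x in (0:ℝ)..1, Sg lam i x = if (i:ℕ) < k then -τ i else τ i := by
    intro i
    have : ∫ x in (0:ℝ)..1, Sg lam i x = ∫ x in (0:ℝ)..1, ep i * (lam i x)⁻¹ := by
      refine intervalIntegral.integral_congr fun x hx => ?_
      rw [uIcc_of_le zero_le_one] at hx
      simp only [Sg, pj_of hx]
    rw [this, intervalIntegral.integral_const_mul, ← hτ, ep]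
    split_ifs <;> ring
  refine ⟨{ S := Sg lam, hS := hSc, sgn := ?_, dist := ?_, T := T0, Topt := Topt, hT0 := hTo0, hT := hT0
            M := fun l i j t x => G l t (pj x) j i * Sg lam j x
            hM := ?_, hMd := ?_, A := A * |σ|, R := R, hA := by positivity, hR := hR, hMb := ?_, Bd := BdB B, CB := CB
            hCB := hCB, hΘ := ?_, BP := ?_ }, rfl, rfl, rfl, ?_⟩
  · intro i
    by_cases hi : (i:ℕ) < k
    · right; intro x
      have := inv_pos.2 (hpos i _ (pj x).2)
      simp only [Sg, ep, if_pos hi]; linarith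
    · left; intro x
      have := inv_pos.2 (hpos i _ (pj x).2)
      simp only [Sg, ep, if_neg hi]; linarith
  · intro i j hij x h
    have h1 := inv_pos.2 (hpos i _ (pj x).2)
    have h2 := inv_pos.2 (hpos j _ (pj x).2)
    have hne : (i:ℕ) ≠ j := fun h => hij (Fin.ext h)
    by_cases hi : (i:ℕ) < k <;> by_cases hj : (j:ℕ) < k <;> simp only [Sg, ep, hi, hj, if_true, if_false] at h
    · have h3 : lam i (pj x) = lam j (pj x) := inv_injective (by linarith)
      rcases hne.lt_or_gt with h4 | h4
      · exact (hdec i j h4 hj _ (pj x).2).ne h3.symm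
      · exact (hdec j i h4 hi _ (pj x).2).ne h3
    · linarith
    · linarith
    · have h3 : lam i (pj x) = lam j (pj x) := inv_injective (by linarith)
      rcases hne.lt_or_gt with h4 | h4
      · exact (hinc i j (not_lt.1 hi) h4 _ (pj x).2).ne h3
      · exact (hinc j i (not_lt.1 hj) h4 _ (pj x).2).ne h3.symm
  · intro l i j
    refine ContinuousOn.mul ?_ ((hSc j).comp continuous_snd).continuousOn
    have h1 : ContinuousOn (G l) (Icc 0 T0) := fun t ht => (hGd l t ht).continuousAt.continuousWithinAt
    have h2 : ContinuousOn (fun p : ℝ × ℝ => (G l p.1, pj p.2)) (Icc 0 T0 ×ˢ Icc 0 1) :=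
      (h1.comp continuous_fst.continuousOn fun p hp => hp.1).prodMk
        ((pj_cont.comp continuous_snd).continuousOn)
    have h3 : Continuous fun p : C(Icc (0:ℝ) 1, Fin (k + m) → Fin (k + m) → ℝ) × Icc (0:ℝ) 1 => p.1 p.2 j i :=
      (continuous_apply i).comp ((continuous_apply j).comp continuous_eval)
    exact h3.comp_continuousOn h2
  · intro l i j t ht x hx
    have h1 := ((ContinuousMap.evalCLM ℝ (pj x)).hasFDerivAt.comp_hasDerivAt t (hGd l t ht))
    have h2 := (hasDerivAt_pi.1 (hasDerivAt_pi.1 h1 j) i).mul_const (Sg lam j x)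
    refine HasDerivAt.hasDerivWithinAt ?_
    convert! h2 using 1
    simp; ring
  · intro l i j t ht x hx
    rw [abs_mul]
    have h1 : |G l t (pj x) j i| ≤ A * R ^ l :=
      (norm_le_pi_norm (G l t (pj x) j) i).trans ((norm_le_pi_norm (G l t (pj x)) j).trans
        (((G l t).norm_coe_le_norm _).trans (hAR t ht l)))
    have h2 : |Sg lam j x| ≤ |σ| :=
      ((norm_le_pi_norm (fun i => Sg lam i x) j).trans (hσ x hx)).trans (le_abs_self _)
    calc _ ≤ (A * R ^ l) * |σ| := by gcongr
      _ = _ := by ring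
  · intro i
    rw [hΘ]
    split_ifs
    · rw [abs_neg, abs_of_pos (hτ0 i)]; exact hτT i
    · rw [abs_of_pos (hτ0 i)]; exact hτT i
  · intro β t e hβ ht he y hy h
    refine hBP β t e hβ ht he y hy fun i hi => h i ?_
    rw [hΘ]; exact hi
  · intro i j t x
    simp [hG]

end HypObs
namespace HypObs
open Set MeasureTheory Filter Topology

theorem ep_sq {k m : ℕ} (i : Fin (k + m)) : ep i * ep i = 1 := by unfold ep; split_ifs <;> norm_num

/-- weights making the boundary form nonnegative -/
theorem q_bd {k m : ℕ} (B : Matrix (Fin k) (Fin m) ℝ) {CB : ℝ} (hCB : 0 ≤ CB)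
    (h : ∀ e : ℝ, 0 ≤ e → ∀ y ∈ BdB B, (∀ i : Fin (k + m), k ≤ (i:ℕ) → |y i| ≤ e) → ∀ i, |y i| ≤ CB * e)
    (y : Fin (k + m) → ℝ) (hy : y ∈ BdB B) :
    0 ≤ ∑ i : Fin (k + m), (if (i:ℕ) < k then -1 else k * CB ^ 2 + 1) * y i ^ 2 := by
  set E : ℝ := ∑ i : Fin m, y (Fin.natAdd k i) ^ 2 with hE
  have hE0 : 0 ≤ E := Finset.sum_nonneg fun i _ => sq_nonneg _
  have h1 := h (Real.sqrt E) (Real.sqrt_nonneg _) y hy (by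
    intro i hi
    refine Real.abs_le_sqrt ?_
    have h2 := Finset.single_le_sum (f := fun i : Fin m => y (Fin.natAdd k i) ^ 2) (fun i _ => sq_nonneg _)
      (Finset.mem_univ (⟨i - k, by omega⟩ : Fin m))
    have h3 : Fin.natAdd k (⟨i - k, by omega⟩ : Fin m) = i := Fin.ext (by simp; omega)
    simpa only [h3] using h2)
  have h2 : ∀ i, y i ^ 2 ≤ CB ^ 2 * E := fun i => by
    rw [← sq_abs, ← Real.sq_sqrt hE0, ← mul_pow]
    exact pow_le_pow_left₀ (abs_nonneg _) (h1 i) 2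
  rw [Fin.sum_univ_add]
  simp only [Fin.val_castAdd, Fin.is_lt, if_true, Fin.val_natAdd, not_lt.2 (Nat.le_add_right k _), if_false]
  rw [← Finset.mul_sum, ← Finset.mul_sum, ← hE]
  have h3 : ∑ i : Fin k, y (Fin.castAdd m i) ^ 2 ≤ k * (CB ^ 2 * E) := by
    refine (Finset.sum_le_sum fun i _ => h2 _).trans ?_
    simp
  nlinarith

end HypObs
open HypObs MeasureTheory Filter Topology
set_option maxHeartbeats 2000000 in
/-- Dual inequality for exact controllability at any time `T > T_opt` in the time-analytic
setting (consequence of Theorem 1.4 of the paper, restricted to classical adjoint solutions).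
Here `n = k + m` with `m ≥ k ≥ 1`, `Σ(x) = diag(−λ₁(x),…,−λ_k(x), λ_{k+1}(x),…,λ_{k+m}(x))`
with `λ_i` of class `C²` and derivative `λ'_i`, `τ_i = ∫₀¹ dx/λ_i(x)`, `T₁ = τ_k + τ_{k+1}`,
`T_opt = max{τ₁+τ_{m+1}, …, τ_k+τ_{m+k}, τ_{k+1}}`, every trailing principal minor of `B` of
size at most `k` is nonzero, `C` is continuous on `ℝ × [0,1]`, and `t ↦ C(t,·)` is
real-analytic on an open interval `I = (a,b) ⊇ [T_opt − T₁, T_opt]` (as a map `F` into the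
Banach space `C([0,1]; ℝ^{n×n})`). Every classical solution `v` of the adjoint system
`∂_t v = Σ(x) ∂_x v + (Σ′(x) − C(t,x)ᵀ) v` with `v₋(t,1) = 0` and
`Σ₊(0) v₊(t,0) = −Bᵀ Σ₋(0) v₋(t,0)` obeys
`∫₀ᵀ |v₊(t,1)|² dt ≥ c_T ∫₀¹ |v(T,x)|² dx`. -/
theorem stmt3 (k m : ℕ) (hk : 1 ≤ k) (hkm : k ≤ m)
    (lam lam' : Fin (k + m) → ℝ → ℝ)
    (hlamC2 : ∀ i, ContDiffOn ℝ 2 (lam i) (Icc 0 1))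
    (hlam' : ∀ i, ∀ x ∈ Icc (0:ℝ) 1, HasDerivWithinAt (lam i) (lam' i x) (Icc 0 1) x)
    (hpos : ∀ i, ∀ x ∈ Icc (0:ℝ) 1, 0 < lam i x)
    (hdec : ∀ i j : Fin (k + m), (i : ℕ) < (j : ℕ) → (j : ℕ) < k →
      ∀ x ∈ Icc (0:ℝ) 1, lam j x < lam i x)
    (hinc : ∀ i j : Fin (k + m), k ≤ (i : ℕ) → (i : ℕ) < (j : ℕ) →
      ∀ x ∈ Icc (0:ℝ) 1, lam i x < lam j x)
    (τ : Fin (k + m) → ℝ) (hτ : ∀ i, τ i = ∫ x in (0:ℝ)..1, (lam i x)⁻¹)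
    (T₁ : ℝ) (hT₁ : T₁ = τ ⟨k - 1, by omega⟩ + τ ⟨k, by omega⟩)
    (Topt : ℝ)
    (hTopt : Topt =
      max (⨆ i : Fin k,
          (τ ⟨i.1, by have := i.2; omega⟩ + τ ⟨m + i.1, by have := i.2; omega⟩))
        (τ ⟨k, by omega⟩))
    (B : Matrix (Fin k) (Fin m) ℝ)
    (hB : ∀ i (h1 : 1 ≤ i) (hik : i ≤ k),
      (Matrix.of fun p q : Fin i =>
        B ⟨k - i + p.1, by have := p.2; omega⟩ ⟨m - i + q.1, by have := q.2; omega⟩).det ≠ 0)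
    (C : ℝ → ℝ → Fin (k + m) → Fin (k + m) → ℝ)
    (hC : ContinuousOn (fun p : ℝ × ℝ => C p.1 p.2) (univ ×ˢ Icc 0 1))
    (a b : ℝ) (hI : Icc (Topt - T₁) Topt ⊆ Ioo a b)
    -- `t ↦ C(t,·)` is real-analytic on `I = (a,b)` into `C([0,1]; ℝ^{n×n})`
    (F : ℝ → C(Icc (0:ℝ) 1, Fin (k + m) → Fin (k + m) → ℝ))
    (hF : ∀ t : ℝ, ∀ x : Icc (0:ℝ) 1, F t x = C t x.1)
    (hFa : AnalyticOnNhd ℝ F (Ioo a b)) :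
    ∀ T : ℝ, Topt < T →
      ∃ c : ℝ, 0 < c ∧
        ∀ v vt vx : ℝ → ℝ → Fin (k + m) → ℝ,
          ContinuousOn (fun p : ℝ × ℝ => v p.1 p.2) (Icc 0 T ×ˢ Icc 0 1) →
          ContinuousOn (fun p : ℝ × ℝ => vt p.1 p.2) (Icc 0 T ×ˢ Icc 0 1) →
          ContinuousOn (fun p : ℝ × ℝ => vx p.1 p.2) (Icc 0 T ×ˢ Icc 0 1) →
          (∀ t ∈ Icc (0:ℝ) T, ∀ x ∈ Icc (0:ℝ) 1, ∀ i,
            HasDerivWithinAt (fun s => v s x i) (vt t x i) (Icc 0 T) t) →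
          (∀ t ∈ Icc (0:ℝ) T, ∀ x ∈ Icc (0:ℝ) 1, ∀ i,
            HasDerivWithinAt (fun y => v t y i) (vx t x i) (Icc 0 1) x) →
          -- ∂_t v = Σ(x) ∂_x v + (Σ′(x) − C(t,x)ᵀ) v
          (∀ t ∈ Icc (0:ℝ) T, ∀ x ∈ Icc (0:ℝ) 1, ∀ i : Fin (k + m),
            vt t x i = (if (i : ℕ) < k then -lam i x else lam i x) * vx t x i +
              (if (i : ℕ) < k then -lam' i x else lam' i x) * v t x i -
              ∑ j, C t x j i * v t x j) →
          -- v₋(t,1) = 0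
          (∀ t ∈ Icc (0:ℝ) T, ∀ j : Fin k, v t 1 (Fin.castAdd m j) = 0) →
          -- Σ₊(0) v₊(t,0) = −Bᵀ Σ₋(0) v₋(t,0)
          (∀ t ∈ Icc (0:ℝ) T, ∀ i : Fin m,
            lam (Fin.natAdd k i) 0 * v t 0 (Fin.natAdd k i) =
              -∑ j : Fin k, B j i * (-lam (Fin.castAdd m j) 0 * v t 0 (Fin.castAdd m j))) →
          (∫ t in (0:ℝ)..T, ∑ i : Fin m, (v t 1 (Fin.natAdd k i)) ^ 2) ≥
            c * ∫ x in (0:ℝ)..1, ∑ i, (v T x i) ^ 2 := by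
  intro T hT
  have hc : ∀ i, ContinuousOn (lam i) (Icc 0 1) := fun i => (hlamC2 i).continuousOn
  obtain ⟨hτ0, hpl, hTs, hτT, hT1⟩ := tau_facts k m hk hkm lam hc hpos hdec hinc τ hτ (by omega) (by omega)
    (fun i => by omega) (fun i => by omega) T₁ hT₁ Topt hTopt
  obtain ⟨CB, hCB, hBP, hBP2⟩ := BPc hkm B (fun i _ _ p => by omega) (fun i _ _ p => by omega) hB τ hτ0 hpl Topt
    (fun i => by omega) (fun i => by omega) hTs
  have hTo : 0 < Topt := (hτ0 ⟨k, by omega⟩).trans_le (hτT _)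
  have hb : Topt < b := (hI ⟨by linarith, le_rfl⟩).2
  have ha : a < 0 := (hI ⟨by linarith, hTo.le⟩).1
  obtain ⟨T0, hT0, hT0'⟩ := exists_between (lt_min hT hb)
  have hT0T : T0 < T := hT0'.trans_le (min_le_left _ _)
  have hT0b : T0 < b := hT0'.trans_le (min_le_right _ _)
  have hT0p : 0 < T0 := hTo.trans hT0
  have hTp : 0 < T := hTo.trans hT
  obtain ⟨s, hsT, hsS, hsB, hsM⟩ := mkSys k m hkm lam hc hpos hdec hinc τ hτ Topt hτ0 hτT B CB hCB hBP a b F hFa T0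
    hTo hT0 (fun t ht => ⟨ha.trans_le ht.1, ht.2.trans_lt hT0b⟩)
  obtain ⟨N, hN, hNo⟩ := IntObs s
  rw [hsT] at hNo
  -- bounds on lam
  have hlo : ∃ r : ℝ, 0 < r ∧ ∀ i, ∀ x ∈ Icc (0:ℝ) 1, r ≤ lam i x := by
    have h1 : ∀ i, ∃ r : ℝ, 0 < r ∧ ∀ x ∈ Icc (0:ℝ) 1, r ≤ lam i x := fun i => by
      obtain ⟨z, hz, hz2⟩ := isCompact_Icc.exists_isMinOn (nonempty_Icc.2 zero_le_one) (hc i)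
      exact ⟨lam i z, hpos i z hz, fun x hx => hz2 hx⟩
    choose r hr hr2 using h1
    haveI : Nonempty (Fin (k + m)) := ⟨⟨0, by omega⟩⟩
    refine ⟨Finset.univ.inf' Finset.univ_nonempty r, ?_, fun i x hx => ?_⟩
    · rw [Finset.lt_inf'_iff]; exact fun i _ => hr i
    · exact (Finset.inf'_le _ (Finset.mem_univ i)).trans (hr2 i x hx)
  have hhi : ∃ r : ℝ, 0 < r ∧ ∀ i, ∀ x ∈ Icc (0:ℝ) 1, lam i x ≤ r := by
    obtain ⟨σ, hσ⟩ := isCompact_Icc.exists_bound_of_continuousOn (s := Icc (0:ℝ) 1) (continuousOn_pi.2 hc)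
    refine ⟨|σ| + 1, by positivity, fun i x hx => ?_⟩
    have h1 := (norm_le_pi_norm (fun i => lam i x) i).trans (hσ x hx)
    rw [Real.norm_eq_abs] at h1
    linarith [le_abs_self σ, le_abs_self (lam i x)]
  obtain ⟨r, hr, hrl⟩ := hlo
  obtain ⟨R, hR, hRl⟩ := hhi
  have hCb : ∃ A : ℝ, 0 ≤ A ∧ ∀ t ∈ Icc 0 T, ∀ x ∈ Icc (0:ℝ) 1, ∀ i j, |C t x i j| ≤ A := by
    obtain ⟨A, hA⟩ := (isCompact_Icc.prod isCompact_Icc).exists_bound_of_continuousOn (s := Icc 0 T ×ˢ Icc (0:ℝ) 1)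
      (hC.mono fun p hp => ⟨mem_univ _, hp.2⟩)
    refine ⟨|A|, abs_nonneg _, fun t ht x hx i j => ?_⟩
    exact ((norm_le_pi_norm (C t x i) j).trans (norm_le_pi_norm (C t x) i)).trans
      ((hA (t, x) ⟨ht, hx⟩).trans (le_abs_self _))
  obtain ⟨A, hA, hAC⟩ := hCb
  have hSc := Sg_cont hc hpos
  have hSx : ∀ i, ∀ x ∈ Icc (0:ℝ) 1, Sg lam i x = ep i * (lam i x)⁻¹ := fun i x hx => by simp only [Sg, pj_of hx]
  have hSb : ∀ i x, |Sg lam i x| ≤ r⁻¹ := fun i x => by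
    rw [Sg_abs hpos]; exact inv_anti₀ hr (hrl i _ (pj x).2)
  have hq1 : (1:ℝ) ≤ k * CB ^ 2 + 1 := le_add_of_nonneg_left (by positivity)
  obtain ⟨K, hK, hKE⟩ := Energy (S := Sg lam) hSc (q := fun i => if (i:ℕ) < k then -1 else k * CB ^ 2 + 1)
    (s0 := R⁻¹) (P := k * CB ^ 2 + 1) (σ := r⁻¹) (A := A * r⁻¹) (T := T) (T0 := T0) (by positivity)
    (by positivity) (by positivity) (by positivity) hT0p hT0T.le (by
      intro i; split_ifs
      · simpa using hq1
      · rw [abs_of_nonneg (by linarith)]) (by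
      intro i x hx
      have h1 := inv_anti₀ (hpos i x hx) (hRl i x hx)
      have h2 := inv_pos.2 (hpos i x hx)
      rw [hSx i x hx]; unfold ep
      split_ifs
      · linarith
      · nlinarith) (fun i x _ => hSb i x)
  set n : ℝ := ((k + m : ℕ) : ℝ) with hn
  have hn0 : 0 ≤ n := Nat.cast_nonneg _
  set L : ℝ := (r ^ 2)⁻¹ * (K * (n * N + 1)) * R ^ 2 with hL
  have hLp : 0 < L := by positivity
  refine ⟨L⁻¹, by positivity, ?_⟩
  intro v vt vx cv cvt cvx hdt hdx hpde hb1 hb0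
  have cl : ∀ i, CO T (fun _ x => lam i x) := fun i => (hc i).comp continuousOn_snd fun p hp => hp.2
  have cvi : ∀ i, CO T (fun t x => v t x i) := fun i => continuousOn_pi.1 cv i
  have cvti : ∀ i, CO T (fun t x => vt t x i) := fun i => continuousOn_pi.1 cvt i
  have cC : ∀ i j, CO T (fun t x => C t x i j) := fun i j =>
    continuousOn_pi.1 (continuousOn_pi.1 (hC.mono fun p hp => ⟨mem_univ _, hp.2⟩) i) j
  set w : Fin (k + m) → ℝ → ℝ → ℝ := fun i t x => ep i * lam i x * v t x i with hw
  set wt : Fin (k + m) → ℝ → ℝ → ℝ := fun i t x => ep i * lam i x * vt t x i with hwt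
  set wx : Fin (k + m) → ℝ → ℝ → ℝ := fun i t x => vt t x i + ∑ j, C t x j i * v t x j with hwx
  have cw : ∀ i, CO T (w i) := fun i => (continuousOn_const.mul (cl i)).mul (cvi i)
  have cwt : ∀ i, CO T (wt i) := fun i => (continuousOn_const.mul (cl i)).mul (cvti i)
  have cwx : ∀ i, CO T (wx i) := fun i => (cvti i).add (continuousOn_finsetSum _ fun j _ => (cC j i).mul (cvi j))
  have dwt : ∀ i, ∀ t ∈ Icc 0 T, ∀ x ∈ Icc (0:ℝ) 1, HasDerivWithinAt (fun r => w i r x) (wt i t x) (Icc 0 T) t :=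
    fun i t ht x hx => (hdt t ht x hx i).const_mul _
  have dwx : ∀ i, ∀ t ∈ Icc 0 T, ∀ x ∈ Icc (0:ℝ) 1, HasDerivWithinAt (fun y => w i t y) (wx i t x) (Icc 0 1) x := by
    intro i t ht x hx
    have h1 := ((hlam' i x hx).const_mul (ep i)).mul (hdx t ht x hx i)
    convert! h1 using 1
    simp only [hwx, hpde t ht x hx i, ep]
    split_ifs <;> ring
  have hvS : ∀ i t, ∀ x ∈ Icc (0:ℝ) 1, v t x i = Sg lam i x * w i t x := by
    intro i t x hx
    have := (hpos i x hx).ne'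
    calc v t x i = (ep i * ep i) * (lam i x * (lam i x)⁻¹) * v t x i := by rw [ep_sq, mul_inv_cancel₀ this]; ring
      _ = _ := by rw [hSx i x hx]; simp only [hw]; ring
  have hvtS : ∀ i t, ∀ x ∈ Icc (0:ℝ) 1, vt t x i = Sg lam i x * wt i t x := by
    intro i t x hx
    have := (hpos i x hx).ne'
    calc vt t x i = (ep i * ep i) * (lam i x * (lam i x)⁻¹) * vt t x i := by rw [ep_sq, mul_inv_cancel₀ this]; ring
      _ = _ := by rw [hSx i x hx]; simp only [hwt]; ring
  have hsqw : ∀ i t x, w i t x ^ 2 = lam i x ^ 2 * v t x i ^ 2 := by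
    intro i t x
    calc _ = (ep i * ep i) * (lam i x ^ 2 * v t x i ^ 2) := by simp only [hw]; ring
      _ = _ := by rw [ep_sq, one_mul]
  have hbdw : ∀ t ∈ Icc 0 T, (fun i => w i t 0) ∈ BdB B := by
    intro t ht i
    have := hb0 t ht i
    simp only [hw, ep, Fin.val_castAdd, Fin.is_lt, if_true, Fin.val_natAdd, not_lt.2 (Nat.le_add_right k _), if_false]
    rw [one_mul, this]
    congr 1
    exact Finset.sum_congr rfl fun j _ => by ring
  have hsub : Icc 0 T0 ⊆ Icc 0 T := Icc_subset_Icc_right hT0T.le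
  have hcl : Cl s w wt wx := by
    refine ⟨fun i => ?_, ?_, ?_⟩
    · rw [hsT]
      have hm : Icc 0 T0 ×ˢ Icc (0:ℝ) 1 ⊆ Icc 0 T ×ˢ Icc (0:ℝ) 1 := prod_mono hsub le_rfl
      refine ⟨(cw i).mono hm, (cwt i).mono hm, (cwx i).mono hm, fun t ht x hx => ?_, fun t ht x hx => ?_⟩
      · exact (dwt i t (hsub (Ioo_subset_Icc_self ht)) x (Ioo_subset_Icc_self hx)).hasDerivAt
          (Icc_mem_nhds ht.1 (ht.2.trans hT0T))
      · exact (dwx i t (hsub (Ioo_subset_Icc_self ht)) x (Ioo_subset_Icc_self hx)).hasDerivAt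
          (Icc_mem_nhds hx.1 hx.2)
    · intro i t ht x hx
      rw [hsS, ← hvtS i t x hx]
      simp only [hwx]
      congr 1
      refine Finset.sum_congr rfl fun j _ => ?_
      rw [hsM, hF, pj_of hx, mul_assoc, ← hvS j t x hx]
    · rw [hsT, hsB]; exact fun t ht => hbdw t (hsub ht)
  have hcw1 : ∀ i, ContinuousOn (fun t => w i t 1 ^ 2) (Icc 0 T) := fun i =>
    ((cw i).comp (f := fun t : ℝ => (t, (1:ℝ))) (by fun_prop) fun t ht => ⟨ht, by simp⟩).pow 2
  set O : ℝ := ∫ t in (0:ℝ)..T, ∑ i, w i t 1 ^ 2 with hO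
  have hobs : obs T0 w ≤ O := by
    rw [hO, intervalIntegral.integral_finsetSum fun i _ => (hcw1 i).intervalIntegrable_of_Icc hTp.le]
    refine Finset.sum_le_sum fun i _ => ?_
    refine intervalIntegral.integral_mono_interval le_rfl hT0p.le hT0T.le (Eventually.of_forall fun t => sq_nonneg _)
      ((hcw1 i).intervalIntegrable_of_Icc hTp.le)
  have hE := hKE w wt wx (fun i t x => ∑ j, C t x j i * v t x j) (n * N * O) cw cwt cwx dwt dwx
    (fun i t ht x hx => by rw [← hvtS i t x hx]) (by
      intro i t ht x hx
      refine (Finset.abs_sum_le_sum_abs _ _).trans ?_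
      rw [Finset.mul_sum]
      refine Finset.sum_le_sum fun j _ => ?_
      rw [hvS j t x hx, abs_mul, abs_mul, mul_assoc]
      have h1 := hAC t ht x hx j i
      have h2 := hSb j x
      gcongr) (fun t ht => q_bd B hCB hBP2 _ (hbdw t ht)) (by
      intro x hx
      calc ∑ i, ∫ t in (0:ℝ)..T0, w i t x ^ 2 ≤ ∑ i : Fin (k + m), N * O := Finset.sum_le_sum fun i _ =>
            (hNo w wt wx hcl i x hx).trans (mul_le_mul_of_nonneg_left hobs hN.le)
        _ = n * N * O := by simp [hn]; ring)
  have cvTx : ∀ i, ContinuousOn (fun x => v T x i) (Icc 0 1) := fun i =>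
    (cvi i).comp (f := fun x : ℝ => (T, x)) (by fun_prop) fun x hx => ⟨⟨hTp.le, le_rfl⟩, hx⟩
  have hfin1 : ∫ x in (0:ℝ)..1, ∑ i, v T x i ^ 2 ≤ (r ^ 2)⁻¹ * ∫ x in (0:ℝ)..1, ∑ i, w i T x ^ 2 := by
    rw [← intervalIntegral.integral_const_mul]
    refine intervalIntegral.integral_mono_on zero_le_one ?_ ?_ fun x hx => ?_
    · exact (continuousOn_finsetSum _ fun i _ => (cvTx i).pow 2).intervalIntegrable_of_Icc zero_le_one
    · simp only [hsqw]
      exact (continuousOn_const.mul (continuousOn_finsetSum _ fun i _ =>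
        ((hc i).pow 2).mul ((cvTx i).pow 2))).intervalIntegrable_of_Icc zero_le_one
    · rw [Finset.mul_sum]
      refine Finset.sum_le_sum fun i _ => ?_
      rw [hsqw, ← mul_assoc]
      refine le_mul_of_one_le_left (sq_nonneg _) ?_
      rw [inv_mul_eq_div, one_le_div (by positivity)]
      exact pow_le_pow_left₀ hr.le (hrl i x hx) 2
  have hv1 : ∀ i, ContinuousOn (fun t => v t 1 i) (Icc 0 T) := fun i =>
    (cvi i).comp (f := fun t : ℝ => (t, (1:ℝ))) (by fun_prop) fun t ht => ⟨ht, by simp⟩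
  have hfin2 : O ≤ R ^ 2 * ∫ t in (0:ℝ)..T, ∑ i : Fin m, (v t 1 (Fin.natAdd k i)) ^ 2 := by
    rw [← intervalIntegral.integral_const_mul]
    refine intervalIntegral.integral_mono_on hTp.le ?_ ?_ fun t ht => ?_
    · exact (continuousOn_finsetSum _ fun i _ => hcw1 i).intervalIntegrable_of_Icc hTp.le
    · exact (continuousOn_const.mul (continuousOn_finsetSum _ fun i _ =>
        (hv1 _).pow 2)).intervalIntegrable_of_Icc hTp.le
    · rw [Fin.sum_univ_add, Finset.mul_sum]
      simp only [hsqw, hb1 t ht]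
      simp only [ne_eq, OfNat.ofNat_ne_zero, not_false_eq_true, zero_pow, mul_zero, Finset.sum_const_zero, zero_add]
      refine Finset.sum_le_sum fun i _ => mul_le_mul_of_nonneg_right ?_ (sq_nonneg _)
      have h1 : (1:ℝ) ∈ Icc (0:ℝ) 1 := by simp
      exact pow_le_pow_left₀ (hpos _ 1 h1).le (hRl _ 1 h1) 2
  rw [ge_iff_le, inv_mul_le_iff₀ hLp]
  calc _ ≤ _ := hfin1
    _ ≤ (r ^ 2)⁻¹ * (K * (n * N * O + O)) := mul_le_mul_of_nonneg_left hE (by positivity)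
    _ = (r ^ 2)⁻¹ * (K * (n * N + 1)) * O := by ring
    _ ≤ (r ^ 2)⁻¹ * (K * (n * N + 1)) * (R ^ 2 * ∫ t in (0:ℝ)..T, ∑ i : Fin m, (v t 1 (Fin.natAdd k i)) ^ 2) :=
        mul_le_mul_of_nonneg_left hfin2 (by positivity)
    _ = _ := by rw [hL]; ring
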